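/- arXiv:0704.0013 — 2 statements merged into one kernel-verified Lean document; each statement's English description precedes it below -/
import Mathlib

section
/- Let p be an odd prime and let k ≥ 2 be an integer with k ≡ 2 (mod (p−1)/2) or k ≡ 3 (mod (p−1)/2). Let f be a cusp form of weight k+1/2 on Γ₀(4) whose Fourier coefficients c(n) := a_f(n) at ∞ are all rational integers. Then for every positive integer j there exists a positive integer b such that for all positive integers D and F with F² ∣ D and p^b ∣ D, and every function φ : ℕ → ℤ, one has Σ_{a ∣ F} a^{k−1}·φ(a)·c(D/a²) ≡ 0 (mod p^j), the sum being over the positive divisors a of F. -/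
open Complex UpperHalfPlane Matrix MatrixGroups CongruenceSubgroup Filter Topology Manifold
open scoped Real NumberField

set_option synthInstance.maxHeartbeats 1000000
set_option maxHeartbeats 1000000

noncomputable section

/-- The Jacobi theta function `θ(τ) = Σ_{n ∈ ℤ} e^{2πin²τ}`. -/
def Theta (τ : ℍ) : ℂ := ∑' n : ℤ, Complex.exp (2 * Real.pi * Complex.I * (n : ℂ) ^ 2 * (τ : ℂ))

/-- `cτ + d` for `σ = (a,b;c,d) ∈ SL₂(ℤ)`. -/
def denomC (σ : SL(2, ℤ)) (τ : ℍ) : ℂ := (σ 1 0 : ℂ) * (τ : ℂ) + (σ 1 1 : ℂ)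

/-- `f` admits at the cusp `σ∞` an expansion `(cτ+d)^{-k} f(στ) = Σ_n c(n) e^{2πinτ/M}`
(principal branch) with coefficients `c`, width `M > 0`, coefficients vanishing below some `s₀`,
the series converging absolutely, and uniformly on `{Im τ ≥ y₀}` for every `y₀ > 0`. -/
def CuspExpansion (k : ℂ) (f : ℍ → ℂ) (σ : SL(2, ℤ)) (M : ℕ) (c : ℤ → ℂ) : Prop :=
  0 < M ∧ (∃ s₀ : ℤ, ∀ n : ℤ, n < s₀ → c n = 0) ∧
  ∀ y₀ : ℝ, 0 < y₀ →
    (∀ τ : ℍ, y₀ ≤ τ.im →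
      Summable fun n : ℤ => ‖c n * Complex.exp (2 * Real.pi * Complex.I * n * τ / M)‖) ∧
    TendstoUniformlyOn
      (fun (s : Finset ℤ) (τ : ℍ) =>
        ∑ n ∈ s, c n * Complex.exp (2 * Real.pi * Complex.I * n * τ / M))
      (fun τ => (denomC σ τ) ^ (-k) * f (σ • τ))
      Filter.atTop {τ : ℍ | y₀ ≤ τ.im}

/-- Weakly holomorphic modular form of weight `lam + 1/2` on `Γ₀(4N)`. -/
structure IsWeaklyHolo (N : ℕ) (lam : ℤ) (f : ℍ → ℂ) : Prop where
  holo : MDifferentiable 𝓘(ℂ) 𝓘(ℂ) f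
  transf : ∀ γ ∈ Gamma0 (4 * N), ∀ τ : ℍ,
    f (γ • τ) = (Theta (γ • τ) / Theta τ) ^ (2 * lam + 1 : ℤ) * f τ
  cusp : ∀ σ : SL(2, ℤ), ∃ (M : ℕ) (c : ℤ → ℂ), CuspExpansion ((lam : ℂ) + 1 / 2) f σ M c

/-- Holomorphic modular form of weight `lam + 1/2` on `Γ₀(4N)`: at every cusp one can take the
expansion to start at `0`. -/
structure IsHoloForm (N : ℕ) (lam : ℤ) (f : ℍ → ℂ) : Prop where
  holo : MDifferentiable 𝓘(ℂ) 𝓘(ℂ) f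
  transf : ∀ γ ∈ Gamma0 (4 * N), ∀ τ : ℍ,
    f (γ • τ) = (Theta (γ • τ) / Theta τ) ^ (2 * lam + 1 : ℤ) * f τ
  cusp : ∀ σ : SL(2, ℤ), ∃ (M : ℕ) (c : ℤ → ℂ),
    CuspExpansion ((lam : ℂ) + 1 / 2) f σ M c ∧ ∀ n : ℤ, n < 0 → c n = 0

/-- Cusp form of weight `lam + 1/2` on `Γ₀(4N)`: holomorphic form all of whose slashes tend to
`0` as `Im τ → ∞`. -/
structure IsCuspFormHalf (N : ℕ) (lam : ℤ) (f : ℍ → ℂ) : Prop where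
  toIsHoloForm : IsHoloForm N lam f
  decay : ∀ σ : SL(2, ℤ),
    Filter.Tendsto (fun τ : ℍ => (denomC σ τ) ^ (-((lam : ℂ) + 1 / 2)) * f (σ • τ))
      (Filter.comap UpperHalfPlane.im Filter.atTop) (nhds 0)

/-- `f(τ) = Σ_{n ∈ ℤ} a(n) e^{2πinτ}` is the Fourier expansion of `f` at `∞`. -/
def FourierAtInfty (f : ℍ → ℂ) (a : ℤ → ℂ) : Prop :=
  ∀ τ : ℍ, HasSum (fun n : ℤ => a n * Complex.exp (2 * Real.pi * Complex.I * n * τ)) (f τ)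

/-- `x ≡ y (mod 𝔭^j)` for elements of `ℂ` lying in `L`: `(x - y)·b = a` with `a ∈ 𝔭^j`,
`b ∉ 𝔭`, i.e. `v_𝔭(x - y) ≥ j`. -/
def CongMod (L : Subfield ℂ) (P : Ideal (𝓞 L)) (j : ℕ) (x y : ℂ) : Prop :=
  ∃ a b : 𝓞 L, a ∈ P ^ j ∧ b ∉ P ∧ (x - y) * ((b : L) : ℂ) = ((a : L) : ℂ)

/-- `x` is `𝔭`-integral: `x·b = a` with `a ∈ 𝒪_L`, `b ∈ 𝒪_L ∖ 𝔭`. -/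
def PIntegral (L : Subfield ℂ) (P : Ideal (𝓞 L)) (x : ℂ) : Prop :=
  ∃ a b : 𝓞 L, b ∉ P ∧ x * ((b : L) : ℂ) = ((a : L) : ℂ)

namespace MaassCongruence

open scoped ModularForm

section FormalPowerSeries

open PowerSeries

theorem natCast_dvd_powerSeries_iff {m : ℕ} {f : PowerSeries ℤ} :
    (m : PowerSeries ℤ) ∣ f ↔ ∀ n, (m : ℤ) ∣ f.coeff n := by
  constructor
  · rintro ⟨g, rfl⟩ n
    rw [← map_natCast (C (R := ℤ)), coeff_C_mul]
    simp
  · intro h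
    choose g hg using h
    refine ⟨PowerSeries.mk g, ?_⟩
    ext n
    rw [← map_natCast (C (R := ℤ)), coeff_C_mul]
    simp [hg n]

theorem prime_dvd_pow_sub_expand {p : ℕ} (hp : p.Prime) (b : ℕ) (f : PowerSeries ℤ) :
    (p : PowerSeries ℤ) ∣ f ^ p ^ b - expand (p ^ b) (pow_ne_zero b hp.ne_zero) f := by
  have := Fact.mk hp
  rw [natCast_dvd_powerSeries_iff]
  intro n
  rw [← ZMod.intCast_zmod_eq_zero_iff_dvd]
  have h1 : ∀ g : PowerSeries ℤ, ((g.coeff n : ℤ) : ZMod p) =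
      (PowerSeries.map (Int.castRingHom (ZMod p)) g).coeff n := fun g => by simp
  rw [h1, map_sub, map_pow, map_expand]
  have h2 := MvPowerSeries.map_iterateFrobenius_expand (σ := Unit) (R := ZMod p) p hp.ne_zero
    (f := PowerSeries.map (Int.castRingHom (ZMod p)) f) b
  have h3 : iterateFrobenius (ZMod p) p b = RingHom.id _ := by
    ext x
    simp [iterateFrobenius_def, ZMod.pow_card_pow]
  rw [h3] at h2
  simp only [MvPowerSeries.map_id, RingHom.id_apply] at h2
  rw [← h2]
  simp [PowerSeries.expand]

/-- The operator `∑ a(n) Xⁿ ↦ ∑ a(mn) Xⁿ`. -/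
def uOp (m : ℕ) (a : PowerSeries ℤ) : PowerSeries ℤ := PowerSeries.mk fun n => a.coeff (m * n)

@[simp]
theorem coeff_uOp (m : ℕ) (a : PowerSeries ℤ) (n : ℕ) : (uOp m a).coeff n = a.coeff (m * n) := by
  simp [uOp]

theorem uOp_mul_expand {m : ℕ} (hm : m ≠ 0) (a g : PowerSeries ℤ) :
    uOp m (a * expand m hm g) = uOp m a * g := by
  ext n
  rw [coeff_uOp, coeff_mul, coeff_mul]
  symm
  apply Finset.sum_of_injOn (fun x => (m * x.1, m * x.2))
  · rintro ⟨a, b⟩ - ⟨c, d⟩ - h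
    simp only [Prod.mk.injEq, mul_eq_mul_left_iff, hm, or_false] at h
    ext <;> simp [h]
  · rintro ⟨a, b⟩ h
    simp only [Finset.mem_coe, Finset.HasAntidiagonal.mem_antidiagonal] at h ⊢
    rw [← h]; ring
  · rintro ⟨x, y⟩ h h'
    have hy : ¬ m ∣ y := by
      rintro ⟨d, rfl⟩
      rw [Finset.HasAntidiagonal.mem_antidiagonal] at h
      have : m ∣ x := (Nat.dvd_add_left (dvd_mul_right m d)).1 (h ▸ dvd_mul_right m n)
      obtain ⟨c, rfl⟩ := this
      apply h'
      refine ⟨(c, d), ?_, rfl⟩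
      simp only [Finset.mem_coe, Finset.HasAntidiagonal.mem_antidiagonal]
      rw [← mul_add] at h
      exact Nat.eq_of_mul_eq_mul_left (Nat.pos_of_ne_zero hm) h
    simp [coeff_expand_of_not_dvd m hm g hy]
  · rintro ⟨x, y⟩ -
    simp

theorem prime_dvd_coeff_of_coeff_mul_pow_eq_zero {p : ℕ} (hp : p.Prime) (b : ℕ)
    {c E : PowerSeries ℤ} {s : ℤ} (hc : c.coeff 0 = 0) (hE : (p : PowerSeries ℤ) ∣ E - C s)
    (hs : ¬ (p : ℤ) ∣ s)
    (h : ∀ n, 1 ≤ n → ∃ g : PowerSeries ℤ, g.coeff 0 = 1 ∧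
      (c * g ^ p ^ b * E).coeff (p ^ b * n) = 0) (n : ℕ) :
    (p : ℤ) ∣ c.coeff (p ^ b * n) := by
  have hb := pow_ne_zero b hp.ne_zero
  induction n using Nat.strong_induction_on with
  | _ n ih =>
  rcases Nat.eq_zero_or_pos n with rfl | hn
  · simp only [mul_zero, hc, dvd_zero]
  obtain ⟨g, hg0, hg⟩ := h n hn
  have h1 : (p : PowerSeries ℤ) ∣ c * g ^ p ^ b * E - c * expand (p ^ b) hb g * C s := by
    have : c * g ^ p ^ b * E - c * expand (p ^ b) hb g * C s =
      c * E * (g ^ p ^ b - expand (p ^ b) hb g) + c * expand (p ^ b) hb g * (E - C s) := by ring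
    rw [this]
    exact dvd_add (dvd_mul_of_dvd_right (prime_dvd_pow_sub_expand hp b g) _)
      (dvd_mul_of_dvd_right hE _)
  have h2 := natCast_dvd_powerSeries_iff.1 h1 (p ^ b * n)
  rw [map_sub, hg, zero_sub, dvd_neg, coeff_mul_C] at h2
  have h3 : (p : ℤ) ∣ (c * expand (p ^ b) hb g).coeff (p ^ b * n) :=
    ((Nat.prime_iff_prime_int.1 hp).dvd_or_dvd h2).resolve_right hs
  rw [← coeff_uOp, uOp_mul_expand, coeff_mul] at h3
  rw [← Finset.add_sum_erase _ _ (a := (n, 0)) (by simp)] at h3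
  simp only [coeff_uOp, hg0, mul_one] at h3
  refine (dvd_add_left (Finset.dvd_sum ?_)).1 h3
  rintro ⟨x, y⟩ hxy
  simp only [Finset.mem_erase, ne_eq, Prod.mk.injEq, not_and, Finset.HasAntidiagonal.mem_antidiagonal] at hxy
  refine dvd_mul_of_dvd_left (ih x ?_) _
  omega

theorem dvd_pow_mul_sub_expand {p : ℕ} (hp : p.Prime) (i m : ℕ) (f : PowerSeries ℤ) :
    ((p ^ i : ℕ) : PowerSeries ℤ) ∣ f ^ (m * p ^ i) - expand p hp.ne_zero (f ^ (m * p ^ (i - 1))) := by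
  rcases Nat.eq_zero_or_pos i with rfl | hi
  · simp
  obtain ⟨i, rfl⟩ := Nat.exists_eq_add_of_lt hi
  simp only [zero_add, Nat.add_sub_cancel]
  have h1 := prime_dvd_pow_sub_expand hp 1 (f ^ m)
  simp only [pow_one] at h1
  have h2 := dvd_sub_pow_of_dvd_sub h1 i
  rw [pow_mul, pow_mul, map_pow _ (f ^ m)]
  push_cast
  convert h2 using 2
  rw [← pow_mul, ← pow_mul, ← pow_mul, pow_succ']

end FormalPowerSeries

section GammaZeroFour

open ModularGroup

/-- The parabolic matrix `(1, 0; 4, 1)`. -/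
def lowerU : SL(2, ℤ) := ⟨!![1, 0; 4, 1], by simp [Matrix.det_fin_two]⟩

theorem exists_two_mul_abs_add_mul_le (x : ℤ) {m : ℤ} (hm : m ≠ 0) :
    ∃ n : ℤ, 2 * |x + n * m| ≤ |m| := by
  have h0 := Int.emod_nonneg x hm
  have h1 := Int.emod_lt_abs x hm
  have h2 := Int.mul_ediv_add_emod x m
  by_cases h : 2 * (x % m) ≤ |m|
  · refine ⟨-(x / m), ?_⟩
    have : x + -(x / m) * m = x % m := by linarith [mul_comm m (x / m)]
    rw [this, abs_of_nonneg h0]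
    exact h
  · refine ⟨-(x / m) - m.sign, ?_⟩
    have : x + (-(x / m) - m.sign) * m = x % m - |m| := by
      rw [← Int.sign_mul_self_eq_abs]
      linarith [mul_comm m (x / m)]
    rw [this, abs_of_nonpos (by linarith)]
    linarith

theorem T_zpow_row (γ : SL(2, ℤ)) (n : ℤ) :
    (γ * T ^ n) 1 0 = γ 1 0 ∧ (γ * T ^ n) 1 1 = γ 1 1 + n * γ 1 0 := by
  simp [coe_T_zpow, Matrix.mul_apply, Fin.sum_univ_two]
  ring

theorem coe_lowerU_zpow (n : ℤ) : ((lowerU ^ n : SL(2, ℤ)) : Matrix (Fin 2) (Fin 2) ℤ) =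
    (!![1, 0; 4 * n, 1] : Matrix (Fin 2) (Fin 2) ℤ) := by
  have key : ∀ m : ℕ, ((lowerU ^ m : SL(2, ℤ)) : Matrix (Fin 2) (Fin 2) ℤ) =
      (!![1, 0; 4 * (m : ℤ), 1] : Matrix (Fin 2) (Fin 2) ℤ) := by
    intro m
    induction m with
    | zero => ext i j; fin_cases i <;> fin_cases j <;> simp
    | succ m ih =>
      rw [pow_succ, Matrix.SpecialLinearGroup.coe_mul, ih]
      simp [lowerU]
      try ring
  rcases Int.eq_nat_or_neg n with ⟨m, rfl | rfl⟩
  · rw [zpow_natCast, key]; try simp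
  · rw [_root_.zpow_neg, zpow_natCast, Matrix.SpecialLinearGroup.coe_inv, key]
    simp [Matrix.adjugate_fin_two]

theorem lowerU_zpow_row (γ : SL(2, ℤ)) (n : ℤ) :
    (γ * lowerU ^ n) 1 0 = γ 1 0 + n * (4 * γ 1 1) ∧ (γ * lowerU ^ n) 1 1 = γ 1 1 := by
  have h := coe_lowerU_zpow n
  rw [Matrix.SpecialLinearGroup.coe_mul, h]
  simp [Matrix.mul_apply, Fin.sum_univ_two]
  ring

theorem mem_gamma0_four_iff (γ : SL(2, ℤ)) : γ ∈ Gamma0 4 ↔ (4 : ℤ) ∣ γ 1 0 := by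
  rw [CongruenceSubgroup.Gamma0_mem, ZMod.intCast_zmod_eq_zero_iff_dvd]
  rfl

theorem gamma0_four_le {H : Subgroup SL(2, ℤ)} (hT : T ∈ H) (hU : lowerU ∈ H) (hn : -1 ∈ H) :
    Gamma0 4 ≤ H := by
  intro γ hγ
  rw [mem_gamma0_four_iff] at hγ
  induction hc : (γ 1 0).natAbs using Nat.strong_induction_on generalizing γ with
  | _ m ih =>
  have hdet := γ.det_coe
  rw [Matrix.det_fin_two] at hdet
  rcases eq_or_ne (γ 1 0) 0 with h0 | h0
  · rw [h0, mul_zero, sub_zero] at hdet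
    rcases Int.mul_eq_one_iff_eq_one_or_neg_one.1 hdet with ⟨h1, h2⟩ | ⟨h1, h2⟩
    · have : γ = T ^ (γ 0 1) := by
        ext i j
        rw [coe_T_zpow]
        fin_cases i <;> fin_cases j <;> simp [h0, h1, h2]
      rw [this]
      exact zpow_mem hT _
    · have : γ = -T ^ (-γ 0 1) := by
        ext i j
        rw [Matrix.SpecialLinearGroup.coe_neg, coe_T_zpow]
        fin_cases i <;> fin_cases j <;> simp [h0, h1, h2]
      rw [this, ← neg_one_mul]
      exact mul_mem hn (zpow_mem hT _)
  · obtain ⟨n, hn1⟩ := exists_two_mul_abs_add_mul_le (γ 1 1) h0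
    set γ₁ := γ * T ^ n with hγ₁
    obtain ⟨r0, r1⟩ := T_zpow_row γ n
    rw [← hγ₁] at r0 r1
    rw [← r1] at hn1
    have hdet1 := γ₁.det_coe
    rw [Matrix.det_fin_two, r0] at hdet1
    obtain ⟨t, ht⟩ := hγ
    have hodd : ¬ (2 : ℤ) ∣ γ₁ 1 1 := by
      rintro ⟨s, hs⟩
      rw [hs, ht] at hdet1
      have : (2 : ℤ) ∣ 1 := ⟨γ₁ 0 0 * s - γ₁ 0 1 * (2 * t), by linarith⟩
      norm_num at this
    have hd0 : γ₁ 1 1 ≠ 0 := fun h => hodd (h ▸ dvd_zero 2)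
    obtain ⟨m', hm'⟩ := exists_two_mul_abs_add_mul_le (γ₁ 1 0) (mul_ne_zero four_ne_zero hd0)
    set γ₂ := γ₁ * lowerU ^ m' with hγ₂
    obtain ⟨s0, s1⟩ := lowerU_zpow_row γ₁ m'
    rw [← hγ₂] at s0 s1
    rw [← s0] at hm'
    have hlt : (γ₂ 1 0).natAbs < m := by
      rw [← hc]
      have hne : |γ 1 0| ≠ 2 * |γ₁ 1 1| := by
        intro h
        rw [ht, abs_mul, Nat.abs_ofNat] at h
        apply hodd
        rw [← dvd_abs]
        exact ⟨|t|, by linarith⟩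
      rw [abs_mul, Nat.abs_ofNat] at hm'
      zify
      omega
    have hdvd : (4 : ℤ) ∣ γ₂ 1 0 := by
      rw [s0, r0, ht]
      exact ⟨t + m' * γ₁ 1 1, by ring⟩
    have h2 := ih _ hlt hdvd rfl
    have : γ = γ₂ * (lowerU ^ m')⁻¹ * (T ^ n)⁻¹ := by
      rw [hγ₂, hγ₁]; group
    rw [this]
    exact mul_mem (mul_mem h2 (inv_mem (zpow_mem hU _))) (inv_mem (zpow_mem hT _))

theorem slash_neg_one {k : ℤ} (hk : Even k) (f : ℍ → ℂ) : f ∣[k] (-1 : SL(2, ℤ)) = f := by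
  ext τ
  rw [ModularForm.SL_slash_apply, ModularGroup.SL_neg_smul, one_smul]
  have := ModularGroup.denom_apply (-1) τ
  rw [this]
  simp [hk.neg_one_zpow]

theorem slash_eq_of_generators {k : ℤ} (hk : Even k) {f : ℍ → ℂ} (hT : f ∣[k] T = f)
    (hU : f ∣[k] lowerU = f) {γ : SL(2, ℤ)} (hγ : γ ∈ Gamma0 4) : f ∣[k] γ = f := by
  let H : Subgroup SL(2, ℤ) :=
    { carrier := {γ | f ∣[k] γ = f}
      mul_mem' := fun {a b} ha hb => by
        simp only [Set.mem_ofPred_eq] at *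
        rw [SlashAction.slash_mul, ha, hb]
      one_mem' := SlashAction.slash_one _ _
      inv_mem' := fun {a} ha => by
        simp only [Set.mem_ofPred_eq] at *
        conv_lhs => rw [← ha]
        rw [← SlashAction.slash_mul, mul_inv_cancel, SlashAction.slash_one] }
  exact gamma0_four_le (H := H) hT hU (slash_neg_one hk f) hγ

end GammaZeroFour

section Forms

/-- Holomorphic modular forms of integral weight `k` on `Γ₀(4)`. -/
structure IsModForm (k : ℤ) (f : ℍ → ℂ) : Prop where
  holo : MDifferentiable 𝓘(ℂ) 𝓘(ℂ) f
  inv : ∀ γ ∈ Gamma0 4, f ∣[k] γ = f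
  bdd : ∀ σ : SL(2, ℤ), IsBoundedAtImInfty (f ∣[k] σ)

/-- Cusp forms of integral weight `k` on `Γ₀(4)`. -/
structure IsCusp4 (k : ℤ) (f : ℍ → ℂ) : Prop where
  holo : MDifferentiable 𝓘(ℂ) 𝓘(ℂ) f
  inv : ∀ γ ∈ Gamma0 4, f ∣[k] γ = f
  zero : ∀ σ : SL(2, ℤ), IsZeroAtImInfty (f ∣[k] σ)

theorem IsModForm.mul {k l : ℤ} {f g : ℍ → ℂ} (hf : IsModForm k f) (hg : IsModForm l g) :
    IsModForm (k + l) (f * g) where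
  holo := hf.holo.mul hg.holo
  inv γ hγ := by rw [ModularForm.mul_slash_SL2, hf.inv γ hγ, hg.inv γ hγ]
  bdd σ := by
    rw [ModularForm.mul_slash_SL2]
    exact (hf.bdd σ).mul (hg.bdd σ)

theorem IsCusp4.mul {k l : ℤ} {f g : ℍ → ℂ} (hf : IsCusp4 k f) (hg : IsModForm l g) :
    IsCusp4 (k + l) (f * g) where
  holo := hf.holo.mul hg.holo
  inv γ hγ := by rw [ModularForm.mul_slash_SL2, hf.inv γ hγ, hg.inv γ hγ]
  zero σ := by
    rw [ModularForm.mul_slash_SL2]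
    exact (hf.zero σ).zero_mul_isBoundedUnder_le (by
      have := hg.bdd σ
      exact this.isBoundedUnder_le)

theorem isModForm_const (c : ℂ) : IsModForm 0 (fun _ => c) where
  holo := mdifferentiable_const
  inv γ _ := ModularForm.is_invariant_const γ c
  bdd σ := by
    have := ModularForm.is_invariant_const σ c
    rw [show (fun _ : ℍ => c) = Function.const ℍ c from rfl, this]
    exact Filter.const_boundedAtFilter _ c

theorem IsModForm.pow {k : ℤ} {f : ℍ → ℂ} (hf : IsModForm k f) (n : ℕ) :
    IsModForm (n * k) (f ^ n) := by
  induction n with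
  | zero =>
    rw [pow_zero, Nat.cast_zero, zero_mul]
    exact isModForm_const 1
  | succ n ih =>
    rw [pow_succ]
    convert ih.mul hf using 1
    push_cast; ring

theorem isZeroAtImInfty_slash_rat {k : ℤ} {f : ℍ → ℂ}
    (hf : ∀ σ : SL(2, ℤ), IsZeroAtImInfty (f ∣[k] σ)) (g : GL (Fin 2) ℚ) (σ : SL(2, ℤ)) :
    IsZeroAtImInfty ((f ∣[k] (g.map (Rat.castHom ℝ))) ∣[k] σ) := by
  set c : OnePoint ℝ := Matrix.SpecialLinearGroup.mapGL ℝ σ • OnePoint.infty with hc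
  have hcusp : IsCusp c 𝒮ℒ := isCusp_SL2Z_iff'.2 ⟨σ, hc⟩
  have hcusp' : IsCusp ((g.map (Rat.castHom ℝ)) • c) 𝒮ℒ := by
    rw [isCusp_SL2Z_iff] at hcusp ⊢
    obtain ⟨x, hx⟩ := hcusp
    refine ⟨g • x, ?_⟩
    rw [← hx, ← Rat.coe_castHom, OnePoint.map_smul]
  have h1 : OnePoint.IsZeroAt ((g.map (Rat.castHom ℝ)) • c) f k :=
    (OnePoint.isZeroAt_iff_forall_SL2Z hcusp').2 fun γ _ => hf γ
  rw [OnePoint.IsZeroAt.smul_iff, OnePoint.isZeroAt_iff hc.symm] at h1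
  exact h1

theorem isBoundedAtImInfty_slash_rat {k : ℤ} {f : ℍ → ℂ}
    (hf : ∀ σ : SL(2, ℤ), IsBoundedAtImInfty (f ∣[k] σ)) (g : GL (Fin 2) ℚ) (σ : SL(2, ℤ)) :
    IsBoundedAtImInfty ((f ∣[k] (g.map (Rat.castHom ℝ))) ∣[k] σ) := by
  set c : OnePoint ℝ := Matrix.SpecialLinearGroup.mapGL ℝ σ • OnePoint.infty with hc
  have hcusp : IsCusp c 𝒮ℒ := isCusp_SL2Z_iff'.2 ⟨σ, hc⟩
  have hcusp' : IsCusp ((g.map (Rat.castHom ℝ)) • c) 𝒮ℒ := by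
    rw [isCusp_SL2Z_iff] at hcusp ⊢
    obtain ⟨x, hx⟩ := hcusp
    refine ⟨g • x, ?_⟩
    rw [← hx, ← Rat.coe_castHom, OnePoint.map_smul]
  have h1 : OnePoint.IsBoundedAt ((g.map (Rat.castHom ℝ)) • c) f k :=
    (OnePoint.isBoundedAt_iff_forall_SL2Z hcusp').2 fun γ _ => hf γ
  rw [OnePoint.IsBoundedAt.smul_iff, OnePoint.isBoundedAt_iff hc.symm] at h1
  exact h1

end Forms

section QExpansions

open Function.Periodic

/-- `f` is given by the convergent `q`-expansion with coefficients `A`. -/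
def HasQC (f : ℍ → ℂ) (A : PowerSeries ℂ) : Prop :=
  ∀ τ : ℍ, HasSum (fun n : ℕ => A.coeff n * qParam 1 τ ^ n) (f τ)

/-- `f` is given by the `q`-expansion with integral coefficients `a`. -/
def HasQ (f : ℍ → ℂ) (a : PowerSeries ℤ) : Prop :=
  HasQC f (a.map (Int.castRingHom ℂ))

theorem hasSum_of_eq {f g : ℕ → ℂ} {s : ℂ} (hf : HasSum f s) (h : ∀ n, g n = f n) :
    HasSum g s := by
  rwa [show g = f from funext h]

theorem HasQC.mul {f g : ℍ → ℂ} {A B : PowerSeries ℂ} (hf : HasQC f A) (hg : HasQC g B) :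
    HasQC (f * g) (A * B) := by
  intro τ
  have h1 := (hf τ).summable.norm
  have h2 := (hg τ).summable.norm
  have h3 := tsum_mul_tsum_eq_tsum_sum_antidiagonal_of_summable_norm h1 h2
  have h4 := (summable_norm_sum_mul_antidiagonal_of_summable_norm h1 h2).of_norm
  rw [(hf τ).tsum_eq, (hg τ).tsum_eq] at h3
  rw [Pi.mul_apply, h3]
  refine hasSum_of_eq h4.hasSum fun n => ?_
  rw [PowerSeries.coeff_mul, Finset.sum_mul]
  refine Finset.sum_congr rfl fun x hx => ?_
  rw [← Finset.HasAntidiagonal.mem_antidiagonal.1 hx, pow_add]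
  ring

theorem HasQC.add {f g : ℍ → ℂ} {A B : PowerSeries ℂ} (hf : HasQC f A) (hg : HasQC g B) :
    HasQC (f + g) (A + B) := by
  intro τ
  refine hasSum_of_eq ((hf τ).add (hg τ)) fun n => ?_
  simp [add_mul]

theorem hasQC_const (m : ℂ) : HasQC (fun _ => m) (PowerSeries.C m) := by
  intro τ
  refine hasSum_of_eq (hasSum_ite_eq (0 : ℕ) m) fun n => ?_
  rw [PowerSeries.coeff_C]
  rcases eq_or_ne n 0 with rfl | hn <;> simp [*]

theorem HasQC.pow {f : ℍ → ℂ} {A : PowerSeries ℂ} (hf : HasQC f A) (n : ℕ) :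
    HasQC (f ^ n) (A ^ n) := by
  induction n with
  | zero =>
    rw [pow_zero, pow_zero]
    have := hasQC_const 1
    rw [map_one] at this
    exact this
  | succ n ih => rw [pow_succ, pow_succ]; exact ih.mul hf

theorem hasQC_qParam : HasQC (fun τ => qParam 1 τ) PowerSeries.X := by
  intro τ
  refine hasSum_of_eq (hasSum_ite_eq (1 : ℕ) (qParam 1 τ)) fun n => ?_
  rw [PowerSeries.coeff_X]
  rcases eq_or_ne n 1 with rfl | hn <;> simp [*]

theorem qParam_tendsto_zero : Tendsto (fun τ : ℍ => qParam 1 (τ : ℂ)) atImInfty (𝓝 0) :=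
  UpperHalfPlane.qParam_tendsto_atImInfty one_pos

theorem HasQC.isBounded {f : ℍ → ℂ} {A : PowerSeries ℂ} (hf : HasQC f A) :
    IsBoundedAtImInfty f :=
  UpperHalfPlane.isBoundedAtImInfty_of_hasSum_qExpansion (c := fun n => A.coeff n) one_pos hf

theorem HasQC.shift {f : ℍ → ℂ} {A : PowerSeries ℂ} (hf : HasQC f A) :
    HasQC (fun τ => (f τ - A.coeff 0) / qParam 1 τ) (PowerSeries.mk fun n => A.coeff (n + 1)) := by
  intro τ
  have h2 := ((hasSum_nat_add_iff' 1).2 (hf τ)).div_const (qParam 1 τ)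
  simp only [Finset.sum_range_one, pow_zero, mul_one] at h2
  refine hasSum_of_eq h2 fun n => ?_
  rw [PowerSeries.coeff_mk, pow_succ, ← mul_assoc, mul_div_cancel_right₀ _ (qParam_ne_zero _)]

theorem HasQC.tendsto {f : ℍ → ℂ} {A : PowerSeries ℂ} (hf : HasQC f A) :
    Tendsto f atImInfty (𝓝 (A.coeff 0)) := by
  have h2 := qParam_tendsto_zero.zero_mul_isBoundedUnder_le
    (Asymptotics.IsBigO.isBoundedUnder_le hf.shift.isBounded)
  have h3 := h2.add_const (A.coeff 0)
  rw [zero_add] at h3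
  refine h3.congr fun τ => ?_
  rw [mul_div_cancel₀ _ (qParam_ne_zero _), sub_add_cancel]

theorem HasQC.eq_zero {A : PowerSeries ℂ} (hf : HasQC (fun _ => 0) A) : A = 0 := by
  ext n
  rw [map_zero]
  induction n generalizing A with
  | zero => exact tendsto_nhds_unique hf.tendsto tendsto_const_nhds
  | succ n ih =>
    have h0 : A.coeff 0 = 0 := tendsto_nhds_unique hf.tendsto tendsto_const_nhds
    have h1 := hf.shift
    simp only [h0, sub_zero, zero_div] at h1
    simpa using ih h1

theorem HasQC.unique {f : ℍ → ℂ} {A B : PowerSeries ℂ} (hf : HasQC f A) (hg : HasQC f B) :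
    A = B := by
  refine sub_eq_zero.1 (HasQC.eq_zero fun τ => ?_)
  have := (hf τ).sub (hg τ)
  rw [sub_self] at this
  exact hasSum_of_eq this fun n => by simp [sub_mul]

theorem HasQ.mul {f g : ℍ → ℂ} {a b : PowerSeries ℤ} (hf : HasQ f a) (hg : HasQ g b) :
    HasQ (f * g) (a * b) := by
  rw [HasQ, map_mul]
  exact HasQC.mul hf hg

theorem HasQ.pow {f : ℍ → ℂ} {a : PowerSeries ℤ} (hf : HasQ f a) (n : ℕ) :
    HasQ (f ^ n) (a ^ n) := by
  rw [HasQ, map_pow]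
  exact HasQC.pow hf n

theorem HasQ.hasSum {f : ℍ → ℂ} {a : PowerSeries ℤ} (hf : HasQ f a) (τ : ℍ) :
    HasSum (fun n : ℕ => (a.coeff n : ℂ) * qParam 1 τ ^ n) (f τ) :=
  hasSum_of_eq (hf τ) fun n => by simp

theorem hasQ_iff {f : ℍ → ℂ} {a : PowerSeries ℤ} : HasQ f a ↔
    ∀ τ : ℍ, HasSum (fun n : ℕ => (a.coeff n : ℂ) * qParam 1 τ ^ n) (f τ) :=
  ⟨fun h => h.hasSum, fun h τ => hasSum_of_eq (h τ) fun n => by simp⟩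

end QExpansions

section Periodicity

theorem slash_T_apply (k : ℤ) (f : ℍ → ℂ) (τ : ℍ) :
    (f ∣[k] ModularGroup.T) τ = f ((1 : ℝ) +ᵥ τ) := by
  have := ModularGroup.denom_apply ModularGroup.T τ
  rw [ModularForm.SL_slash_apply, UpperHalfPlane.modular_T_smul, this]
  simp [ModularGroup.coe_T]

theorem periodic_of_vadd {f : ℍ → ℂ} (h : ∀ τ : ℍ, f ((1 : ℝ) +ᵥ τ) = f τ) :
    Function.Periodic (f ∘ ofComplex) (1 : ℝ) := by
  intro w
  by_cases hw : 0 < w.im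
  · have h1 : 0 < (w + (1 : ℝ)).im := by simpa using hw
    simp only [Function.comp_apply, ofComplex_apply_of_im_pos h1, ofComplex_apply_of_im_pos hw]
    rw [← h ⟨w, hw⟩]
    congr 1
    ext
    simp [add_comm]
  · have h1 : (w + (1 : ℝ)).im ≤ 0 := by simpa using hw
    simp only [Function.comp_apply, ofComplex_apply_of_im_nonpos h1,
      ofComplex_apply_of_im_nonpos (not_lt.1 hw)]

theorem periodic_of_slash {k : ℤ} {f : ℍ → ℂ} (h : f ∣[k] ModularGroup.T = f) (τ : ℍ) :
    f ((1 : ℝ) +ᵥ τ) = f τ := by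
  rw [← slash_T_apply k f, h]

theorem T_mem_gamma0_four : ModularGroup.T ∈ Gamma0 4 := by
  rw [mem_gamma0_four_iff]
  simp [ModularGroup.coe_T]

theorem lowerU_mem_gamma0_four : lowerU ∈ Gamma0 4 := by
  rw [mem_gamma0_four_iff]
  simp [lowerU]

end Periodicity

section Primitive

theorem mem_ball_mul_I_iff {n : ℝ} (hn : 0 ≤ n) (z : ℂ) :
    z ∈ Metric.ball ((n : ℂ) * Complex.I) n ↔ Complex.normSq z < 2 * n * z.im := by
  rw [Metric.mem_ball, Complex.dist_eq, ← abs_of_nonneg hn, ← sq_lt_sq₀ (norm_nonneg _) (abs_nonneg _),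
    abs_of_nonneg hn, ← Complex.normSq_eq_norm_sq, Complex.normSq_apply, Complex.normSq_apply]
  simp only [sub_re, sub_im, mul_re, mul_im, ofReal_re, ofReal_im, Complex.I_re, Complex.I_im]
  constructor <;> intro h <;> nlinarith

theorem ball_mul_I_subset {m n : ℝ} (hm : 0 ≤ m) (hmn : m ≤ n) :
    Metric.ball ((m : ℂ) * Complex.I) m ⊆ Metric.ball ((n : ℂ) * Complex.I) n := by
  intro z hz
  rw [mem_ball_mul_I_iff hm] at hz
  rw [mem_ball_mul_I_iff (hm.trans hmn)]
  have h1 := Complex.normSq_nonneg z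
  have h2 : 0 < m * z.im := by linarith
  have h3 : 0 < z.im := by
    rcases hm.eq_or_lt with rfl | hm
    · simp at h2
    · exact (pos_iff_pos_of_mul_pos h2).1 hm
  nlinarith

theorem exists_hasDerivAt_upperHalfPlane {φ : ℂ → ℂ} (hφ : DifferentiableOn ℂ φ {z | 0 < z.im}) :
    ∃ Φ : ℂ → ℂ, ∀ z : ℂ, 0 < z.im → HasDerivAt Φ (φ z) z := by
  have hsub : ∀ n : ℝ, 0 ≤ n → Metric.ball ((n : ℂ) * Complex.I) n ⊆ {z | 0 < z.im} := by
    intro n hn z hz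
    rw [mem_ball_mul_I_iff hn] at hz
    have h1 := Complex.normSq_nonneg z
    have h2 : 0 < n * z.im := by linarith
    rcases hn.eq_or_lt with rfl | hm
    · simp at h2
    · exact (pos_iff_pos_of_mul_pos h2).1 hm
  have hI : ∀ n : ℕ, Complex.I ∈ Metric.ball (((n + 1 : ℕ) : ℝ) * Complex.I) ((n + 1 : ℕ) : ℝ) := by
    intro n
    rw [mem_ball_mul_I_iff (by positivity)]
    simp
    linarith
  have h := fun n : ℕ => ((hφ.mono (hsub ((n + 1 : ℕ) : ℝ) (by positivity))).isExactOn_ball).with_val_at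
    Complex.I 0
  choose F hF0 hF using h
  have hagree : ∀ m n : ℕ, m ≤ n → Set.EqOn (F m) (F n)
      (Metric.ball (((m + 1 : ℕ) : ℝ) * Complex.I) ((m + 1 : ℕ) : ℝ)) := by
    intro m n hmn
    have hss := ball_mul_I_subset (m := ((m + 1 : ℕ) : ℝ)) (n := ((n + 1 : ℕ) : ℝ))
      (by positivity) (by exact_mod_cast Nat.succ_le_succ hmn)
    refine Metric.isOpen_ball.eqOn_of_deriv_eq (convex_ball _ _).isPreconnected
      (fun z hz => (hF m z hz).differentiableAt.differentiableWithinAt)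
      (fun z hz => (hF n z (hss hz)).differentiableAt.differentiableWithinAt)
      (fun z hz => ?_) (hI m) ?_
    · rw [(hF m z hz).deriv, (hF n z (hss hz)).deriv]
    · rw [hF0, hF0]
  have hex : ∀ z : ℂ, 0 < z.im → ∃ n : ℕ,
      z ∈ Metric.ball (((n + 1 : ℕ) : ℝ) * Complex.I) ((n + 1 : ℕ) : ℝ) := by
    intro z hz
    obtain ⟨n, hn⟩ := exists_nat_gt (Complex.normSq z / z.im)
    refine ⟨n, ?_⟩
    rw [mem_ball_mul_I_iff (by positivity)]
    rw [div_lt_iff₀ hz] at hn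
    push_cast
    have : 0 ≤ (n : ℝ) * z.im := by positivity
    nlinarith
  classical
  refine ⟨fun z => if hz : 0 < z.im then F (hex z hz).choose z else 0, fun z hz => ?_⟩
  set n := (hex z hz).choose with hn
  have hzn := (hex z hz).choose_spec
  refine (hF n z hzn).congr_of_eventuallyEq ?_
  filter_upwards [Metric.isOpen_ball.mem_nhds hzn] with w hw
  have hw0 : 0 < w.im := hsub _ (by positivity) hw
  simp only [hw0, dif_pos]
  have hwm := (hex w hw0).choose_spec
  rcases le_total n (hex w hw0).choose with h | h
  · exact (hagree _ _ h hw).symm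
  · exact hagree _ _ h hwm

end Primitive

section Periods

/-- The derivative of the action of `SL(2, ℤ)` on a complex coordinate. -/
theorem hasDerivAt_moebius (γ : SL(2, ℤ)) {z : ℂ} (hz : 0 < z.im) :
    HasDerivAt (fun w : ℂ => ((γ 0 0 : ℂ) * w + γ 0 1) / ((γ 1 0 : ℂ) * w + γ 1 1))
      (((γ 1 0 : ℂ) * z + γ 1 1) ^ (-2 : ℤ)) z := by
  have hd : ((γ 1 0 : ℂ) * z + γ 1 1) ≠ 0 := by
    have := denom_ne_zero (γ : GL (Fin 2) ℝ) ⟨z, hz⟩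
    rwa [ModularGroup.denom_apply] at this
  have h1 : HasDerivAt (fun w : ℂ => (γ 0 0 : ℂ) * w + γ 0 1) (γ 0 0 : ℂ) z := by
    simpa using ((hasDerivAt_id z).const_mul (γ 0 0 : ℂ)).add_const (γ 0 1 : ℂ)
  have h2 : HasDerivAt (fun w : ℂ => (γ 1 0 : ℂ) * w + γ 1 1) (γ 1 0 : ℂ) z := by
    simpa using ((hasDerivAt_id z).const_mul (γ 1 0 : ℂ)).add_const (γ 1 1 : ℂ)
  refine (h1.div h2 hd).congr_deriv ?_
  have hdet := γ.det_coe
  rw [Matrix.det_fin_two] at hdet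
  have hdet' : (γ 0 0 : ℂ) * γ 1 1 - γ 0 1 * γ 1 0 = 1 := by exact_mod_cast hdet
  rw [_root_.zpow_neg, eq_comm, eq_div_iff (pow_ne_zero 2 hd)]
  have : ((γ 1 0 : ℂ) * z + γ 1 1) ^ (2 : ℤ) = ((γ 1 0 : ℂ) * z + γ 1 1) ^ 2 := by norm_cast
  rw [this, inv_mul_cancel₀ (pow_ne_zero 2 hd)]
  linear_combination -hdet'

theorem coe_sl_smul (γ : SL(2, ℤ)) (τ : ℍ) :
    ((γ • τ : ℍ) : ℂ) = ((γ 0 0 : ℂ) * τ + γ 0 1) / ((γ 1 0 : ℂ) * τ + γ 1 1) := by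
  rw [UpperHalfPlane.specialLinearGroup_apply]
  simp

theorem slash_two_hasDerivAt {φ : ℍ → ℂ} {Φ : ℂ → ℂ}
    (hΦ : ∀ τ : ℍ, HasDerivAt Φ (φ τ) τ) (γ : SL(2, ℤ)) (τ : ℍ) :
    HasDerivAt (fun w : ℂ => Φ (((γ 0 0 : ℂ) * w + γ 0 1) / ((γ 1 0 : ℂ) * w + γ 1 1)))
      ((φ ∣[(2 : ℤ)] γ) τ) τ := by
  have h1 := hΦ (γ • τ)
  rw [coe_sl_smul] at h1
  have h2 := h1.comp (τ : ℂ) (hasDerivAt_moebius γ τ.im_pos)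
  have := ModularGroup.denom_apply γ τ
  rw [ModularForm.SL_slash_apply, this]
  exact h2

/-- If `φ` is invariant under `γ` in weight `2`, then the period of a primitive along `γ` is
independent of the base point. -/
theorem period_const {φ : ℍ → ℂ} {Φ : ℂ → ℂ} (hΦ : ∀ τ : ℍ, HasDerivAt Φ (φ τ) τ)
    {γ : SL(2, ℤ)} (hγ : φ ∣[(2 : ℤ)] γ = φ) (τ τ' : ℍ) :
    Φ (γ • τ : ℍ) - Φ τ = Φ (γ • τ' : ℍ) - Φ τ' := by
  set D : ℂ → ℂ := fun w =>
    Φ (((γ 0 0 : ℂ) * w + γ 0 1) / ((γ 1 0 : ℂ) * w + γ 1 1)) - Φ w with hD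
  have hD' : ∀ w : ℂ, 0 < w.im → HasDerivAt D 0 w := by
    intro w hw
    have h1 := (slash_two_hasDerivAt hΦ γ ⟨w, hw⟩).sub (hΦ ⟨w, hw⟩)
    rw [hγ, sub_self] at h1
    exact h1
  have hopen : IsOpen {z : ℂ | 0 < z.im} := isOpen_lt continuous_const Complex.continuous_im
  have hconn : IsPreconnected {z : ℂ | 0 < z.im} := (convex_halfSpace_im_gt 0).isPreconnected
  have := hopen.is_const_of_deriv_eq_zero hconn
    (fun w hw => (hD' w hw).differentiableAt.differentiableWithinAt)
    (fun w hw => (hD' w hw).deriv) τ.im_pos τ'.im_pos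
  simpa only [hD, coe_sl_smul] using this

theorem period_eq_zero {φ : ℍ → ℂ} {Φ : ℂ → ℂ} (hΦ : ∀ τ : ℍ, HasDerivAt Φ (φ τ) τ)
    {γ σ : SL(2, ℤ)} (hγ : φ ∣[(2 : ℤ)] γ = φ) (hσ : IsZeroAtImInfty (φ ∣[(2 : ℤ)] σ)) (m : ℝ)
    (h : ∀ τ : ℍ, γ • (σ • τ) = σ • (m +ᵥ τ)) (τ : ℍ) : Φ (γ • τ : ℍ) - Φ τ = 0 := by
  set Ψ : ℂ → ℂ := fun w => Φ (((σ 0 0 : ℂ) * w + σ 0 1) / ((σ 1 0 : ℂ) * w + σ 1 1)) with hΨ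
  have hΨ' := slash_two_hasDerivAt hΦ σ
  rw [← norm_le_zero_iff]
  refine le_of_forall_pos_le_add fun ε hε => ?_
  rw [zero_add]
  have h1 := hσ.norm
  rw [norm_zero] at h1
  have h2 : ∀ᶠ w : ℍ in atImInfty, ‖(φ ∣[(2 : ℤ)] σ) w‖ < ε / (|m| + 1) :=
    h1.eventually_lt_const (by positivity)
  obtain ⟨A, hA⟩ := (UpperHalfPlane.atImInfty_mem _).1 h2
  set y : ℝ := max A 1 with hy
  have hy0 : 0 < y := lt_of_lt_of_le one_pos (le_max_right _ _)
  set s : Set ℂ := {z : ℂ | z.im = y} with hs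
  have hconv : Convex ℝ s := by
    intro a ha b hb t u _ _ htu
    simp only [hs, Set.mem_ofPred_eq] at ha hb ⊢
    simp [ha, hb, ← add_mul, htu]
  have hpos : ∀ z ∈ s, 0 < z.im := fun z hz => by
    simp only [hs, Set.mem_ofPred_eq] at hz
    rwa [hz]
  set w₀ : ℍ := ⟨y * Complex.I, by simpa using hy0⟩ with hw₀
  have hbound := hconv.norm_image_sub_le_of_norm_hasDerivWithin_le
    (f := Ψ) (f' := fun z => (φ ∣[(2 : ℤ)] σ) (ofComplex z)) (C := ε / (|m| + 1))
    (x := w₀) (y := (m +ᵥ w₀ : ℍ))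
    (fun z hz => by
      have := hΨ' ⟨z, hpos z hz⟩
      rw [ofComplex_apply_of_im_pos (hpos z hz)]
      exact this.hasDerivWithinAt)
    (fun z hz => by
      rw [ofComplex_apply_of_im_pos (hpos z hz)]
      refine (hA _ ?_).le
      simp only [hs, Set.mem_ofPred_eq] at hz
      change A ≤ z.im
      rw [hz]; exact le_max_left _ _)
    (by simp [hs, hw₀]) (by simp [hs, hw₀])
  rw [period_const hΦ hγ τ (σ • w₀), h w₀, coe_sl_smul, coe_sl_smul]
  refine hbound.trans ?_
  rw [UpperHalfPlane.coe_vadd, add_sub_cancel_right, norm_real, Real.norm_eq_abs,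
    div_mul_eq_mul_div, div_le_iff₀ (by positivity)]
  nlinarith [abs_nonneg m]

end Periods

section Residue

/-- The matrix `(1, 0; 2, 1)`, sending `∞` to the cusp `1/2`. -/
def lowerTwo : SL(2, ℤ) := ⟨!![1, 0; 2, 1], by simp [Matrix.det_fin_two]⟩

theorem div_pow_slash {N : ℕ} (G H : ℍ → ℂ) (σ : SL(2, ℤ)) :
    (H / G ^ N) ∣[(2 : ℤ)] σ = (H ∣[(2 * N + 2 : ℤ)] σ) * ((G ∣[(2 : ℤ)] σ)⁻¹) ^ N := by
  ext τ
  have hd := denom_ne_zero σ τ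
  simp only [ModularForm.SL_slash_apply, Pi.mul_apply, Pi.div_apply, Pi.pow_apply, Pi.inv_apply]
  set d := denom σ τ
  rw [_root_.zpow_neg, _root_.zpow_neg, zpow_add₀ hd, _root_.zpow_mul, zpow_natCast, mul_inv, mul_inv, inv_inv,
    mul_pow, inv_pow, div_eq_mul_inv]
  have : (d ^ (2 : ℤ)) ^ N ≠ 0 := by positivity
  field_simp

theorem lowerU_S_smul (τ : ℍ) :
    lowerU • (ModularGroup.S • τ) = ModularGroup.S • ((-4 : ℝ) +ᵥ τ) := by
  have h : lowerU * ModularGroup.S = ModularGroup.S * ModularGroup.T ^ (-4 : ℤ) := by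
    ext i j
    simp only [Matrix.SpecialLinearGroup.coe_mul, ModularGroup.coe_T_zpow]
    fin_cases i <;> fin_cases j <;> simp [lowerU, ModularGroup.S, Matrix.mul_apply, Fin.sum_univ_two]
  rw [← mul_smul, h, mul_smul, UpperHalfPlane.modular_T_zpow_smul]
  norm_num

theorem T_lowerU_inv_smul (τ : ℍ) :
    (ModularGroup.T * lowerU⁻¹) • (lowerTwo • τ) = lowerTwo • ((-1 : ℝ) +ᵥ τ) := by
  have h : ModularGroup.T * lowerU⁻¹ * lowerTwo = -(lowerTwo * ModularGroup.T ^ (-1 : ℤ)) := by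
    ext i j
    simp only [Matrix.SpecialLinearGroup.coe_mul, Matrix.SpecialLinearGroup.coe_neg, ModularGroup.coe_T_zpow,
      Matrix.SpecialLinearGroup.coe_inv, ModularGroup.coe_T]
    fin_cases i <;> fin_cases j <;> simp [lowerU, lowerTwo, Matrix.mul_apply, Fin.sum_univ_two, Matrix.adjugate_fin_two]
  rw [← mul_smul, h, ModularGroup.SL_neg_smul, mul_smul, UpperHalfPlane.modular_T_zpow_smul]
  norm_num

theorem primitive_periodic {φ : ℍ → ℂ} {Φ : ℂ → ℂ} (hΦ : ∀ τ : ℍ, HasDerivAt Φ (φ τ) τ)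
    (hφ : ∀ γ ∈ Gamma0 4, φ ∣[(2 : ℤ)] γ = φ) (h0 : IsZeroAtImInfty (φ ∣[(2 : ℤ)] ModularGroup.S))
    (h1 : IsZeroAtImInfty (φ ∣[(2 : ℤ)] lowerTwo)) (τ : ℍ) :
    Φ ((1 : ℝ) +ᵥ τ : ℍ) = Φ τ := by
  have hTU : ModularGroup.T * lowerU⁻¹ ∈ Gamma0 4 :=
    mul_mem T_mem_gamma0_four (inv_mem lowerU_mem_gamma0_four)
  have e0 := period_eq_zero hΦ (hφ _ lowerU_mem_gamma0_four) h0 (-4) lowerU_S_smul (lowerU⁻¹ • τ)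
  have e1 := period_eq_zero hΦ (hφ _ hTU) h1 (-1) T_lowerU_inv_smul τ
  rw [smul_inv_smul] at e0
  rw [mul_smul, UpperHalfPlane.modular_T_smul] at e1
  have e2 := period_const hΦ (hφ _ T_mem_gamma0_four) τ (lowerU⁻¹ • τ)
  rw [UpperHalfPlane.modular_T_smul, UpperHalfPlane.modular_T_smul] at e2
  linear_combination e2 + e1 + e0

theorem mdifferentiable_qParam : MDifferentiable 𝓘(ℂ) 𝓘(ℂ) (fun τ : ℍ => Function.Periodic.qParam 1 τ) := by
  rw [UpperHalfPlane.mdifferentiable_iff]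
  have : DifferentiableOn ℂ (Function.Periodic.qParam 1) {z : ℂ | 0 < z.im} :=
    (Function.Periodic.differentiable_qParam (h := 1)).differentiableOn
  refine this.congr fun z hz => ?_
  simp [ofComplex_apply_of_im_pos hz]

theorem qParam_vadd_one (τ : ℍ) :
    Function.Periodic.qParam 1 ((1 : ℝ) +ᵥ τ : ℍ) = Function.Periodic.qParam 1 (τ : ℂ) := by
  rw [UpperHalfPlane.coe_vadd, Function.Periodic.qParam, Function.Periodic.qParam,
    Complex.exp_eq_exp_iff_exists_int]
  exact ⟨1, by push_cast; ring⟩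

theorem MDifferentiable.inv_of_ne_zero {G : ℍ → ℂ} (hG : MDifferentiable 𝓘(ℂ) 𝓘(ℂ) G) (h0 : ∀ τ, G τ ≠ 0) :
    MDifferentiable 𝓘(ℂ) 𝓘(ℂ) (G⁻¹) := by
  rw [UpperHalfPlane.mdifferentiable_iff] at hG ⊢
  exact hG.inv fun z _ => h0 _

/-- The residue theorem on `X₀(4)` for the differential `H / G ^ N dτ`, whose only pole is at `∞`. -/
theorem coeff_mul_pow_eq_zero {N : ℕ} {G H : ℍ → ℂ} {u v a : PowerSeries ℤ}
    (hG : IsModForm 2 G) (hG0 : ∀ τ, G τ ≠ 0) (hGq : HasQ G (PowerSeries.X * u))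
    (hu : u.coeff 0 = 1) (huv : u * v = 1)
    (hGS : IsBoundedAtImInfty ((G ∣[(2 : ℤ)] ModularGroup.S)⁻¹))
    (hGT : IsBoundedAtImInfty ((G ∣[(2 : ℤ)] lowerTwo)⁻¹))
    (hH : IsCusp4 (2 * N + 2) H) (hHq : HasQ H a) : (a * v ^ N).coeff N = 0 := by
  classical
  have hGinv := MDifferentiable.inv_of_ne_zero hG.holo hG0
  set φ : ℍ → ℂ := H / G ^ N with hφdef
  have hφeq : φ = H * (G⁻¹) ^ N := by rw [hφdef, div_eq_mul_inv, inv_pow]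
  have hφm : MDifferentiable 𝓘(ℂ) 𝓘(ℂ) φ := by
    rw [hφeq]; exact hH.holo.mul (hGinv.pow N)
  have hφinv : ∀ γ ∈ Gamma0 4, φ ∣[(2 : ℤ)] γ = φ := by
    intro γ hγ
    rw [hφdef, div_pow_slash, hH.inv γ hγ, hG.inv γ hγ, ← hφdef, hφeq]
  have hz : ∀ σ : SL(2, ℤ), IsBoundedAtImInfty ((G ∣[(2 : ℤ)] σ)⁻¹) →
      IsZeroAtImInfty (φ ∣[(2 : ℤ)] σ) := by
    intro σ hσ
    rw [hφdef, div_pow_slash]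
    have hp : IsBoundedAtImInfty (((G ∣[(2 : ℤ)] σ)⁻¹) ^ N) := by
      have := Asymptotics.IsBigO.pow hσ N
      simp only [Pi.one_apply, one_pow] at this
      exact this
    exact (hH.zero σ).zero_mul_isBoundedUnder_le (Asymptotics.IsBigO.isBoundedUnder_le hp)
  obtain ⟨Φ, hΦ⟩ := exists_hasDerivAt_upperHalfPlane
    (UpperHalfPlane.mdifferentiable_iff.1 hφm)
  have hΦ' : ∀ τ : ℍ, HasDerivAt Φ (φ τ) τ := fun τ => by
    have := hΦ τ τ.im_pos
    simpa using this
  have hper := primitive_periodic hΦ' hφinv (hz _ hGS) (hz _ hGT)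
  set Q : ℍ → ℂ := fun τ => Function.Periodic.qParam 1 (τ : ℂ) with hQ
  set J : ℍ → ℂ := H * (Q * G⁻¹) ^ N with hJ
  have hJm : MDifferentiable 𝓘(ℂ) 𝓘(ℂ) J := hH.holo.mul ((mdifferentiable_qParam.mul hGinv).pow N)
  have hJper : Function.Periodic (J ∘ ofComplex) (1 : ℝ) := by
    refine periodic_of_vadd fun τ => ?_
    have h1 := periodic_of_slash (hH.inv _ T_mem_gamma0_four) τ
    have h2 := periodic_of_slash (hG.inv _ T_mem_gamma0_four) τ
    simp only [hJ, hQ, Pi.mul_apply, Pi.pow_apply, Pi.inv_apply, h1, h2, qParam_vadd_one]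
  -- `G / q` tends to `1`
  have hGQ : HasQC (fun τ => G τ / Q τ) (u.map (Int.castRingHom ℂ)) := by
    have := HasQC.shift hGq
    have e : (PowerSeries.mk fun n => (PowerSeries.map (Int.castRingHom ℂ) (PowerSeries.X * u)).coeff (n + 1))
        = u.map (Int.castRingHom ℂ) := by
      ext n
      simp [PowerSeries.coeff_succ_X_mul]
    rw [e] at this
    simpa using this
  have hQG : Tendsto (Q * G⁻¹) atImInfty (𝓝 1) := by
    have := hGQ.tendsto.inv₀ (by simp [hu])
    simp only [PowerSeries.coeff_map, hu] at this
    simp only [eq_intCast, Int.cast_one, inv_one] at this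
    refine this.congr fun τ => ?_
    simp [div_eq_mul_inv, mul_comm]
  have hJb : IsBoundedAtImInfty J := by
    have hHb : Tendsto H atImInfty (𝓝 0) := by
      have := hH.zero 1
      rwa [SlashAction.slash_one] at this
    have := hHb.mul (hQG.pow N)
    exact this.isBigO_one ℝ
  have hJan := UpperHalfPlane.mdifferentiable_iff.1 hJm
  have hJq : HasQC J (qExpansion 1 J) := by
    intro τ
    have := UpperHalfPlane.hasSum_qExpansion one_pos hJper hJm hJb τ
    simpa [smul_eq_mul] using this
  -- the coefficients are determined by `H`
  have hmul : HasQC H (qExpansion 1 J * (u.map (Int.castRingHom ℂ)) ^ N) := by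
    have := hJq.mul (hGQ.pow N)
    refine (show H = J * (fun τ => G τ / Q τ) ^ N from ?_) ▸ this
    ext τ
    have hq : Q τ ≠ 0 := Function.Periodic.qParam_ne_zero _
    have hg := hG0 τ
    simp only [hJ, Pi.mul_apply, Pi.pow_apply, Pi.inv_apply]
    rw [mul_assoc, ← mul_pow, show Q τ * (G τ)⁻¹ * (G τ / Q τ) = 1 by field_simp, one_pow, mul_one]
  have hcoef : qExpansion 1 J = (a * v ^ N).map (Int.castRingHom ℂ) := by
    have h1 := HasQC.unique hmul hHq
    have h2 : u.map (Int.castRingHom ℂ) * v.map (Int.castRingHom ℂ) = 1 := by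
      rw [← map_mul, huv, map_one]
    rw [map_mul, map_pow, ← h1, mul_assoc, ← mul_pow, h2, one_pow, mul_one]
  have hint : (qExpansion 1 J).coeff N = 0 := by
    rw [UpperHalfPlane.qExpansion_coeff_eq_intervalIntegral one_pos hJper hJm hJb N (t := 1) one_pos]
    rw [mul_eq_zero]
    right
    have hpt : ∀ x : ℝ, 0 < ((x : ℂ) + Complex.I).im := fun x => by simp
    have key : ∀ x : ℝ, HasDerivAt (fun y : ℝ => Φ ((y : ℂ) + Complex.I))
        (φ ⟨(x : ℂ) + Complex.I, hpt x⟩) x := by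
      intro x
      have h1 := hΦ' ⟨(x : ℂ) + Complex.I, hpt x⟩
      have h2 : HasDerivAt (fun y : ℂ => Φ (y + Complex.I)) (φ ⟨(x : ℂ) + Complex.I, hpt x⟩) (x : ℂ) :=
        HasDerivAt.comp_add_const (x : ℂ) Complex.I h1
      exact h2.comp_ofReal
    have hcont : Continuous fun x : ℝ => φ ⟨(x : ℂ) + Complex.I, hpt x⟩ := by
      refine hφm.continuous.comp ?_
      refine UpperHalfPlane.isEmbedding_coe.continuous_iff.2 ?_
      exact (Complex.continuous_ofReal.add continuous_const)
    have e := intervalIntegral.integral_eq_sub_of_hasDerivAt (a := 0) (b := 1) (fun x _ => key x)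
      (hcont.intervalIntegrable _ _)
    have e2 : Φ (((1 : ℝ) : ℂ) + Complex.I) - Φ (((0 : ℝ) : ℂ) + Complex.I) = 0 := by
      have := hper ⟨((0 : ℝ) : ℂ) + Complex.I, hpt 0⟩
      rw [UpperHalfPlane.coe_vadd] at this
      simp only [Complex.ofReal_zero, zero_add] at this ⊢
      rw [sub_eq_zero, this]
    rw [e2] at e
    rw [← e]
    refine intervalIntegral.integral_congr fun x _ => ?_
    have hq : Function.Periodic.qParam 1 ((x : ℂ) + Complex.I) ≠ 0 := Function.Periodic.qParam_ne_zero _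
    simp only [hJ, hQ, hφdef, Pi.mul_apply, Pi.pow_apply, Pi.inv_apply, Pi.div_apply,
      Complex.ofReal_one, one_mul, UpperHalfPlane.coe_I]
    field_simp
    rw [div_pow]
    ring
  rw [hcoef, PowerSeries.coeff_map] at hint
  simpa using hint

end Residue

section ThetaNullwerte

theorem slash_S_apply (k : ℤ) (f : ℍ → ℂ) (τ : ℍ) :
    (f ∣[k] ModularGroup.S) τ = f (ModularGroup.S • τ) * (τ : ℂ) ^ (-k) := by
  rw [ModularForm.SL_slash_apply, ModularGroup.denom_S]

theorem coe_S_smul (τ : ℍ) : ((ModularGroup.S • τ : ℍ) : ℂ) = -1 / τ := by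
  rw [UpperHalfPlane.modular_S_smul]
  rw [UpperHalfPlane.coe_mk, inv_neg, neg_div, one_div]

theorem jacobiTheta₂_add_one (z τ : ℂ) : jacobiTheta₂ z (1 + τ) = jacobiTheta₂ (z + 1 / 2) τ := by
  refine tsum_congr fun n => ?_
  rw [jacobiTheta₂_term, jacobiTheta₂_term, Complex.exp_eq_exp_iff_exists_int]
  obtain ⟨m, hm⟩ : (2 : ℤ) ∣ n * (n - 1) := (Int.even_mul_pred_self n).two_dvd
  refine ⟨m, ?_⟩
  have hm' : (n : ℂ) * (n - 1) = 2 * m := by exact_mod_cast hm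
  linear_combination (π : ℂ) * Complex.I * hm'

/-- The fourth power of the theta constant `θ₃`. -/
def thetaC (τ : ℍ) : ℂ := jacobiTheta τ ^ 4

/-- The fourth power of the theta constant `θ₄`. -/
def thetaD (τ : ℍ) : ℂ := jacobiTheta (1 + τ) ^ 4

/-- The fourth power of the theta constant `θ₂`. -/
def thetaB (τ : ℍ) : ℂ := (Complex.exp (π * Complex.I * τ / 4) * jacobiTheta₂ (τ / 2) τ) ^ 4

theorem neg_I_mul_cpow_half_pow_four (τ : ℂ) : ((-Complex.I * τ) ^ (1 / 2 : ℂ)) ^ 4 = -τ ^ 2 := by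
  rw [← Complex.cpow_nat_mul, show ((4 : ℕ) : ℂ) * (1 / 2) = (2 : ℕ) by norm_num, Complex.cpow_natCast,
    mul_pow, neg_sq, Complex.I_sq]
  ring

theorem thetaC_slash_S : thetaC ∣[(2 : ℤ)] ModularGroup.S = -thetaC := by
  ext τ
  have hτ : (τ : ℂ) ≠ 0 := ne_zero τ
  rw [slash_S_apply, thetaC, jacobiTheta_S_smul, mul_pow, neg_I_mul_cpow_half_pow_four, Pi.neg_apply,
    thetaC, _root_.zpow_neg]
  norm_cast
  field_simp

theorem thetaD_slash_S : thetaD ∣[(2 : ℤ)] ModularGroup.S = -thetaB := by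
  ext τ
  have hτ : (τ : ℂ) ≠ 0 := ne_zero τ
  have hc : (-Complex.I * (τ : ℂ)) ^ (1 / 2 : ℂ) ≠ 0 := by
    rw [Complex.cpow_ne_zero_iff]
    left
    simp [hτ]
  have h := jacobiTheta₂_functional_equation ((τ : ℂ) / 2) τ
  have he : Complex.exp (-π * Complex.I * ((τ : ℂ) / 2) ^ 2 / τ) *
      Complex.exp (π * Complex.I * τ / 4) = 1 := by
    rw [← Complex.exp_add, Complex.exp_eq_one_iff]
    refine ⟨0, ?_⟩
    field_simp
    ring
  have h2 : jacobiTheta (1 + -1 / (τ : ℂ)) = (-Complex.I * (τ : ℂ)) ^ (1 / 2 : ℂ) *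
      (Complex.exp (π * Complex.I * τ / 4) * jacobiTheta₂ (τ / 2) τ) := by
    rw [jacobiTheta_eq_jacobiTheta₂, jacobiTheta₂_add_one, zero_add, h,
      show (τ : ℂ) / 2 / τ = 1 / 2 by field_simp]
    rw [one_div_mul_eq_div, div_mul_eq_mul_div, mul_div_assoc', mul_div_cancel₀ _ hc]
    linear_combination (-jacobiTheta₂ (1 / 2) (-1 / (τ : ℂ))) * he
  rw [slash_S_apply, thetaD, coe_S_smul, h2, mul_pow, neg_I_mul_cpow_half_pow_four, Pi.neg_apply,
    thetaB, _root_.zpow_neg]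
  norm_cast
  field_simp

theorem thetaB_slash_S : thetaB ∣[(2 : ℤ)] ModularGroup.S = -thetaD := by
  have h : thetaB = -(thetaD ∣[(2 : ℤ)] ModularGroup.S) := by rw [thetaD_slash_S, neg_neg]
  have hS : ModularGroup.S * ModularGroup.S = -1 := by
    ext i j
    simp only [Matrix.SpecialLinearGroup.coe_mul, Matrix.SpecialLinearGroup.coe_neg]
    fin_cases i <;> fin_cases j <;> simp [ModularGroup.S, Matrix.mul_apply, Fin.sum_univ_two]
  rw [h, SlashAction.neg_slash, ← SlashAction.slash_mul, hS, slash_neg_one even_two]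

theorem thetaC_slash_T : thetaC ∣[(2 : ℤ)] ModularGroup.T = thetaD := by
  ext τ
  rw [slash_T_apply, thetaC, thetaD]
  simp

theorem thetaD_slash_T : thetaD ∣[(2 : ℤ)] ModularGroup.T = thetaC := by
  ext τ
  rw [slash_T_apply, thetaC, thetaD, ← jacobiTheta_two_add τ, UpperHalfPlane.coe_vadd,
    Complex.ofReal_one, ← add_assoc, one_add_one_eq_two]

theorem thetaB_slash_T : thetaB ∣[(2 : ℤ)] ModularGroup.T = -thetaB := by
  ext τ
  rw [slash_T_apply, Pi.neg_apply, thetaB, thetaB, UpperHalfPlane.coe_vadd, Complex.ofReal_one,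
    jacobiTheta₂_add_one, show (1 + (τ : ℂ)) / 2 + 1 / 2 = τ / 2 + 1 by ring, jacobiTheta₂_add_left,
    mul_pow, mul_pow, ← Complex.exp_nat_mul, ← Complex.exp_nat_mul,
    show ((4 : ℕ) : ℂ) * (π * Complex.I * (1 + τ) / 4) =
      π * Complex.I + ((4 : ℕ) : ℂ) * (π * Complex.I * τ / 4) by push_cast; ring,
    Complex.exp_add, Complex.exp_pi_mul_I]
  ring

/-- The matrices of `SL(2, ℤ)` permute the theta constants up to sign. -/
theorem theta_slash (σ : SL(2, ℤ)) : ∀ f ∈ ({thetaB, -thetaB, thetaC, -thetaC, thetaD, -thetaD} : Set (ℍ → ℂ)),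
    f ∣[(2 : ℤ)] σ ∈ ({thetaB, -thetaB, thetaC, -thetaC, thetaD, -thetaD} : Set (ℍ → ℂ)) := by
  set X : Set (ℍ → ℂ) := {thetaB, -thetaB, thetaC, -thetaC, thetaD, -thetaD} with hX
  have hS : ∀ f ∈ X, f ∣[(2 : ℤ)] ModularGroup.S ∈ X := by
    simp [hX, SlashAction.neg_slash, thetaB_slash_S, thetaC_slash_S, thetaD_slash_S]
  have hT : ∀ f ∈ X, f ∣[(2 : ℤ)] ModularGroup.T ∈ X := by
    simp [hX, SlashAction.neg_slash, thetaB_slash_T, thetaC_slash_T, thetaD_slash_T]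
  have hfin : X.Finite := by simp [hX]
  have hinv : ∀ g : SL(2, ℤ), (∀ f ∈ X, f ∣[(2 : ℤ)] g ∈ X) → ∀ f ∈ X, f ∣[(2 : ℤ)] g⁻¹ ∈ X := by
    intro g hg f hf
    have hinj : Set.InjOn (fun f : ℍ → ℂ => f ∣[(2 : ℤ)] g) X := by
      intro a _ b _ hab
      have := congrArg (fun f : ℍ → ℂ => f ∣[(2 : ℤ)] g⁻¹) hab
      simpa [← SlashAction.slash_mul] using this
    obtain ⟨f', hf', rfl⟩ := ((hfin.injOn_iff_bijOn_of_mapsTo hg).1 hinj).surjOn hf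
    simpa [← SlashAction.slash_mul] using hf'
  have hmem : σ ∈ Subgroup.closure ({ModularGroup.S, ModularGroup.T} : Set SL(2, ℤ)) := by
    rw [SpecialLinearGroup.SL2Z_generators]; trivial
  induction hmem using Subgroup.closure_induction with
  | mem g hg =>
    rcases hg with rfl | rfl
    · exact hS
    · exact hT
  | one => intro f hf; rwa [SlashAction.slash_one]
  | mul a b _ _ ha hb =>
    intro f hf
    rw [SlashAction.slash_mul]
    exact hb _ (ha _ hf)
  | inv a _ ha => exact hinv a ha

end ThetaNullwerte

section SparseSeries

/-- The power series `∑ X ^ n` over the range of `e`. -/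
def indSeries (e : ℕ → ℕ) : PowerSeries ℤ :=
  open Classical in PowerSeries.mk fun n => if n ∈ Set.range e then 1 else 0

/-- The function `∑ q ^ e m`. -/
def indFun (e : ℕ → ℕ) (τ : ℍ) : ℂ := ∑' m : ℕ, Function.Periodic.qParam 1 (τ : ℂ) ^ e m

theorem hasSum_indFun {e : ℕ → ℕ} (he : Function.Injective e) (τ : ℍ) :
    HasSum (fun m => Function.Periodic.qParam 1 (τ : ℂ) ^ e m) (indFun e τ) := by
  have h : Summable fun n : ℕ => Function.Periodic.qParam 1 (τ : ℂ) ^ n :=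
    summable_geometric_of_norm_lt_one (by simpa using UpperHalfPlane.norm_qParam_lt_one 1 τ)
  exact (h.comp_injective he).hasSum

theorem hasQ_indFun {e : ℕ → ℕ} (he : Function.Injective e) : HasQ (indFun e) (indSeries e) := by
  classical
  rw [hasQ_iff]
  intro τ
  rw [← he.hasSum_iff]
  · refine hasSum_of_eq (hasSum_indFun he τ) fun m => ?_
    simp [indSeries]
  · intro n hn
    rw [indSeries, PowerSeries.coeff_mk, if_neg hn, Int.cast_zero, zero_mul]

end SparseSeries

section Doubled

/-- The map `τ ↦ 2τ`. -/
def dbl (τ : ℍ) : ℍ := ⟨2 * (τ : ℂ), by simpa using τ.im_pos⟩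

@[simp] theorem coe_dbl (τ : ℍ) : (dbl τ : ℂ) = 2 * τ := rfl

theorem tendsto_dbl : Tendsto dbl atImInfty atImInfty := by
  refine tendsto_comap_iff.2 ?_
  have : UpperHalfPlane.im ∘ dbl = fun τ => 2 * τ.im := by
    ext τ
    change (2 * (τ : ℂ)).im = _
    simp
  rw [this]
  exact tendsto_comap.const_mul_atTop two_pos

/-- The matrix `diag(2, 1)`. -/
def diagTwo : GL (Fin 2) ℚ := Matrix.GeneralLinearGroup.mkOfDetNeZero !![2, 0; 0, 1] (by simp)

theorem slash_diagTwo (f : ℍ → ℂ) :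
    f ∣[(2 : ℤ)] (diagTwo.map (Rat.castHom ℝ)) = fun τ => 2 * f (dbl τ) := by
  ext τ
  have hdet : (diagTwo.map (Rat.castHom ℝ)).det.val = 2 := by
    simp [diagTwo, Matrix.GeneralLinearGroup.mkOfDetNeZero, Matrix.det_fin_two]
  have hsm : (diagTwo.map (Rat.castHom ℝ)) • τ = dbl τ := by
    ext
    rw [UpperHalfPlane.coe_smul_of_det_pos (by rw [hdet]; norm_num)]
    simp [num, denom, diagTwo, Matrix.GeneralLinearGroup.mkOfDetNeZero]
  rw [ModularForm.slash_apply, hsm, hdet, UpperHalfPlane.σ, hdet]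
  simp [denom, diagTwo, Matrix.GeneralLinearGroup.mkOfDetNeZero, mul_comm]

theorem isBoundedAtImInfty_dbl {f : ℍ → ℂ} (hf : ∀ σ : SL(2, ℤ), IsBoundedAtImInfty (f ∣[(2 : ℤ)] σ))
    (σ : SL(2, ℤ)) : IsBoundedAtImInfty ((f ∘ dbl) ∣[(2 : ℤ)] σ) := by
  have h := isBoundedAtImInfty_slash_rat hf diagTwo σ
  rw [slash_diagTwo] at h
  have e : (f ∘ dbl) ∣[(2 : ℤ)] σ = fun τ => (1 / 2 : ℂ) * ((fun τ => 2 * f (dbl τ)) ∣[(2 : ℤ)] σ) τ := by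
    ext τ
    simp only [ModularForm.SL_slash_apply, Function.comp_apply]
    ring
  rw [e]
  exact Asymptotics.IsBigO.const_mul_left h _

theorem comp_dbl_slash (k : ℤ) (f : ℍ → ℂ) {γ γ' : SL(2, ℤ)} (h00 : γ' 0 0 = γ 0 0) (h01 : γ' 0 1 = 2 * γ 0 1)
    (h10 : γ 1 0 = 2 * γ' 1 0) (h11 : γ' 1 1 = γ 1 1) :
    (f ∘ dbl) ∣[k] γ = (f ∣[k] γ') ∘ dbl := by
  ext τ
  have h1 := ModularGroup.denom_apply γ τ
  have h2 := ModularGroup.denom_apply γ' (dbl τ)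
  rw [Function.comp_apply, ModularForm.SL_slash_apply, ModularForm.SL_slash_apply, h1, h2,
    Function.comp_apply]
  have hd : dbl (γ • τ) = γ' • dbl τ := by
    ext
    rw [coe_dbl, coe_sl_smul, coe_sl_smul, coe_dbl, h00, h01, h11, h10]
    push_cast
    rw [mul_div_assoc']
    congr 1 <;> ring
  rw [hd, coe_dbl, h11, h10]
  push_cast
  congr 3
  ring

theorem MDifferentiable.comp_dbl {f : ℍ → ℂ} (hf : MDifferentiable 𝓘(ℂ) 𝓘(ℂ) f) :
    MDifferentiable 𝓘(ℂ) 𝓘(ℂ) (f ∘ dbl) := by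
  rw [UpperHalfPlane.mdifferentiable_iff] at hf ⊢
  have h2 : DifferentiableOn ℂ (fun z : ℂ => 2 * z) {z | 0 < z.im} :=
    (differentiable_id.const_mul 2).differentiableOn
  refine (hf.comp h2 fun z hz => ?_).congr fun z hz => ?_
  · simpa using hz
  · have hz' : 0 < (2 * z).im := by simpa using hz
    simp only [Function.comp_apply, ofComplex_apply_of_im_pos hz, ofComplex_apply_of_im_pos hz']
    rfl

end Doubled

section Series

theorem injective_succ_sq : Function.Injective fun m : ℕ => (m + 1) ^ 2 := fun a b h => by
  have := Nat.pow_left_injective (by norm_num) h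
  omega

theorem injective_mul_succ : Function.Injective fun m : ℕ => m * (m + 1) := fun a b h => by
  simp only at h
  rcases lt_trichotomy a b with h' | h' | h'
  · nlinarith
  · exact h'
  · nlinarith

/-- The `q`-expansion of the theta function. -/
def thetaSeries : PowerSeries ℤ := 1 + 2 * indSeries fun m => (m + 1) ^ 2

theorem coeff_zero_thetaSeries : thetaSeries.coeff 0 = 1 := by
  classical
  have h : (indSeries fun m => (m + 1) ^ 2).coeff 0 = 0 := by
    rw [indSeries, PowerSeries.coeff_mk, if_neg]
    rintro ⟨m, hm⟩
    simp at hm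
  rw [PowerSeries.coeff_zero_eq_constantCoeff] at h ⊢
  rw [thetaSeries, map_add, map_mul, h]
  simp

theorem Theta_eq (τ : ℍ) : Theta τ = jacobiTheta (dbl τ) := by
  refine tsum_congr fun n => ?_
  rw [coe_dbl]
  congr 1
  ring

theorem Theta_eq_one_add (τ : ℍ) : Theta τ = 1 + 2 * indFun (fun m => (m + 1) ^ 2) τ := by
  have h1 := hasSum_nat_jacobiTheta (dbl τ).im_pos
  have h2 := hasSum_indFun injective_succ_sq τ
  have h3 := h1.unique (hasSum_of_eq h2 fun m => ?_)
  · rw [← h3, Theta_eq]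
    ring
  · rw [Function.Periodic.qParam, ← Complex.exp_nat_mul]
    congr 1
    change (π : ℂ) * Complex.I * (m + 1) ^ 2 * (2 * τ) = _
    push_cast
    ring

theorem hasQ_Theta : HasQ Theta thetaSeries := by
  have h := hasQ_indFun injective_succ_sq
  have h1 : HasQC (fun _ => (1 : ℂ)) (PowerSeries.C 1) := hasQC_const 1
  have h2 := (hasQC_const 2).mul h
  have := h1.add h2
  rw [HasQ, thetaSeries, map_add, map_mul]
  refine (show Theta = _ from funext Theta_eq_one_add) ▸ ?_
  have e1 : PowerSeries.map (Int.castRingHom ℂ) 1 = PowerSeries.C 1 := by simp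
  have e2 : PowerSeries.map (Int.castRingHom ℂ) 2 = PowerSeries.C 2 := by rw [map_ofNat, map_ofNat]
  rw [e1, e2]
  exact this

theorem thetaB_dbl (τ : ℍ) :
    thetaB (dbl τ) = 16 * (Function.Periodic.qParam 1 (τ : ℂ) * indFun (fun m => m * (m + 1)) τ ^ 4) := by
  have h2 := hasSum_indFun injective_mul_succ τ
  set s := indFun (fun m => m * (m + 1)) τ with hs
  have h3 := HasSum.of_nat_of_neg_add_one (f := fun n : ℤ => jacobiTheta₂_term n (τ : ℂ) (2 * τ)) (m := s) (m' := s)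
    (hasSum_of_eq h2 fun m => ?_) (hasSum_of_eq h2 fun m => ?_)
  · have h4 := h3.unique (hasSum_jacobiTheta₂_term (τ : ℂ) (dbl τ).im_pos)
    have h5 : jacobiTheta₂ (τ : ℂ) (2 * τ) = s + s := h4.symm
    rw [thetaB, coe_dbl, mul_div_cancel_left₀ _ two_ne_zero, h5, mul_pow, ← Complex.exp_nat_mul,
      Function.Periodic.qParam,
      show ((4 : ℕ) : ℂ) * (π * Complex.I * (2 * τ) / 4) = 2 * π * Complex.I * τ / (1 : ℝ) by push_cast; ring]
    ring
  · rw [Function.Periodic.qParam, ← Complex.exp_nat_mul, jacobiTheta₂_term]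
    congr 1
    push_cast
    ring
  · rw [Function.Periodic.qParam, ← Complex.exp_nat_mul, jacobiTheta₂_term]
    congr 1
    push_cast
    ring

end Series

section ThetaForms

/-- The map `τ ↦ τ / 2`. -/
def half (τ : ℍ) : ℍ := ⟨(τ : ℂ) / 2, by simpa using τ.im_pos⟩

theorem dbl_half (τ : ℍ) : dbl (half τ) = τ := by
  ext
  rw [coe_dbl]
  change 2 * ((τ : ℂ) / 2) = τ
  ring

theorem tendsto_half : Tendsto half atImInfty atImInfty := by
  refine tendsto_comap_iff.2 ?_
  have : UpperHalfPlane.im ∘ half = fun τ => τ.im / 2 := by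
    ext τ
    change ((τ : ℂ) / 2).im = _
    simp
  rw [this]
  exact tendsto_comap.atTop_div_const two_pos

theorem tendsto_jacobiTheta : Tendsto jacobiTheta (comap Complex.im atTop) (𝓝 1) := by
  have h := isBigO_at_im_infty_jacobiTheta_sub_one
  have h2 : Tendsto (fun τ : ℂ => Real.exp (-π * τ.im)) (comap Complex.im atTop) (𝓝 0) := by
    refine Real.tendsto_exp_atBot.comp ?_
    exact tendsto_comap.const_mul_atTop_of_neg (by simpa using Real.pi_pos)
  have h3 := (h.trans_tendsto h2).add_const 1
  simpa using h3

theorem tendsto_coe_comap_im : Tendsto (fun τ : ℍ => (τ : ℂ)) atImInfty (comap Complex.im atTop) :=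
  tendsto_comap_iff.2 tendsto_comap

theorem thetaC_tendsto : Tendsto thetaC atImInfty (𝓝 1) := by
  have := (tendsto_jacobiTheta.comp tendsto_coe_comap_im).pow 4
  rw [one_pow] at this
  exact this

theorem thetaD_tendsto : Tendsto thetaD atImInfty (𝓝 1) := by
  have h : Tendsto (fun τ : ℍ => 1 + (τ : ℂ)) atImInfty (comap Complex.im atTop) := by
    refine tendsto_comap_iff.2 ?_
    have : Complex.im ∘ (fun τ : ℍ => 1 + (τ : ℂ)) = UpperHalfPlane.im := by
      ext τ
      simp
    rw [this]
    exact tendsto_comap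
  have := (tendsto_jacobiTheta.comp h).pow 4
  rw [one_pow] at this
  exact this

theorem thetaB_tendsto : Tendsto thetaB atImInfty (𝓝 0) := by
  have h := (hasQ_indFun injective_mul_succ).tendsto
  have h2 := (qParam_tendsto_zero.mul (h.pow 4)).const_mul (16 : ℂ)
  rw [zero_mul, mul_zero] at h2
  refine (h2.comp tendsto_half).congr fun τ => ?_
  rw [Function.comp_apply, ← thetaB_dbl, dbl_half]

theorem theta_slash_isBounded {f : ℍ → ℂ}
    (hf : f ∈ ({thetaB, -thetaB, thetaC, -thetaC, thetaD, -thetaD} : Set (ℍ → ℂ))) (σ : SL(2, ℤ)) :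
    IsBoundedAtImInfty (f ∣[(2 : ℤ)] σ) := by
  have hB : IsBoundedAtImInfty thetaB := thetaB_tendsto.isBigO_one ℝ
  have hC : IsBoundedAtImInfty thetaC := thetaC_tendsto.isBigO_one ℝ
  have hD : IsBoundedAtImInfty thetaD := thetaD_tendsto.isBigO_one ℝ
  have h := theta_slash σ f hf
  simp only [Set.mem_insert_iff, Set.mem_singleton_iff] at h
  rcases h with h | h | h | h | h | h <;> rw [h]
  exacts [hB, hB.neg, hC, hC.neg, hD, hD.neg]

theorem slash_zpow_T_two (f : ℍ → ℂ) (h : (f ∣[(2 : ℤ)] ModularGroup.T) ∣[(2 : ℤ)] ModularGroup.T = f) :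
    f ∣[(2 : ℤ)] (ModularGroup.T * ModularGroup.T)⁻¹ = f := by
  have h2 : f ∣[(2 : ℤ)] (ModularGroup.T * ModularGroup.T) = f := by
    rw [SlashAction.slash_mul, h]
  conv_lhs => rw [← h2]
  rw [← SlashAction.slash_mul, mul_inv_cancel, SlashAction.slash_one]

theorem lowerTwo_eq : lowerTwo = ModularGroup.S * (ModularGroup.T * ModularGroup.T)⁻¹ * (-ModularGroup.S) := by
  ext i j
  simp only [Matrix.SpecialLinearGroup.coe_mul, Matrix.SpecialLinearGroup.coe_neg,
    Matrix.SpecialLinearGroup.coe_inv]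
  fin_cases i <;> fin_cases j <;>
    simp [lowerTwo, ModularGroup.S, ModularGroup.T, Matrix.mul_apply, Fin.sum_univ_two, Matrix.adjugate_fin_two]

theorem slash_neg_S (f : ℍ → ℂ) : f ∣[(2 : ℤ)] (-ModularGroup.S) = f ∣[(2 : ℤ)] ModularGroup.S := by
  rw [← neg_one_mul, SlashAction.slash_mul, slash_neg_one even_two]

theorem thetaC_slash_lowerTwo : thetaC ∣[(2 : ℤ)] lowerTwo = thetaC := by
  rw [lowerTwo_eq, SlashAction.slash_mul, SlashAction.slash_mul, thetaC_slash_S, slash_zpow_T_two,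
    slash_neg_S, SlashAction.neg_slash, thetaC_slash_S, neg_neg]
  rw [SlashAction.neg_slash, SlashAction.neg_slash, thetaC_slash_T, thetaD_slash_T]

theorem thetaB_slash_lowerTwo : thetaB ∣[(2 : ℤ)] lowerTwo = thetaB := by
  rw [lowerTwo_eq, SlashAction.slash_mul, SlashAction.slash_mul, thetaB_slash_S, slash_zpow_T_two,
    slash_neg_S, SlashAction.neg_slash, thetaD_slash_S, neg_neg]
  rw [SlashAction.neg_slash, SlashAction.neg_slash, thetaD_slash_T, thetaC_slash_T]

theorem mdifferentiable_of_differentiableAt {g : ℂ → ℂ} (hg : ∀ z : ℂ, 0 < z.im → DifferentiableAt ℂ g z) :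
    MDifferentiable 𝓘(ℂ) 𝓘(ℂ) (fun τ : ℍ => g τ) := by
  rw [UpperHalfPlane.mdifferentiable_iff]
  have : DifferentiableOn ℂ g {z : ℂ | 0 < z.im} := fun z hz => (hg z hz).differentiableWithinAt
  refine this.congr fun z hz => ?_
  simp [ofComplex_apply_of_im_pos hz]

theorem mdifferentiable_thetaC : MDifferentiable 𝓘(ℂ) 𝓘(ℂ) thetaC :=
  mdifferentiable_of_differentiableAt (g := fun z => jacobiTheta z ^ 4)
    fun _ hz => (differentiableAt_jacobiTheta hz).pow 4

theorem mdifferentiable_thetaD : MDifferentiable 𝓘(ℂ) 𝓘(ℂ) thetaD := by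
  have := mdifferentiable_thetaC.slash 2 (Matrix.SpecialLinearGroup.mapGL ℝ ModularGroup.T)
  rw [← thetaC_slash_T]
  exact this

theorem mdifferentiable_thetaB : MDifferentiable 𝓘(ℂ) 𝓘(ℂ) thetaB := by
  have h := (mdifferentiable_thetaD.slash 2 (Matrix.SpecialLinearGroup.mapGL ℝ ModularGroup.S)).neg
  have e : thetaB = -(thetaD ∣[(2 : ℤ)] ModularGroup.S) := by rw [thetaD_slash_S, neg_neg]
  rw [e]
  exact h

theorem isModForm_comp_dbl {f : ℍ → ℂ} (hf : MDifferentiable 𝓘(ℂ) 𝓘(ℂ) f)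
    (hmem : f ∈ ({thetaB, -thetaB, thetaC, -thetaC, thetaD, -thetaD} : Set (ℍ → ℂ)))
    (hT : (f ∣[(2 : ℤ)] ModularGroup.T) ∣[(2 : ℤ)] ModularGroup.T = f) (hU : f ∣[(2 : ℤ)] lowerTwo = f) :
    IsModForm 2 (f ∘ dbl) where
  holo := MDifferentiable.comp_dbl hf
  inv γ hγ := by
    refine slash_eq_of_generators even_two ?_ ?_ hγ
    · rw [comp_dbl_slash 2 f (γ' := ModularGroup.T * ModularGroup.T), SlashAction.slash_mul, hT] <;>
      simp [Matrix.SpecialLinearGroup.coe_mul, ModularGroup.coe_T, Matrix.mul_apply, Fin.sum_univ_two]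
    · rw [comp_dbl_slash 2 f (γ' := lowerTwo), hU] <;>
      simp [lowerTwo, lowerU]
  bdd σ := isBoundedAtImInfty_dbl (theta_slash_isBounded hmem) σ

theorem Theta_pow_four : Theta ^ 4 = thetaC ∘ dbl := by
  ext τ
  rw [Pi.pow_apply, Theta_eq, Function.comp_apply, thetaC]

theorem isModForm_Theta_pow_four : IsModForm 2 (Theta ^ 4) := by
  rw [Theta_pow_four]
  refine isModForm_comp_dbl mdifferentiable_thetaC (by simp) ?_ thetaC_slash_lowerTwo
  rw [thetaC_slash_T, thetaD_slash_T]

/-- The form of weight `2` on `Γ₀(4)` whose only zero is a simple one at `∞`. -/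
def cuspUnit (τ : ℍ) : ℂ := Function.Periodic.qParam 1 (τ : ℂ) * indFun (fun m => m * (m + 1)) τ ^ 4

theorem cuspUnit_eq : cuspUnit = (fun _ => (1 / 16 : ℂ)) * (thetaB ∘ dbl) := by
  ext τ
  rw [Pi.mul_apply, Function.comp_apply, thetaB_dbl, cuspUnit]
  ring

theorem isModForm_cuspUnit : IsModForm 2 cuspUnit := by
  rw [cuspUnit_eq, ← zero_add 2]
  refine (isModForm_const _).mul (isModForm_comp_dbl mdifferentiable_thetaB (by simp) ?_ thetaB_slash_lowerTwo)
  rw [thetaB_slash_T, SlashAction.neg_slash, thetaB_slash_T, neg_neg]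

theorem hasQ_cuspUnit : HasQ cuspUnit (PowerSeries.X * (indSeries fun m => m * (m + 1)) ^ 4) := by
  rw [HasQ, map_mul, PowerSeries.map_X]
  exact hasQC_qParam.mul ((hasQ_indFun injective_mul_succ).pow 4)

theorem coeff_zero_indSeries_pow : ((indSeries fun m => m * (m + 1)) ^ 4).coeff 0 = 1 := by
  classical
  have h : (indSeries fun m => m * (m + 1)).coeff 0 = 1 := by
    rw [indSeries, PowerSeries.coeff_mk, if_pos ⟨0, by simp⟩]
  rw [PowerSeries.coeff_zero_eq_constantCoeff] at h ⊢
  rw [map_pow, h, one_pow]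

theorem thetaProd_slash (γ : SL(2, ℤ)) :
    ((thetaB * thetaC * thetaD) ^ 2) ∣[(12 : ℤ)] γ = (thetaB * thetaC * thetaD) ^ 2 := by
  refine SlashInvariantForm.slash_action_generators_SL2Z ?_ ?_ γ
  · rw [pow_two, show (12 : ℤ) = (2 + 2 + 2) + (2 + 2 + 2) by norm_num]
    simp only [ModularForm.mul_slash_SL2, thetaB_slash_S, thetaC_slash_S, thetaD_slash_S]
    ring
  · rw [pow_two, show (12 : ℤ) = (2 + 2 + 2) + (2 + 2 + 2) by norm_num]
    simp only [ModularForm.mul_slash_SL2, thetaB_slash_T, thetaC_slash_T, thetaD_slash_T]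
    ring

/-- The level one cusp form of weight `12` given by the theta constants. -/
def thetaDelta : CuspForm 𝒮ℒ 12 where
  toFun := (thetaB * thetaC * thetaD) ^ 2
  slash_action_eq' := by
    rintro _ ⟨γ, rfl⟩
    exact thetaProd_slash γ
  holo' := ((mdifferentiable_thetaB.mul mdifferentiable_thetaC).mul mdifferentiable_thetaD).pow 2
  zero_at_cusps' hc := by
    rw [Subgroup.IsArithmetic.isCusp_iff_isCusp_SL2Z] at hc
    rw [OnePoint.isZeroAt_iff_forall_SL2Z hc]
    intro γ _
    rw [thetaProd_slash]
    have := ((thetaB_tendsto.mul thetaC_tendsto).mul thetaD_tendsto).pow 2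
    simp only [zero_mul, ne_eq, OfNat.ofNat_ne_zero, not_false_eq_true, zero_pow] at this
    exact this

theorem thetaProd_ne_zero (τ : ℍ) : thetaB τ * thetaC τ * thetaD τ ≠ 0 := by
  obtain ⟨c, hc⟩ := CuspForm.exists_smul_discriminant_of_weight_eq_twelve thetaDelta
  have hval : ∀ w : ℍ, c * ModularForm.discriminant w = (thetaB w * thetaC w * thetaD w) ^ 2 := fun w =>
    congrArg (fun f : CuspForm 𝒮ℒ 12 => f w) hc
  have hc0 : c ≠ 0 := by
    rintro rfl
    have hi := ((hasQ_indFun injective_mul_succ).pow 4).tendsto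
    have hi0 : (PowerSeries.map (Int.castRingHom ℂ) ((indSeries fun m => m * (m + 1)) ^ 4)).coeff 0 = 1 := by
      rw [PowerSeries.coeff_map, coeff_zero_indSeries_pow, map_one]
    have h3 := ((hi.mul (thetaC_tendsto.comp tendsto_dbl)).mul (thetaD_tendsto.comp tendsto_dbl))
    rw [hi0, mul_one, mul_one] at h3
    obtain ⟨w, hw⟩ := (h3.eventually_ne one_ne_zero).exists
    refine hw ?_
    have h4 := hval (dbl w)
    rw [zero_mul, eq_comm, pow_eq_zero_iff two_ne_zero, thetaB_dbl] at h4
    have hq : Function.Periodic.qParam 1 (w : ℂ) ≠ 0 := Function.Periodic.qParam_ne_zero _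
    have h5 : 16 * Function.Periodic.qParam 1 (w : ℂ) * (indFun (fun m => m * (m + 1)) w ^ 4 *
        thetaC (dbl w) * thetaD (dbl w)) = 0 := by
      rw [← h4]; ring
    simpa [hq] using h5
  intro h
  have := hval τ
  rw [h, zero_pow two_ne_zero] at this
  exact mul_ne_zero hc0 (ModularForm.discriminant_ne_zero τ) this

theorem Theta_ne_zero (τ : ℍ) : Theta τ ≠ 0 := by
  intro h
  refine thetaProd_ne_zero (dbl τ) ?_
  rw [thetaC, ← Theta_eq, h]
  simp

theorem cuspUnit_ne_zero (τ : ℍ) : cuspUnit τ ≠ 0 := by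
  intro h
  refine thetaProd_ne_zero (dbl τ) ?_
  rw [thetaB_dbl]
  rw [cuspUnit] at h
  rw [h]
  simp

theorem isBounded_inv_of_tendsto {f : ℍ → ℂ} {c : ℂ} (hc : c ≠ 0) (hf : Tendsto f atImInfty (𝓝 c)) :
    IsBoundedAtImInfty f⁻¹ :=
  (hf.inv₀ hc).isBigO_one ℝ

theorem cuspUnit_slash_S : IsBoundedAtImInfty ((cuspUnit ∣[(2 : ℤ)] ModularGroup.S)⁻¹) := by
  refine isBounded_inv_of_tendsto (c := (-(1 / 64) * 1)) (by norm_num) ?_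
  refine ((thetaD_tendsto.comp tendsto_half).const_mul _).congr fun τ => ?_
  have h1 : dbl (ModularGroup.S • τ) = ModularGroup.S • half τ := by
    ext
    rw [coe_dbl, coe_S_smul, coe_S_smul]
    change _ = -1 / ((τ : ℂ) / 2)
    field_simp
  have h2 : (thetaB ∣[(2 : ℤ)] ModularGroup.S) (half τ) = -thetaD (half τ) := by
    rw [thetaB_slash_S]; rfl
  have hτ : (τ : ℂ) ≠ 0 := ne_zero τ
  rw [slash_S_apply, show ((half τ : ℍ) : ℂ) = τ / 2 from rfl, _root_.zpow_neg] at h2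
  rw [Function.comp_apply, slash_S_apply, cuspUnit_eq, Pi.mul_apply, Function.comp_apply, h1, _root_.zpow_neg]
  norm_cast at h2 ⊢
  field_simp at h2 ⊢
  linear_combination (-16) * h2

/-- The matrix `(1, 0; 1, 1)`. -/
def lowerOne : SL(2, ℤ) := ⟨!![1, 0; 1, 1], by simp [Matrix.det_fin_two]⟩

theorem lowerOne_eq : lowerOne = ModularGroup.S * ModularGroup.T⁻¹ * (-ModularGroup.S) := by
  ext i j
  simp only [Matrix.SpecialLinearGroup.coe_mul, Matrix.SpecialLinearGroup.coe_neg,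
    Matrix.SpecialLinearGroup.coe_inv]
  fin_cases i <;> fin_cases j <;>
    simp [lowerOne, ModularGroup.S, ModularGroup.T, Matrix.mul_apply, Fin.sum_univ_two, Matrix.adjugate_fin_two]

theorem thetaB_slash_lowerOne : thetaB ∣[(2 : ℤ)] lowerOne = thetaC := by
  have h : thetaD ∣[(2 : ℤ)] ModularGroup.T⁻¹ = thetaC := by
    rw [← thetaC_slash_T, ← SlashAction.slash_mul, mul_inv_cancel, SlashAction.slash_one]
  rw [lowerOne_eq, SlashAction.slash_mul, SlashAction.slash_mul, thetaB_slash_S, slash_neg_S,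
    SlashAction.neg_slash, h, SlashAction.neg_slash, thetaC_slash_S, neg_neg]

theorem cuspUnit_slash_lowerTwo : IsBoundedAtImInfty ((cuspUnit ∣[(2 : ℤ)] lowerTwo)⁻¹) := by
  refine isBounded_inv_of_tendsto (c := (1 / 16) * 1) (by norm_num) ?_
  refine ((thetaC_tendsto.comp tendsto_dbl).const_mul _).congr fun τ => ?_
  have h1 : (thetaB ∘ dbl) ∣[(2 : ℤ)] lowerTwo = thetaC ∘ dbl := by
    rw [comp_dbl_slash 2 thetaB (γ' := lowerOne), thetaB_slash_lowerOne] <;> simp [lowerOne, lowerTwo]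
  rw [cuspUnit_eq, ← h1, ModularForm.SL_slash_apply, ModularForm.SL_slash_apply, Pi.mul_apply, mul_assoc]

end ThetaForms

/-- The vanishing of residues, for the form `cuspUnit`. -/
theorem exists_coeff_mul_pow_eq_zero : ∃ v : PowerSeries ℤ, v.coeff 0 = 1 ∧ ∀ (N : ℕ) (H : ℍ → ℂ)
    (a : PowerSeries ℤ), IsCusp4 (2 * N + 2) H → HasQ H a → (a * v ^ N).coeff N = 0 := by
  have hu := coeff_zero_indSeries_pow
  set u := (indSeries fun m => m * (m + 1)) ^ 4
  have huv := PowerSeries.mul_invOfUnit u 1 (by simpa using hu)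
  refine ⟨PowerSeries.invOfUnit u 1, by simp, fun N H a hH ha => ?_⟩
  exact coeff_mul_pow_eq_zero isModForm_cuspUnit cuspUnit_ne_zero hasQ_cuspUnit hu huv
    cuspUnit_slash_S cuspUnit_slash_lowerTwo hH ha

section Eisenstein

theorem prime_dvd_den_bernoulli {p : ℕ} (hp : p.Prime) {k : ℕ} (hk0 : k ≠ 0) (hk : Even k)
    (hpk : (p - 1) ∣ k) : p ∣ (bernoulli k).den := by
  obtain ⟨m, rfl⟩ := hk
  rw [← two_mul] at hpk hk0 ⊢
  obtain ⟨z, hz⟩ := Bernoulli.vonStaudt_clausen m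
  set s := Finset.filter (fun q => q.Prime ∧ (q - 1) ∣ 2 * m) (Finset.range (2 * m + 2)) with hs
  have hps : p ∈ s := by
    rw [hs, Finset.mem_filter, Finset.mem_range]
    have := Nat.le_of_dvd (Nat.pos_of_ne_zero hk0) hpk
    exact ⟨by omega, hp, hpk⟩
  have hsum : ∃ w : ℤ, (∏ q ∈ s.erase p, (q : ℚ)) * ∑ q ∈ s.erase p, (1 : ℚ) / q = w := by
    rw [Finset.mul_sum]
    refine ⟨∑ q ∈ s.erase p, ∏ r ∈ (s.erase p).erase q, (r : ℤ), ?_⟩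
    push_cast
    refine Finset.sum_congr rfl fun q hq => ?_
    have hq0 : (q : ℚ) ≠ 0 := by
      have := (Finset.mem_filter.1 (Finset.mem_of_mem_erase hq)).2.1.ne_zero
      exact_mod_cast this
    rw [← Finset.mul_prod_erase _ _ hq]
    field_simp
  obtain ⟨w, hw⟩ := hsum
  rw [← Finset.add_sum_erase _ _ hps] at hz
  have hp0 : (p : ℚ) ≠ 0 := by exact_mod_cast hp.ne_zero
  set B := bernoulli (2 * m)
  have hB : B * B.den = B.num := Rat.mul_den_eq_num B
  set P := ∏ q ∈ s.erase p, (q : ℚ) with hP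
  set S := ∑ q ∈ s.erase p, (1 : ℚ) / q
  have key : P * B.den = p * (z * P * B.den - P * B.num - w * B.den) := by
    rw [← hw, ← hB, hz]
    field_simp
    ring
  have key2 : ((∏ q ∈ s.erase p, q : ℕ) : ℤ) * (B.den : ℤ) = p * (z * (∏ q ∈ s.erase p, q : ℕ) * B.den
      - (∏ q ∈ s.erase p, q : ℕ) * B.num - w * B.den) := by
    rw [hP] at key
    have : ((((∏ q ∈ s.erase p, q : ℕ) : ℤ) * (B.den : ℤ) : ℤ) : ℚ) = ((p * (z * (∏ q ∈ s.erase p, q : ℕ) * B.den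
      - (∏ q ∈ s.erase p, q : ℕ) * B.num - w * B.den) : ℤ) : ℚ) := by
      push_cast
      exact key
    exact Int.cast_injective this
  have hdvd : p ∣ (∏ q ∈ s.erase p, q) * B.den := by
    rw [← Int.natCast_dvd_natCast]
    push_cast at key2 ⊢
    exact ⟨_, key2⟩
  refine (hp.dvd_mul.1 hdvd).resolve_left fun h => ?_
  obtain ⟨q, hq, hpq⟩ := (Prime.dvd_finsetProd_iff hp.prime _).1 h
  have hqp := (Finset.mem_filter.1 (Finset.mem_of_mem_erase hq)).2.1
  exact Finset.ne_of_mem_erase hq ((Nat.prime_dvd_prime_iff_eq hp hqp).1 hpq).symm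

theorem isModForm_of_levelOne {k : ℤ} (f : ModularForm 𝒮ℒ k) : IsModForm k f where
  holo := f.holo'
  inv γ _ := f.slash_action_eq' _ ⟨γ, rfl⟩
  bdd σ := by
    have h : (f : ℍ → ℂ) ∣[k] σ = f := f.slash_action_eq' _ ⟨σ, rfl⟩
    rw [h]
    exact ModularFormClass.bdd_at_infty f

/-- A form of weight `k`, with `p - 1 ∣ k`, congruent to a unit modulo `p`: the Eisenstein series
with denominators cleared. -/
theorem exists_isModForm_unit {p : ℕ} (hp : p.Prime) {k : ℕ} (hk3 : 3 ≤ k) (hk : Even k)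
    (hpk : (p - 1) ∣ k) : ∃ (G : ℍ → ℂ) (E : PowerSeries ℤ) (s : ℤ), IsModForm k G ∧ HasQ G E ∧
      (p : PowerSeries ℤ) ∣ E - PowerSeries.C s ∧ ¬ (p : ℤ) ∣ s := by
  have hden := prime_dvd_den_bernoulli hp (by omega) hk hpk
  set B := bernoulli k with hB
  have hnum : ¬ (p : ℤ) ∣ B.num := fun h => by
    have h1 := Nat.dvd_gcd (Int.natCast_dvd.1 h) hden
    rw [Nat.Coprime.gcd_eq_one B.reduced] at h1
    exact hp.one_lt.ne' (Nat.dvd_one.1 h1)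
  have hB0 : (B.num : ℂ) ≠ 0 := by
    intro h
    refine hnum ?_
    rw [Int.cast_eq_zero.1 h]
    exact dvd_zero _
  refine ⟨(fun _ => (B.num : ℂ)) * (ModularForm.E hk3 : ℍ → ℂ), PowerSeries.mk fun m => if m = 0 then B.num else
    -(2 * k * B.den * (ArithmeticFunction.sigma (k - 1) m : ℕ)), B.num, ?_, ?_, ?_, hnum⟩
  · have := (isModForm_const (B.num : ℂ)).mul (isModForm_of_levelOne (ModularForm.E hk3))
    rwa [zero_add] at this
  · intro τ
    have hE := isModForm_of_levelOne (ModularForm.E hk3)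
    have h := UpperHalfPlane.hasSum_qExpansion one_pos (periodic_of_vadd (periodic_of_slash (hE.inv _ T_mem_gamma0_four))) hE.holo
      (ModularFormClass.bdd_at_infty (ModularForm.E hk3)) τ
    have h2 := h.mul_left (B.num : ℂ)
    refine hasSum_of_eq h2 fun n => ?_
    rw [EisensteinSeries.E_qExpansion_coeff hk3 hk, PowerSeries.coeff_map, PowerSeries.coeff_mk, ← hB, smul_eq_mul,
      ← mul_assoc]
    congr 1
    split_ifs
    · simp
    · have hBd : (B : ℂ) = B.num / B.den := Rat.cast_def B
      have hd : (B.den : ℂ) ≠ 0 := by exact_mod_cast B.den_ne_zero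
      rw [hBd]
      field_simp
      simp
  · rw [natCast_dvd_powerSeries_iff]
    intro n
    rw [map_sub, PowerSeries.coeff_mk, PowerSeries.coeff_C]
    split_ifs
    · simp
    · rw [sub_zero, dvd_neg]
      exact Dvd.dvd.mul_right (Dvd.dvd.mul_left (Int.natCast_dvd_natCast.2 hden) _) _

end Eisenstein

section Admissible

/-- Integral series `c` such that `c` times a power of the theta series is a cusp form on `Γ₀(4)`,
where the half-integral weight of `c` is `k₀ + t (p - 1) / 2 + 1 / 2`. -/
def IsAdmissible (p k₀ : ℕ) (c : PowerSeries ℤ) : Prop :=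
  ∃ (t L K : ℕ) (F : ℍ → ℂ), 4 * K = 2 * (k₀ + t * ((p - 1) / 2)) + 1 + L ∧
    IsCusp4 (2 * K : ℕ) F ∧ HasQ F (c * thetaSeries ^ L)

theorem IsCusp4.coeff_zero {k : ℤ} {f : ℍ → ℂ} {a : PowerSeries ℤ} (hf : IsCusp4 k f) (ha : HasQ f a) :
    a.coeff 0 = 0 := by
  have h := hf.zero 1
  rw [SlashAction.slash_one] at h
  have h2 := tendsto_nhds_unique (HasQC.tendsto ha) h
  rw [PowerSeries.coeff_map, eq_intCast] at h2
  exact_mod_cast h2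

theorem coeff_zero_pow_of_eq_one {v : PowerSeries ℤ} (hv : v.coeff 0 = 1) (n : ℕ) : (v ^ n).coeff 0 = 1 := by
  rw [PowerSeries.coeff_zero_eq_constantCoeff] at hv ⊢
  rw [map_pow, hv, one_pow]

theorem IsAdmissible.coeff_zero {p k₀ : ℕ} {c : PowerSeries ℤ} (hc : IsAdmissible p k₀ c) :
    c.coeff 0 = 0 := by
  obtain ⟨t, L, K, F, -, hF, hq⟩ := hc
  have h := hF.coeff_zero hq
  have h2 := coeff_zero_pow_of_eq_one coeff_zero_thetaSeries L
  rw [PowerSeries.coeff_zero_eq_constantCoeff] at h h2 ⊢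
  rwa [map_mul, h2, mul_one] at h

theorem IsAdmissible.of_mul {p k₀ : ℕ} {c : PowerSeries ℤ} {m : ℤ} (hm : m ≠ 0)
    (hc : IsAdmissible p k₀ (PowerSeries.C m * c)) : IsAdmissible p k₀ c := by
  obtain ⟨t, L, K, F, hK, hF, hq⟩ := hc
  refine ⟨t, L, K, F * fun _ => (m : ℂ)⁻¹, hK, ?_, ?_⟩
  · have := hF.mul (isModForm_const (m : ℂ)⁻¹)
    rwa [add_zero] at this
  · have h := HasQC.mul hq (hasQC_const (m : ℂ)⁻¹)
    have hm' : (m : ℂ) ≠ 0 := by exact_mod_cast hm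
    have e : PowerSeries.map (Int.castRingHom ℂ) (PowerSeries.C m * c * thetaSeries ^ L) *
        PowerSeries.C (m : ℂ)⁻¹ = PowerSeries.map (Int.castRingHom ℂ) (c * thetaSeries ^ L) := by
      rw [mul_assoc, map_mul, PowerSeries.map_C, mul_comm, ← mul_assoc, ← map_mul, eq_intCast,
        inv_mul_cancel₀ hm', map_one, one_mul]
    rwa [e] at h

theorem exists_pow_eq {p : ℕ} (hp : p.Prime) (hodd : Odd p) (t L : ℕ) :
    ∃ b s : ℕ, p ^ b = 2 * ((p - 1) / 2) * s + 1 ∧ L ≤ p ^ b ∧ t + 4 ≤ s ∧ s % 2 = t % 2 := by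
  obtain ⟨r, hr⟩ := hodd
  have hr1 : (p - 1) / 2 = r := by omega
  have h3 : 2 ≤ p := hp.two_le
  set b := t + 2 * (L + 4) with hb
  refine ⟨b, ∑ i ∈ Finset.range b, p ^ i, ?_, ?_, ?_, ?_⟩
  · have := Nat.geomSum_eq hp.two_le b
    have h2 := (Nat.geomSum_eq hp.two_le b).symm ▸ Nat.div_mul_cancel (Nat.sub_one_dvd_pow_sub_one p b)
    have h4 : 1 ≤ p ^ b := Nat.one_le_pow _ _ (by omega)
    rw [hr1, show 2 * r = p - 1 by omega, mul_comm, h2]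
    omega
  · have : b < p ^ b := Nat.lt_pow_self (by omega)
    omega
  · have : ∑ i ∈ Finset.range b, 1 ≤ ∑ i ∈ Finset.range b, p ^ i :=
      Finset.sum_le_sum fun i _ => Nat.one_le_pow _ _ (by omega)
    rw [Finset.sum_const, Finset.card_range, smul_eq_mul, mul_one] at this
    omega
  · have : ∑ i ∈ Finset.range b, p ^ i ≡ ∑ i ∈ Finset.range b, 1 [MOD 2] := by
      refine Nat.ModEq.sum fun i _ => ?_
      have : p ≡ 1 [MOD 2] := by
        change p % 2 = 1 % 2
        omega
      simpa using this.pow i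
    rw [Finset.sum_const, Finset.card_range, smul_eq_mul, mul_one] at this
    have h2 : _ % 2 = _ % 2 := this
    omega

theorem IsAdmissible.exists_dvd_coeff {p k₀ : ℕ} (hp : p.Prime) (hodd : Odd p) (hk₀ : k₀ = 2 ∨ k₀ = 3)
    {c : PowerSeries ℤ} (hc : IsAdmissible p k₀ c) : ∃ b : ℕ, ∀ n, (p : ℤ) ∣ c.coeff (p ^ b * n) := by
  have hc0 := hc.coeff_zero
  obtain ⟨t, L, K, F, hK, hF, hq⟩ := hc
  obtain ⟨b, s, hQ, hL, hs, hst⟩ := exists_pow_eq hp hodd t L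
  obtain ⟨r, hr⟩ := hodd
  have hr1 : (p - 1) / 2 = r := by omega
  rw [hr1] at hK hQ
  have hr0 : 1 ≤ r := by have := hp.two_le; omega
  obtain ⟨w, hw, hw2⟩ : ∃ w, (2 * k₀ - 3) * s = t + 2 * w ∧ 2 ≤ w := by
    rcases hk₀ with rfl | rfl
    · exact ⟨(s - t) / 2, by omega, by omega⟩
    · exact ⟨(3 * s - t) / 2, by omega, by omega⟩
  have hrw : 2 ≤ r * w := by nlinarith
  obtain ⟨G, E, s', hG, hE, hEs, hs'⟩ := exists_isModForm_unit hp (k := 2 * (r * w))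
    (by omega) (even_two_mul _) ⟨w, by rw [hr, Nat.add_sub_cancel, mul_assoc]⟩
  obtain ⟨v, hv, hres⟩ := exists_coeff_mul_pow_eq_zero
  refine ⟨b, prime_dvd_coeff_of_coeff_mul_pow_eq_zero hp b hc0 hEs hs' fun n hn => ?_⟩
  obtain ⟨n, rfl⟩ : ∃ n', n = n' + 1 := ⟨n - 1, by omega⟩
  set Q := p ^ b
  have hrel : (7 - 2 * k₀) * Q + 4 * K + 4 * (r * w) = 4 * Q + 4 + L := by
    have e : r * ((2 * k₀ - 3) * s) = r * (t + 2 * w) := by rw [hw]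
    rcases hk₀ with rfl | rfl <;> nlinarith
  have hle : Q ≤ (7 - 2 * k₀) * Q := Nat.le_mul_of_pos_left _ (by omega)
  obtain ⟨A, hA⟩ : ∃ A, A + K + r * w = n * Q + Q + 1 := by
    refine ⟨n * Q + Q + 1 - K - r * w, ?_⟩
    have : K + r * w ≤ Q + 1 := by omega
    omega
  have hA2 : L + 4 * A = (4 * n + (7 - 2 * k₀)) * Q := by
    rw [add_mul, mul_assoc]
    omega
  refine ⟨thetaSeries ^ (4 * n + (7 - 2 * k₀)) * v ^ (n + 1), ?_, ?_⟩
  · have h1 := coeff_zero_pow_of_eq_one coeff_zero_thetaSeries (4 * n + (7 - 2 * k₀))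
    have h2 := coeff_zero_pow_of_eq_one hv (n + 1)
    rw [PowerSeries.coeff_zero_eq_constantCoeff] at h1 h2 ⊢
    rw [map_mul, h1, h2, mul_one]
  · have hH : IsCusp4 (2 * (Q * (n + 1) : ℕ) + 2) (F * (Theta ^ 4) ^ A * G) := by
      have := (hF.mul (isModForm_Theta_pow_four.pow A)).mul hG
      have e : ((2 * K : ℕ) : ℤ) + (A : ℤ) * 2 + ((2 * (r * w) : ℕ) : ℤ) = 2 * (Q * (n + 1) : ℕ) + 2 := by
        have : (A : ℤ) + K + r * w = n * Q + Q + 1 := by exact_mod_cast hA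
        push_cast
        linear_combination 2 * this
      rwa [e] at this
    have hHq := (hq.mul ((hasQ_Theta.pow 4).pow A)).mul hE
    have := hres _ _ _ hH hHq
    rw [← this]
    congr 1
    rw [mul_pow, ← pow_mul, ← hA2, ← pow_mul, ← pow_mul, mul_comm Q]
    ring

end Admissible

section Hecke

variable {p : ℕ}

/-- The matrix `(1, b; 0, p)`. -/
def heckeMat (hp : p ≠ 0) (b : ℤ) : GL (Fin 2) ℚ :=
  Matrix.GeneralLinearGroup.mkOfDetNeZero !![1, (b : ℚ); 0, (p : ℚ)] (by simpa using hp)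

/-- The matrix `(p, 0; 0, 1)`. -/
def heckeMatInf (hp : p ≠ 0) : GL (Fin 2) ℚ :=
  Matrix.GeneralLinearGroup.mkOfDetNeZero !![(p : ℚ), 0; 0, 1] (by simpa using hp)

/-- The point `(τ + b) / p`. -/
def addDiv (hp : p ≠ 0) (b : ℤ) (τ : ℍ) : ℍ :=
  ⟨((τ : ℂ) + b) / p, by
    have : 0 < (p : ℝ) := by exact_mod_cast Nat.pos_of_ne_zero hp
    rw [Complex.div_natCast_im]
    simpa using div_pos τ.im_pos this⟩

/-- The point `p τ`. -/
def natSmul (hp : p ≠ 0) (τ : ℍ) : ℍ :=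
  ⟨(p : ℂ) * τ, by
    have : 0 < (p : ℝ) := by exact_mod_cast Nat.pos_of_ne_zero hp
    simpa using mul_pos this τ.im_pos⟩

theorem slash_heckeMat (hp : p ≠ 0) (b : ℤ) (k : ℤ) (f : ℍ → ℂ) (τ : ℍ) :
    (f ∣[k] ((heckeMat hp b).map (Rat.castHom ℝ))) τ = (p : ℂ)⁻¹ * f (addDiv hp b τ) := by
  have hp0 : 0 < (p : ℝ) := by exact_mod_cast Nat.pos_of_ne_zero hp
  have hpc : (p : ℂ) ≠ 0 := by exact_mod_cast hp
  have hdet : ((heckeMat hp b).map (Rat.castHom ℝ)).det.val = p := by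
    simp [heckeMat, Matrix.GeneralLinearGroup.mkOfDetNeZero, Matrix.det_fin_two]
  have hsm : ((heckeMat hp b).map (Rat.castHom ℝ)) • τ = addDiv hp b τ := by
    ext
    rw [UpperHalfPlane.coe_smul_of_det_pos (by rw [hdet]; exact hp0)]
    simp [num, denom, heckeMat, Matrix.GeneralLinearGroup.mkOfDetNeZero]
    rfl
  rw [ModularForm.slash_apply, hsm, hdet, UpperHalfPlane.σ, hdet, if_pos hp0]
  simp only [denom, heckeMat, Matrix.GeneralLinearGroup.mkOfDetNeZero]
  simp
  rw [mul_assoc, ← zpow_neg_one (p : ℂ), ← _root_.zpow_neg, ← zpow_add₀ hpc, mul_comm]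
  congr 2
  ring

theorem slash_heckeMatInf (hp : p ≠ 0) (k : ℤ) (f : ℍ → ℂ) (τ : ℍ) :
    (f ∣[k] ((heckeMatInf hp).map (Rat.castHom ℝ))) τ = (p : ℂ) ^ (k - 1) * f (natSmul hp τ) := by
  have hp0 : 0 < (p : ℝ) := by exact_mod_cast Nat.pos_of_ne_zero hp
  have hdet : ((heckeMatInf hp).map (Rat.castHom ℝ)).det.val = p := by
    simp [heckeMatInf, Matrix.GeneralLinearGroup.mkOfDetNeZero, Matrix.det_fin_two]
  have hsm : ((heckeMatInf hp).map (Rat.castHom ℝ)) • τ = natSmul hp τ := by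
    ext
    rw [UpperHalfPlane.coe_smul_of_det_pos (by rw [hdet]; exact hp0)]
    simp [num, denom, heckeMatInf, Matrix.GeneralLinearGroup.mkOfDetNeZero]
    rfl
  rw [ModularForm.slash_apply, hsm, hdet, UpperHalfPlane.σ, hdet, if_pos hp0]
  simp only [denom, heckeMatInf, Matrix.GeneralLinearGroup.mkOfDetNeZero]
  simp [mul_comm]

theorem slash_mul_of_matrix_eq {k : ℤ} {f : ℍ → ℂ} {γ : SL(2, ℤ)} (hf : f ∣[k] γ = f)
    (A B : GL (Fin 2) ℚ) (σ : SL(2, ℤ))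
    (h : A.val * (σ.val.map (Int.cast : ℤ → ℚ)) = γ.val.map (Int.cast : ℤ → ℚ) * B.val) :
    (f ∣[k] (A.map (Rat.castHom ℝ))) ∣[k] σ = f ∣[k] (B.map (Rat.castHom ℝ)) := by
  have hmat : A.map (Rat.castHom ℝ) * Matrix.SpecialLinearGroup.mapGL ℝ σ =
      Matrix.SpecialLinearGroup.mapGL ℝ γ * B.map (Rat.castHom ℝ) := by
    ext i j
    have := congrArg (fun M : Matrix (Fin 2) (Fin 2) ℚ => ((M i j : ℚ) : ℝ)) h
    simp only [Matrix.mul_apply, Fin.sum_univ_two, Matrix.map_apply] at this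
    push_cast at this
    simpa [Matrix.mul_apply, Fin.sum_univ_two] using this
  rw [ModularForm.SL_slash, ← SlashAction.slash_mul]
  change f ∣[k] (A.map (Rat.castHom ℝ) * Matrix.SpecialLinearGroup.mapGL ℝ σ) = _
  rw [hmat, SlashAction.slash_mul]
  change (f ∣[k] γ) ∣[k] _ = _
  rw [hf]

variable {k : ℤ} {f : ℍ → ℂ}

theorem slash_heckeMat_T (hf : ∀ γ ∈ Gamma0 4, f ∣[k] γ = f) (hp : p ≠ 0) {b b' : ℤ}
    (h : (p : ℤ) ∣ b + 1 - b') : (f ∣[k] ((heckeMat hp b).map (Rat.castHom ℝ))) ∣[k] ModularGroup.T =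
      f ∣[k] ((heckeMat hp b').map (Rat.castHom ℝ)) := by
  obtain ⟨x, hx⟩ := h
  refine slash_mul_of_matrix_eq (γ := ⟨!![1, x; 0, 1], by simp [Matrix.det_fin_two]⟩)
    (hf _ ((mem_gamma0_four_iff _).2 (dvd_zero (4 : ℤ)))) _ _ _ ?_
  have hx' : (b : ℚ) + 1 = b' + x * p := by
    have : b + 1 = b' + x * p := by linarith
    exact_mod_cast this
  ext i j
  fin_cases i <;> fin_cases j <;>
    simp [heckeMat, Matrix.GeneralLinearGroup.mkOfDetNeZero, ModularGroup.T, Matrix.mul_apply, Fin.sum_univ_two]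
  linarith

theorem slash_heckeMatInf_T (hf : ∀ γ ∈ Gamma0 4, f ∣[k] γ = f) (hp : p ≠ 0) :
    (f ∣[k] ((heckeMatInf hp).map (Rat.castHom ℝ))) ∣[k] ModularGroup.T =
      f ∣[k] ((heckeMatInf hp).map (Rat.castHom ℝ)) := by
  refine slash_mul_of_matrix_eq (γ := ⟨!![1, p; 0, 1], by simp [Matrix.det_fin_two]⟩)
    (hf _ ((mem_gamma0_four_iff _).2 (dvd_zero (4 : ℤ)))) _ _ _ ?_
  ext i j
  fin_cases i <;> fin_cases j <;>
    simp [heckeMatInf, Matrix.GeneralLinearGroup.mkOfDetNeZero, ModularGroup.T, Matrix.mul_apply, Fin.sum_univ_two]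

theorem slash_heckeMat_lowerU (hf : ∀ γ ∈ Gamma0 4, f ∣[k] γ = f) (hp : p ≠ 0) {b b' : ℤ}
    (h : (p : ℤ) ∣ b - (1 + 4 * b) * b') : (f ∣[k] ((heckeMat hp b).map (Rat.castHom ℝ))) ∣[k] lowerU =
      f ∣[k] ((heckeMat hp b').map (Rat.castHom ℝ)) := by
  obtain ⟨x, hx⟩ := h
  refine slash_mul_of_matrix_eq (γ := ⟨!![1 + 4 * b, x; 4 * p, 1 - 4 * b'], ?_⟩)
    (hf _ ((mem_gamma0_four_iff _).2 (dvd_mul_right (4 : ℤ) p))) _ _ _ ?_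
  · rw [Matrix.det_fin_two_of]
    linear_combination 4 * hx
  have hx' : (b : ℚ) - (1 + 4 * b) * b' = p * x := by exact_mod_cast hx
  ext i j
  fin_cases i <;> fin_cases j <;>
    simp [heckeMat, Matrix.GeneralLinearGroup.mkOfDetNeZero, lowerU, Matrix.mul_apply, Fin.sum_univ_two] <;>
    linarith

theorem slash_heckeMat_lowerU_inf (hf : ∀ γ ∈ Gamma0 4, f ∣[k] γ = f) (hp : p ≠ 0) {b : ℤ}
    (h : (p : ℤ) ∣ 1 + 4 * b) : (f ∣[k] ((heckeMat hp b).map (Rat.castHom ℝ))) ∣[k] lowerU =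
      f ∣[k] ((heckeMatInf hp).map (Rat.castHom ℝ)) := by
  obtain ⟨x, hx⟩ := h
  refine slash_mul_of_matrix_eq (γ := ⟨!![x, b; 4, p], ?_⟩)
    (hf _ ((mem_gamma0_four_iff _).2 (dvd_refl (4 : ℤ)))) _ _ _ ?_
  · rw [Matrix.det_fin_two_of]
    linear_combination -hx
  have hx' : 1 + 4 * (b : ℚ) = p * x := by exact_mod_cast hx
  ext i j
  fin_cases i <;> fin_cases j <;>
    simp [heckeMat, heckeMatInf, Matrix.GeneralLinearGroup.mkOfDetNeZero, lowerU, Matrix.mul_apply, Fin.sum_univ_two] <;>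
    linarith

theorem slash_heckeMatInf_lowerU (hf : ∀ γ ∈ Gamma0 4, f ∣[k] γ = f) (hp : p ≠ 0) {b : ℤ}
    (h : (p : ℤ) ∣ 1 - 4 * b) : (f ∣[k] ((heckeMatInf hp).map (Rat.castHom ℝ))) ∣[k] lowerU =
      f ∣[k] ((heckeMat hp b).map (Rat.castHom ℝ)) := by
  obtain ⟨x, hx⟩ := h
  refine slash_mul_of_matrix_eq (γ := ⟨!![p, -b; 4, x], ?_⟩)
    (hf _ ((mem_gamma0_four_iff _).2 (dvd_refl (4 : ℤ)))) _ _ _ ?_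
  · rw [Matrix.det_fin_two_of]
    linear_combination -hx
  have hx' : 1 - 4 * (b : ℚ) = p * x := by exact_mod_cast hx
  ext i j
  fin_cases i <;> fin_cases j <;>
    simp [heckeMat, heckeMatInf, Matrix.GeneralLinearGroup.mkOfDetNeZero, lowerU, Matrix.mul_apply, Fin.sum_univ_two] <;>
    linarith

end Hecke

section HeckeOperator

open Function.Periodic

variable {p : ℕ} {k : ℤ} {f : ℍ → ℂ}

theorem HasQ.natSmul {a : PowerSeries ℤ} (hp : p ≠ 0) (ha : HasQ f a) :
    HasQ (f ∘ natSmul hp) (PowerSeries.expand p hp a) := by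
  rw [hasQ_iff]
  intro τ
  have h := ha.hasSum (MaassCongruence.natSmul hp τ)
  have hinj : Function.Injective fun n : ℕ => p * n := mul_right_injective₀ hp
  refine (hinj.hasSum_iff fun n hn => ?_).1 (hasSum_of_eq h fun n => ?_)
  · rw [PowerSeries.coeff_expand_of_not_dvd, Int.cast_zero, zero_mul]
    rintro ⟨m, rfl⟩
    exact hn ⟨m, rfl⟩
  · rw [Function.comp_apply, PowerSeries.coeff_expand_mul, pow_mul]
    congr 2
    rw [qParam, qParam, ← Complex.exp_nat_mul]
    congr 1
    change _ = 2 * π * Complex.I * ((p : ℂ) * τ) / _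
    ring

theorem sum_pow_rootOfUnity {ζ : ℂ} (hζ : IsPrimitiveRoot ζ p) (n : ℕ) :
    ∑ b ∈ Finset.range p, (ζ ^ b) ^ n = if p ∣ n then (p : ℂ) else 0 := by
  have : ∀ b, (ζ ^ b) ^ n = (ζ ^ n) ^ b := fun b => by rw [← pow_mul, ← pow_mul, mul_comm]
  simp only [this]
  split_ifs with h
  · rw [(hζ.pow_eq_one_iff_dvd n).2 h]
    simp
  · have h1 : ζ ^ n ≠ 1 := fun h' => h ((hζ.pow_eq_one_iff_dvd n).1 h')
    rw [geom_sum_eq h1, ← pow_mul, mul_comm, pow_mul, hζ.pow_eq_one, one_pow, sub_self, zero_div]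

theorem HasQ.sum_addDiv {a : PowerSeries ℤ} (hp : p ≠ 0) (ha : HasQ f a) :
    HasQ (fun τ => ∑ b ∈ Finset.range p, (p : ℂ)⁻¹ * f (addDiv hp b τ)) (uOp p a) := by
  rw [hasQ_iff]
  intro τ
  have hpc : (p : ℂ) ≠ 0 := by exact_mod_cast hp
  set w := Complex.exp (2 * π * Complex.I * τ / p) with hw
  set ζ := Complex.exp (2 * π * Complex.I / p) with hζ
  have hζp : IsPrimitiveRoot ζ p := Complex.isPrimitiveRoot_exp p hp
  have hq : ∀ b : ℕ, qParam 1 (addDiv hp b τ : ℂ) = w * ζ ^ b := fun b => by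
    rw [qParam, hw, hζ, ← Complex.exp_nat_mul, ← Complex.exp_add]
    congr 1
    change 2 * π * Complex.I * (((τ : ℂ) + ((b : ℤ) : ℂ)) / p) / _ = _
    push_cast
    field_simp
  have hwp : w ^ p = qParam 1 (τ : ℂ) := by
    rw [hw, qParam, ← Complex.exp_nat_mul]
    congr 1
    push_cast
    field_simp
  have h := hasSum_sum fun b (_ : b ∈ Finset.range p) => (ha.hasSum (addDiv hp b τ)).mul_left (p : ℂ)⁻¹
  have hinj : Function.Injective fun n : ℕ => p * n := mul_right_injective₀ hp
  have e : ∀ n : ℕ, ∑ b ∈ Finset.range p, (p : ℂ)⁻¹ * (a.coeff n * qParam 1 (addDiv hp b τ : ℂ) ^ n) =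
      if p ∣ n then a.coeff n * w ^ n else 0 := fun n => by
    have : ∀ b : ℕ, (p : ℂ)⁻¹ * (a.coeff n * qParam 1 (addDiv hp b τ : ℂ) ^ n) =
        (p : ℂ)⁻¹ * a.coeff n * w ^ n * (ζ ^ b) ^ n := fun b => by rw [hq, mul_pow]; ring
    simp only [this]
    rw [← Finset.mul_sum, sum_pow_rootOfUnity hζp]
    split_ifs
    · field_simp
    · rw [mul_zero]
  have h2 := hasSum_of_eq h fun n => (e n).symm
  rw [← hinj.hasSum_iff] at h2
  · refine hasSum_of_eq h2 fun n => ?_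
    rw [Function.comp_apply, if_pos (dvd_mul_right p n), coeff_uOp, pow_mul, hwp]
  · intro n hn
    rw [if_neg]
    rintro ⟨m, rfl⟩
    exact hn ⟨m, rfl⟩

variable [hp : Fact p.Prime]

/-- The summands of the Hecke operator `T_p`, indexed by the projective line over `𝔽_p`. -/
def heckeTerm (p : ℕ) [hp : Fact p.Prime] (k : ℤ) (f : ℍ → ℂ) : Option (ZMod p) → ℍ → ℂ
  | none => f ∣[k] ((heckeMatInf hp.out.ne_zero).map (Rat.castHom ℝ))
  | some b => f ∣[k] ((heckeMat hp.out.ne_zero b.val).map (Rat.castHom ℝ))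

/-- The Hecke operator `T_p`. -/
def hecke (p : ℕ) [hp : Fact p.Prime] (k : ℤ) (f : ℍ → ℂ) : ℍ → ℂ :=
  ∑ x : Option (ZMod p), heckeTerm p k f x

theorem hecke_slash_eq {γ : SL(2, ℤ)} (e : Option (ZMod p) → Option (ZMod p)) (he : Function.Injective e)
    (h : ∀ x, heckeTerm p k f x ∣[k] γ = heckeTerm p k f (e x)) :
    hecke p k f ∣[k] γ = hecke p k f := by
  rw [hecke, SlashAction.sum_slash]
  simp only [h]
  exact (Finite.injective_iff_bijective.1 he).sum_comp _

theorem hecke_slash_T (hf : ∀ γ ∈ Gamma0 4, f ∣[k] γ = f) :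
    hecke p k f ∣[k] ModularGroup.T = hecke p k f := by
  refine hecke_slash_eq (Option.map (· + 1)) (Option.map_injective (add_left_injective 1)) ?_
  rintro (_ | b)
  · exact slash_heckeMatInf_T hf _
  · refine slash_heckeMat_T hf _ ?_
    rw [← ZMod.intCast_zmod_eq_zero_iff_dvd]
    simp

theorem hecke_slash_lowerU (hodd : Odd p) (hf : ∀ γ ∈ Gamma0 4, f ∣[k] γ = f) :
    hecke p k f ∣[k] lowerU = hecke p k f := by
  have h4 : (4 : ZMod p) ≠ 0 := by
    have h2 : (2 : ZMod p) ≠ 0 := by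
      intro h
      have h' : ((2 : ℕ) : ZMod p) = 0 := by exact_mod_cast h
      rw [ZMod.natCast_eq_zero_iff, Nat.prime_dvd_prime_iff_eq hp.out Nat.prime_two] at h'
      subst h'
      exact absurd hodd (by decide)
    rw [show (4 : ZMod p) = 2 * 2 by norm_num]
    exact mul_ne_zero h2 h2
  classical
  refine hecke_slash_eq (fun x => x.elim (some 4⁻¹) fun b => if 1 + 4 * b = 0 then none else
    some (b / (1 + 4 * b))) ?_ ?_
  · rintro (_ | b) (_ | b') h
    · rfl
    · simp only [Option.elim_none, Option.elim_some] at h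
      split_ifs at h with h'
      rw [Option.some_inj] at h
      field_simp at h
      exact absurd h (by simp)
    · simp only [Option.elim_none, Option.elim_some] at h
      split_ifs at h with h'
      rw [Option.some_inj] at h
      rw [div_eq_iff h', inv_mul_eq_div, eq_div_iff h4] at h
      exact absurd (by linear_combination -h) (one_ne_zero (α := ZMod p))
    · simp only [Option.elim_some] at h
      split_ifs at h with h1 h2 h2
      · have : (4 : ZMod p) * (b - b') = 0 := by linear_combination h1 - h2
        rw [sub_eq_zero.1 ((mul_eq_zero.1 this).resolve_left h4)]
      · rw [Option.some_inj, div_eq_div_iff h1 h2] at h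
        congr 1
        linear_combination h
  · rintro (_ | b)
    · refine slash_heckeMatInf_lowerU hf _ ?_
      rw [← ZMod.intCast_zmod_eq_zero_iff_dvd]
      simp [h4]
    · simp only [Option.elim_some]
      split_ifs with h
      · refine slash_heckeMat_lowerU_inf hf _ ?_
        rw [← ZMod.intCast_zmod_eq_zero_iff_dvd]
        simpa using h
      · refine slash_heckeMat_lowerU hf _ ?_
        rw [← ZMod.intCast_zmod_eq_zero_iff_dvd]
        push_cast
        rw [ZMod.natCast_zmod_val, ZMod.natCast_zmod_val]
        linear_combination -div_mul_cancel₀ b h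

theorem IsCusp4.hecke (hodd : Odd p) (hk : Even k) (hf : IsCusp4 k f) : IsCusp4 k (hecke p k f) where
  holo := by
    have h : ∀ x, MDifferentiable 𝓘(ℂ) 𝓘(ℂ) (heckeTerm p k f x) := by
      rintro (_ | b) <;> exact hf.holo.slash k _
    simp only [UpperHalfPlane.mdifferentiable_iff] at h ⊢
    refine (DifferentiableOn.sum (u := Finset.univ) fun x _ => h x).congr fun z _ => ?_
    simp [MaassCongruence.hecke]
  inv γ hγ := slash_eq_of_generators hk (hecke_slash_T hf.inv) (hecke_slash_lowerU hodd hf.inv) hγ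
  zero σ := by
    rw [MaassCongruence.hecke, SlashAction.sum_slash]
    have h : ∀ x ∈ (Finset.univ : Finset (Option (ZMod p))), Tendsto (heckeTerm p k f x ∣[k] σ) atImInfty (𝓝 0) := by
      rintro (_ | b) _ <;> exact isZeroAtImInfty_slash_rat hf.zero _ σ
    have h2 := tendsto_finsetSum _ h
    rw [Finset.sum_const_zero] at h2
    refine h2.congr fun τ => ?_
    rw [Finset.sum_apply]

theorem hecke_apply (τ : ℍ) : hecke p k f τ = (p : ℂ) ^ (k - 1) * f (natSmul hp.out.ne_zero τ) +
    ∑ b ∈ Finset.range p, (p : ℂ)⁻¹ * f (addDiv hp.out.ne_zero b τ) := by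
  rw [hecke, Finset.sum_apply, Fintype.sum_option]
  congr 1
  · exact slash_heckeMatInf _ _ _ _
  · refine Finset.sum_bij (fun b _ => b.val) (fun b _ => Finset.mem_range.2 b.val_lt)
      (fun b _ b' _ h => ZMod.val_injective p h) (fun i hi => ⟨i, Finset.mem_univ _,
        ZMod.val_cast_of_lt (Finset.mem_range.1 hi)⟩) fun b _ => ?_
    exact slash_heckeMat _ _ _ _ _

theorem HasQ.hecke {K : ℕ} (hK : K ≠ 0) {a : PowerSeries ℤ} (ha : HasQ f a) :
    HasQ (hecke p K f) (PowerSeries.C ((p : ℤ) ^ (K - 1)) * PowerSeries.expand p hp.out.ne_zero a + uOp p a) := by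
  have h1 : HasQ (fun _ => (p : ℂ) ^ (K - 1)) (PowerSeries.C ((p : ℤ) ^ (K - 1))) := by
    rw [HasQ, PowerSeries.map_C]
    simpa using hasQC_const ((p : ℂ) ^ (K - 1))
  have h2 := h1.mul (ha.natSmul hp.out.ne_zero)
  have h3 := ha.sum_addDiv hp.out.ne_zero
  rw [HasQ, map_add]
  have h4 := HasQC.add h2 h3
  intro τ
  have e : MaassCongruence.hecke p K f τ = _ := hecke_apply τ
  rw [e]
  have e2 : (p : ℂ) ^ ((K : ℤ) - 1) = (p : ℂ) ^ (K - 1) := by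
    rw [← zpow_natCast, Nat.cast_sub (by omega), Nat.cast_one]
  rw [e2]
  exact h4 τ

end HeckeOperator

section Iteration

theorem exists_mul_thetaSeries_pow (A : PowerSeries ℤ) (L : ℕ) :
    ∃ c : PowerSeries ℤ, c * thetaSeries ^ L = A := by
  have h : IsUnit thetaSeries := PowerSeries.isUnit_iff_constantCoeff.2 (by
    rw [← PowerSeries.coeff_zero_eq_constantCoeff_apply, coeff_zero_thetaSeries]
    exact isUnit_one)
  obtain ⟨u, hu⟩ := h.pow L
  exact ⟨A * (u⁻¹ : (PowerSeries ℤ)ˣ), by rw [← hu, Units.inv_mul_cancel_right]⟩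

theorem IsAdmissible.exists_dvd_sub {p k₀ : ℕ} (hp : p.Prime) (hodd : Odd p) (j : ℕ) {c : PowerSeries ℤ}
    (hc : IsAdmissible p k₀ c) :
    ∃ c' : PowerSeries ℤ, IsAdmissible p k₀ c' ∧ ∀ n, (p : ℤ) ^ j ∣ c'.coeff n - c.coeff (p * n) := by
  have : Fact p.Prime := ⟨hp⟩
  obtain ⟨t, L, K, F, hK, hF, hq⟩ := hc
  have hr : p = 2 * ((p - 1) / 2) + 1 := by
    obtain ⟨r, rfl⟩ := hodd
    omega
  set r := (p - 1) / 2 with hr'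
  set i := j + 1 with hi
  have hL : 1 ≤ L := by omega
  obtain ⟨s, hs⟩ : ∃ s, p ^ (2 * i) = 4 * s + 1 := by
    have h : 4 ∣ p ^ 2 - 1 ^ 2 := by
      rw [Nat.sq_sub_sq, hr]
      exact ⟨(r + 1) * r, by rw [show 2 * r + 1 - 1 = 2 * r by omega]; ring⟩
    have h1 : p ^ 2 - 1 ^ 2 ∣ (p ^ 2) ^ i - (1 ^ 2) ^ i := Nat.sub_dvd_pow_sub_pow _ _ _
    obtain ⟨s, hs⟩ := h.trans h1
    have : 1 ≤ p ^ (2 * i) := Nat.one_le_pow _ _ hp.pos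
    rw [← pow_mul, one_pow, one_pow] at hs
    exact ⟨s, by omega⟩
  have hsi : i ≤ s := by
    have h3 : 3 ≤ p := by
      have := hp.two_le
      omega
    have h1 : (3 ^ 2) ^ i ≤ (p ^ 2) ^ i := Nat.pow_le_pow_left (Nat.pow_le_pow_left h3 2) i
    have h2 : 1 + i * 8 ≤ (1 + 8) ^ i := by
      exact_mod_cast one_add_mul_le_pow (a := (8 : ℤ)) (by norm_num) i
    rw [← pow_mul p] at h1
    norm_num at h1 h2
    omega
  set m := L * s with hm
  have hsm : s ≤ m := Nat.le_mul_of_pos_left s hL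
  set q₁ := p ^ (2 * i - 1) with hq₁
  have hQ : p * q₁ = p ^ (2 * i) := by
    rw [hq₁, ← pow_succ']
    congr 1
  have hF' : IsCusp4 (2 * (K + m) : ℕ) (F * (Theta ^ 4) ^ m) := by
    have := hF.mul (isModForm_Theta_pow_four.pow m)
    convert this using 1
    push_cast
    ring
  have hq' : HasQ (F * (Theta ^ 4) ^ m) (c * thetaSeries ^ (L * p ^ (2 * i))) := by
    have := hq.mul ((hasQ_Theta.pow 4).pow m)
    convert this using 1
    rw [mul_assoc, ← pow_mul, ← pow_add]
    congr 2
    rw [hs, hm]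
    ring
  have hF₁ := hF'.hecke hodd (by rw [Nat.cast_mul]; exact even_two_mul _)
  have hqT := HasQ.hecke (p := p) (K := 2 * (K + m)) (by omega) hq'
  obtain ⟨c', hc'⟩ := exists_mul_thetaSeries_pow
    (PowerSeries.C ((p : ℤ) ^ (2 * (K + m) - 1)) *
      PowerSeries.expand p hp.ne_zero (c * thetaSeries ^ (L * p ^ (2 * i))) +
      uOp p (c * thetaSeries ^ (L * p ^ (2 * i)))) (L * q₁)
  refine ⟨c', ⟨t + L * q₁, L * q₁, K + m, _, ?_, hF₁, ?_⟩, ?_⟩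
  · have e1 : 4 * m + L = L * (p * q₁) := by rw [hQ, hs, hm]; ring
    have e2 : L * (p * q₁) = 2 * (L * q₁ * r) + L * q₁ := by
      conv_lhs => rw [hr]
      ring
    rw [add_mul, ← hr']
    omega
  · rw [hc']
    exact hqT
  · have hdvd : ((p ^ j : ℕ) : PowerSeries ℤ) ∣ (c' - uOp p c) * thetaSeries ^ (L * q₁) := by
      obtain ⟨w, hw⟩ := dvd_pow_mul_sub_expand hp (2 * i) L thetaSeries
      rw [sub_mul, hc', ← uOp_mul_expand hp.ne_zero, add_sub_assoc]
      refine dvd_add (dvd_mul_of_dvd_left ?_ _) ?_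
      · rw [← Nat.cast_pow, map_natCast]
        exact Nat.cast_dvd_cast (pow_dvd_pow p (by omega))
      · rw [natCast_dvd_powerSeries_iff]
        intro n
        rw [map_sub, coeff_uOp, coeff_uOp, ← map_sub, ← mul_sub]
        refine natCast_dvd_powerSeries_iff.1 (dvd_mul_of_dvd_right (dvd_trans ?_ ⟨w, hw⟩) c) _
        exact Nat.cast_dvd_cast (pow_dvd_pow p (by omega))
    obtain ⟨d, hd⟩ := exists_mul_thetaSeries_pow 1 (L * q₁)
    have h := natCast_dvd_powerSeries_iff.1 (dvd_mul_of_dvd_left hdvd d)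
    intro n
    have := h n
    rwa [mul_assoc, mul_comm _ d, hd, mul_one, map_sub, coeff_uOp, Nat.cast_pow] at this

theorem IsAdmissible.exists_dvd_sub_iterate {p k₀ : ℕ} (hp : p.Prime) (hodd : Odd p) (j b : ℕ)
    {c : PowerSeries ℤ} (hc : IsAdmissible p k₀ c) :
    ∃ c' : PowerSeries ℤ, IsAdmissible p k₀ c' ∧ ∀ n, (p : ℤ) ^ j ∣ c'.coeff n - c.coeff (p ^ b * n) := by
  induction b with
  | zero => exact ⟨c, hc, by simp⟩
  | succ b ih =>
    obtain ⟨c₁, h₁, hd₁⟩ := ih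
    obtain ⟨c₂, h₂, hd₂⟩ := h₁.exists_dvd_sub hp hodd j
    refine ⟨c₂, h₂, fun n => ?_⟩
    have := dvd_add (hd₂ n) (hd₁ (p * n))
    rwa [sub_add_sub_cancel, ← mul_assoc, ← pow_succ] at this

theorem IsAdmissible.exists_pow_dvd_coeff {p k₀ : ℕ} (hp : p.Prime) (hodd : Odd p) (hk₀ : k₀ = 2 ∨ k₀ = 3)
    (j : ℕ) : ∀ {c : PowerSeries ℤ}, IsAdmissible p k₀ c → ∃ b : ℕ, ∀ n, (p : ℤ) ^ j ∣ c.coeff (p ^ b * n) := by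
  induction j with
  | zero => exact fun _ => ⟨0, by simp⟩
  | succ j ih =>
    intro c hc
    obtain ⟨b, hb⟩ := hc.exists_dvd_coeff hp hodd hk₀
    obtain ⟨c₁, h₁, hd₁⟩ := hc.exists_dvd_sub_iterate hp hodd (j + 1) b
    have h1 : ∀ n, (p : ℤ) ∣ c₁.coeff n := fun n =>
      (dvd_sub_left (hb n)).1 (dvd_trans (dvd_pow_self _ j.succ_ne_zero) (hd₁ n))
    obtain ⟨c₂, rfl⟩ := natCast_dvd_powerSeries_iff.2 h1
    have e : ((p : ℕ) : PowerSeries ℤ) = PowerSeries.C (p : ℤ) := (map_natCast _ _).symm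
    rw [e] at h₁ hd₁
    obtain ⟨b', hb'⟩ := ih (h₁.of_mul (by exact_mod_cast hp.ne_zero))
    refine ⟨b + b', fun n => ?_⟩
    have h2 := hd₁ (p ^ b' * n)
    rw [PowerSeries.coeff_C_mul, ← mul_assoc, ← pow_add] at h2
    refine (dvd_sub_right ?_).1 h2
    rw [pow_succ']
    exact mul_dvd_mul_left _ (hb' n)

end Iteration

section HalfIntegralWeight

open Function.Periodic

theorem denomC_eq_denom (σ : SL(2, ℤ)) (τ : ℍ) : denomC σ τ = denom σ τ := by
  rw [ModularGroup.denom_apply, denomC]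

theorem denomC_ne_zero (σ : SL(2, ℤ)) (τ : ℍ) : denomC σ τ ≠ 0 := by
  rw [denomC_eq_denom]
  exact denom_ne_zero _ _

theorem slash_eq_denomC (k : ℤ) (f : ℍ → ℂ) (σ : SL(2, ℤ)) (τ : ℍ) :
    (f ∣[k] σ) τ = f (σ • τ) * denomC σ τ ^ (-k) := by
  rw [ModularForm.SL_slash_apply, denomC_eq_denom]

theorem mdifferentiable_Theta : MDifferentiable 𝓘(ℂ) 𝓘(ℂ) Theta := by
  have h : MDifferentiable 𝓘(ℂ) 𝓘(ℂ) fun τ : ℍ => jacobiTheta τ :=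
    mdifferentiable_of_differentiableAt fun z hz => differentiableAt_jacobiTheta hz
  rw [show Theta = (fun τ : ℍ => jacobiTheta τ) ∘ dbl from funext Theta_eq]
  exact MDifferentiable.comp_dbl h

theorem tendsto_zero_of_pow {α : Type*} {l : Filter α} {g : α → ℂ} {n : ℕ} (hn : n ≠ 0)
    (h : Tendsto (fun x => g x ^ n) l (𝓝 0)) : Tendsto g l (𝓝 0) := by
  rw [tendsto_zero_iff_norm_tendsto_zero] at h ⊢
  have h2 := h.rpow_const (p := (n : ℝ)⁻¹) (Or.inr (by positivity))
  rw [Real.zero_rpow (by positivity)] at h2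
  refine h2.congr fun x => ?_
  rw [norm_pow, Real.pow_rpow_inv_natCast (norm_nonneg _) hn]

theorem hasQ_shift_of_fourierAtInfty {f : ℍ → ℂ} {c : ℤ → ℤ} (hc : FourierAtInfty f fun n => (c n : ℂ)) {N : ℕ}
    (hN : ∀ n : ℤ, n < -N → c n = 0) :
    HasQ (fun τ => qParam 1 (τ : ℂ) ^ N * f τ) (PowerSeries.mk fun m => c (m - N)) := by
  rw [hasQ_iff]
  intro τ
  have h := (hc τ).mul_left (qParam 1 (τ : ℂ) ^ N)
  have hinj : Function.Injective fun m : ℕ => (m : ℤ) - N := fun a b hab => by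
    simpa using hab
  rw [← hinj.hasSum_iff] at h
  · refine hasSum_of_eq h fun m => ?_
    rw [PowerSeries.coeff_mk, Function.comp_apply, mul_left_comm, qParam, ← Complex.exp_nat_mul,
      ← Complex.exp_nat_mul, ← Complex.exp_add]
    congr 2
    push_cast
    ring
  · intro n hn
    suffices c n = 0 by simp only [this, Int.cast_zero, zero_mul, mul_zero]
    refine hN n ?_
    by_contra hlt
    exact hn ⟨(n + N).toNat, by simp only; omega⟩

theorem coeff_eq_zero_of_tendsto {f : ℍ → ℂ} {c : ℤ → ℤ} (hc : FourierAtInfty f fun n => (c n : ℂ))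
    (hf : Tendsto f atImInfty (𝓝 0)) : ∀ n ≤ 0, c n = 0 := by
  have hN : ∃ N : ℕ, ∀ n : ℤ, n < -N → c n = 0 := by
    have h := (hc UpperHalfPlane.I).summable.tendsto_cofinite_zero.norm
    rw [norm_zero] at h
    have hfin := h.eventually (gt_mem_nhds zero_lt_one)
    rw [eventually_cofinite] at hfin
    obtain ⟨B, hB⟩ := hfin.bddBelow
    refine ⟨B.natAbs, fun n hn => ?_⟩
    by_contra hcn
    have : n ∈ {x : ℤ | ¬‖(c x : ℂ) * Complex.exp (2 * π * Complex.I * x * UpperHalfPlane.I)‖ < 1} := by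
      rw [Set.mem_ofPred_eq, not_lt, norm_mul, Complex.norm_exp]
      have h1 : (1 : ℝ) ≤ ‖(c n : ℂ)‖ := by
        rw [Complex.norm_intCast]
        exact_mod_cast Int.one_le_abs hcn
      have h2 : (1 : ℝ) ≤ Real.exp (2 * π * Complex.I * n * UpperHalfPlane.I : ℂ).re := by
        rw [Real.one_le_exp_iff]
        have hn0 : (n : ℝ) ≤ 0 := by
          have : n ≤ 0 := by omega
          exact_mod_cast this
        have := Real.pi_pos
        simp
        nlinarith
      exact one_le_mul_of_one_le_of_one_le h1 h2
    have := hB this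
    omega
  have key : ∀ N : ℕ, (∀ n : ℤ, n < -N → c n = 0) → c (-N) = 0 := fun N hN => by
    have h1 := HasQC.tendsto (hasQ_shift_of_fourierAtInfty hc hN)
    have h2 := (qParam_tendsto_zero.pow N).mul hf
    rw [mul_zero] at h2
    have h3 := tendsto_nhds_unique h1 h2
    rw [PowerSeries.coeff_map, PowerSeries.coeff_mk, eq_intCast] at h3
    simpa using h3
  obtain ⟨N, hN⟩ := hN
  induction N with
  | zero =>
    intro n hn
    rcases hn.lt_or_eq with h | rfl
    · exact hN n (by simpa using h)
    · simpa using key 0 hN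
  | succ N ih =>
    refine ih fun n hn => ?_
    rcases lt_or_eq_of_le (show n ≤ -((N + 1 : ℕ) : ℤ) by omega) with h | rfl
    · exact hN n h
    · exact key _ hN

theorem hasQ_of_isCuspFormHalf {k : ℤ} {f : ℍ → ℂ} (hf : IsCuspFormHalf 1 k f) {c : ℤ → ℤ}
    (hc : FourierAtInfty f fun n => (c n : ℂ)) : HasQ f (PowerSeries.mk fun n => c n) := by
  have h : Tendsto f atImInfty (𝓝 0) := by
    refine (hf.decay 1).congr fun τ => ?_
    simp [denomC]
  have h0 := coeff_eq_zero_of_tendsto hc h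
  have := hasQ_shift_of_fourierAtInfty hc (N := 0) fun n hn => h0 n (by simpa using hn.le)
  simpa using this

theorem isCusp4_mul_of_isCuspFormHalf {k L K : ℕ} (hK : 4 * K = 2 * k + 1 + L) {f : ℍ → ℂ}
    (hf : IsCuspFormHalf 1 k f) : IsCusp4 (2 * K : ℕ) (f * Theta ^ L) where
  holo := hf.toIsHoloForm.holo.mul (mdifferentiable_Theta.pow L)
  inv γ hγ := by
    ext τ
    have h1 := hf.toIsHoloForm.transf γ (by simpa using hγ) τ
    have h2 := congrFun (isModForm_Theta_pow_four.inv γ hγ) τ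
    have h3 := Theta_ne_zero τ
    have hd := denomC_ne_zero γ τ
    rw [slash_eq_denomC] at h2 ⊢
    simp only [Pi.mul_apply, Pi.pow_apply] at h2 ⊢
    set x := Theta (γ • τ) / Theta τ with hx
    have hx' : Theta (γ • τ) = x * Theta τ := by rw [hx, div_mul_cancel₀ _ h3]
    have hx4 : x ^ 4 = denomC γ τ ^ 2 := by
      rw [hx, div_pow, div_eq_iff (pow_ne_zero _ h3), ← h2]
      field_simp
    rw [h1, hx', _root_.zpow_neg, zpow_natCast, show (2 * (k : ℤ) + 1) = ((2 * k + 1 : ℕ) : ℤ) by push_cast; ring,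
      zpow_natCast, mul_pow, pow_mul, ← hx4, ← pow_mul, hK]
    have hx0 : x ≠ 0 := fun h => by
      rw [h, zero_pow four_ne_zero] at hx4
      exact pow_ne_zero 2 hd hx4.symm
    field_simp
    ring
  zero σ := by
    refine tendsto_zero_of_pow four_ne_zero (g := (f * Theta ^ L) ∣[((2 * K : ℕ) : ℤ)] σ) ?_
    have h1 := (hf.decay σ).pow 4
    rw [zero_pow four_ne_zero] at h1
    have h2 := h1.zero_mul_isBoundedUnder_le ((isModForm_Theta_pow_four.pow L).bdd σ).isBoundedUnder_le
    refine h2.congr fun τ => ?_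
    have hd := denomC_ne_zero σ τ
    rw [slash_eq_denomC, slash_eq_denomC, mul_pow, ← Complex.cpow_nat_mul]
    rw [show ((4 : ℕ) : ℂ) * -(((k : ℤ) : ℂ) + 1 / 2) = ((-(4 * k + 2 : ℕ) : ℤ) : ℂ) by push_cast; ring,
      Complex.cpow_intCast]
    simp only [Pi.mul_apply, Pi.pow_apply]
    rw [show (L : ℤ) * 2 = ((L * 2 : ℕ) : ℤ) by push_cast; ring]
    simp only [_root_.zpow_neg, zpow_natCast]
    have e : (denomC σ τ ^ (2 * K)) ^ 4 = denomC σ τ ^ (4 * k + 2) * denomC σ τ ^ (L * 2) := by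
      rw [← pow_mul, ← pow_add]
      congr 1
      omega
    rw [mul_pow _ (_)⁻¹, inv_pow, e, mul_inv, mul_pow, ← pow_mul, ← pow_mul, mul_comm 4 L]
    ring

end HalfIntegralWeight

theorem exists_isAdmissible {p k : ℕ} (hk : 2 ≤ k)
    (hcong : k ≡ 2 [MOD (p - 1) / 2] ∨ k ≡ 3 [MOD (p - 1) / 2]) {f : ℍ → ℂ} (hf : IsCuspFormHalf 1 (k : ℤ) f)
    {c : ℤ → ℤ} (hc : FourierAtInfty f (fun n => (c n : ℂ))) :
    ∃ k₀ : ℕ, (k₀ = 2 ∨ k₀ = 3) ∧ IsAdmissible p k₀ (PowerSeries.mk fun n => c n) := by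
  have h : ∃ k₀ t : ℕ, (k₀ = 2 ∨ k₀ = 3) ∧ k = k₀ + t * ((p - 1) / 2) := by
    have key : ∀ k₀ ≤ k, k ≡ k₀ [MOD (p - 1) / 2] → ∃ t, k = k₀ + t * ((p - 1) / 2) := fun k₀ h h' => by
      obtain ⟨t, ht⟩ := (Nat.modEq_iff_dvd' h).1 h'.symm
      exact ⟨t, by rw [mul_comm, ← ht]; omega⟩
    rcases hcong with h | h
    · obtain ⟨t, ht⟩ := key 2 hk h
      exact ⟨2, t, Or.inl rfl, ht⟩
    · rcases hk.eq_or_lt with rfl | hk'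
      · exact ⟨2, 0, Or.inl rfl, by simp⟩
      · obtain ⟨t, ht⟩ := key 3 hk' h
        exact ⟨3, t, Or.inr rfl, ht⟩
  obtain ⟨k₀, t, hk₀, rfl⟩ := h
  obtain ⟨L, K, hK⟩ : ∃ L K, 4 * K = 2 * (k₀ + t * ((p - 1) / 2)) + 1 + L := by
    generalize k₀ + t * ((p - 1) / 2) = k
    exact ⟨3 - 2 * (k % 2), k / 2 + 1, by omega⟩
  exact ⟨k₀, hk₀, t, L, K, f * Theta ^ L, hK, isCusp4_mul_of_isCuspFormHalf hK hf,
    (hasQ_of_isCuspFormHalf hf hc).mul (hasQ_Theta.pow L)⟩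

theorem dvd_sum_divisors {p : ℕ} (hp : p.Prime) {k j B : ℕ} (hk : 2 ≤ k) {c : ℤ → ℤ}
    (hB : ∀ n : ℕ, (p : ℤ) ^ j ∣ c ((p ^ B * n : ℕ) : ℤ)) {D F : ℕ} (hF : 0 < F) (hFD : F ^ 2 ∣ D)
    (hpD : p ^ (B + 2 * j) ∣ D) (φ : ℕ → ℤ) :
    (p : ℤ) ^ j ∣ ∑ a ∈ F.divisors, (a : ℤ) ^ (k - 1) * φ a * c ((D / a ^ 2 : ℕ) : ℤ) := by
  refine Finset.dvd_sum fun a ha => ?_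
  have haF := Nat.dvd_of_mem_divisors ha
  have ha0 : a ≠ 0 := by
    rintro rfl
    exact hF.ne' (Nat.eq_zero_of_zero_dvd haF)
  by_cases h : p ^ j ∣ a
  · refine dvd_mul_of_dvd_left (dvd_mul_of_dvd_left ?_ _) _
    refine dvd_trans ?_ (dvd_pow_self _ (show k - 1 ≠ 0 by omega))
    exact_mod_cast h
  · refine dvd_mul_of_dvd_right ?_ _
    obtain ⟨d, rfl⟩ := (pow_dvd_pow_of_dvd haF 2).trans hFD
    rw [Nat.mul_div_cancel_left _ (by positivity)]
    obtain ⟨e, m, hm, hem⟩ := Nat.exists_eq_pow_mul_and_not_dvd ha0 p hp.ne_one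
    have hej : e < j := by
      by_contra hje
      exact h (hem ▸ dvd_mul_of_dvd_left (pow_dvd_pow p (not_lt.1 hje)) m)
    have hcop : Nat.Coprime (p ^ B) (m ^ 2) :=
      Nat.Coprime.pow _ _ ((Nat.Prime.coprime_iff_not_dvd hp).2 hm)
    have h2 : p ^ (2 * e) * p ^ B ∣ p ^ (2 * e) * (m ^ 2 * d) := by
      have e1 : p ^ (2 * e) * (m ^ 2 * d) = a ^ 2 * d := by rw [hem]; ring
      rw [e1, ← pow_add]
      exact dvd_trans (pow_dvd_pow p (by omega)) hpD
    obtain ⟨n, rfl⟩ := hcop.dvd_of_dvd_mul_left (Nat.dvd_of_mul_dvd_mul_left (pow_pos hp.pos _) h2)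
    exact hB n

end MaassCongruence

/-- Let `p` be an odd prime, `k ≥ 2` with `k ≡ 2` or `3 (mod (p−1)/2)`, and
`f` a cusp form of weight `k + 1/2` on `Γ₀(4)` with rational integer coefficients `c(n)` at
`∞`. Then for every `j ≥ 1` there is `b ≥ 1` such that for all `D, F ≥ 1` with `F² ∣ D` and
`p^b ∣ D` and every `φ : ℕ → ℤ`, `Σ_{a ∣ F} a^{k−1}·φ(a)·c(D/a²) ≡ 0 (mod p^j)`. -/
theorem statement8
    (p : ℕ) (hp : p.Prime) (hodd : Odd p)
    (k : ℕ) (hk : 2 ≤ k)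
    (hcong : k ≡ 2 [MOD (p - 1) / 2] ∨ k ≡ 3 [MOD (p - 1) / 2])
    (f : ℍ → ℂ) (hf : IsCuspFormHalf 1 (k : ℤ) f)
    (c : ℤ → ℤ) (hc : FourierAtInfty f (fun n => (c n : ℂ))) :
    ∀ j : ℕ, 0 < j → ∃ b : ℕ, 0 < b ∧
      ∀ D F : ℕ, 0 < D → 0 < F → F ^ 2 ∣ D → p ^ b ∣ D → ∀ φ : ℕ → ℤ,
        (p : ℤ) ^ j ∣ ∑ a ∈ F.divisors, (a : ℤ) ^ (k - 1) * φ a * c ((D / a ^ 2 : ℕ) : ℤ) := by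
  intro j hj
  obtain ⟨k₀, hk₀, hadm⟩ := MaassCongruence.exists_isAdmissible hk hcong hf hc
  obtain ⟨B, hB⟩ := hadm.exists_pow_dvd_coeff hp hodd hk₀ j
  simp only [PowerSeries.coeff_mk] at hB
  exact ⟨B + 2 * j, by omega, fun D F _ hF hFD hpD φ => MaassCongruence.dvd_sum_divisors hp hk hB hF hFD hpD φ⟩

end
end

section
/- For τ ∈ ℍ and q = e^{2πiτ}, define R₄(τ) := q·∏_{n≥1}(1−q^{4n})^8·(1−q^{2n})^{−4}, R₈(τ) := q²·∏_{n≥1}(1−q^{8n})^8·(1−q^{4n})^{−4}, R₁₂(τ) := q⁴·∏_{n≥1}(1−q^{12n})^{12}·(1−q^{2n})²·(1−q^{6n})^{−6}·(1−q^{4n})^{−4}, and R₁₆(τ) := q⁴·∏_{n≥1}(1−q^{16n})^8·(1−q^{8n})^{−4} (the products converge locally uniformly on ℍ). Then for each N ∈ {1,2,3,4}: (a) R_{4N}((aτ+b)/(cτ+d)) = (cτ+d)²·R_{4N}(τ) for every (a,b;c,d) ∈ Γ₀(4N); (b) for every σ = (a,b;c,d) ∈ SL₂(ℤ), the function (cτ+d)^{−2}·R_{4N}(στ)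 is bounded on {τ : Im τ ≥ 1}, so R_{4N} is a holomorphic modular form of weight 2 on Γ₀(4N); (c) R_{4N}(τ) ≠ 0 for every τ ∈ ℍ; and (d) for every σ = (a,b;c,d) ∈ SL₂(ℤ) such that σ∞ is not Γ₀(4N)-equivalent to ∞, the limit of (c·(it)+d)^{−2}·R_{4N}(σ(it)) as t → ∞ exists and is nonzero, i.e. the only zero of R_{4N} is at the cusp ∞. -/
open Complex UpperHalfPlane Matrix MatrixGroups CongruenceSubgroup Filter Topology

set_option synthInstance.maxHeartbeats 1000000
set_option maxHeartbeats 1000000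

noncomputable section

/-- `q = e^{2πiτ}`. -/
def qq (τ : ℍ) : ℂ := Complex.exp (2 * Real.pi * Complex.I * (τ : ℂ))

/-- The factor of the infinite product defining `R₄`. -/
def fac4 (τ : ℍ) (n : ℕ) : ℂ :=
  (1 - qq τ ^ (4 * (n + 1))) ^ 8 * ((1 - qq τ ^ (2 * (n + 1))) ^ 4)⁻¹

/-- The factor of the infinite product defining `R₈`. -/
def fac8 (τ : ℍ) (n : ℕ) : ℂ :=
  (1 - qq τ ^ (8 * (n + 1))) ^ 8 * ((1 - qq τ ^ (4 * (n + 1))) ^ 4)⁻¹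

/-- The factor of the infinite product defining `R₁₂`. -/
def fac12 (τ : ℍ) (n : ℕ) : ℂ :=
  (1 - qq τ ^ (12 * (n + 1))) ^ 12 * (1 - qq τ ^ (2 * (n + 1))) ^ 2 *
    ((1 - qq τ ^ (6 * (n + 1))) ^ 6)⁻¹ * ((1 - qq τ ^ (4 * (n + 1))) ^ 4)⁻¹

/-- The factor of the infinite product defining `R₁₆`. -/
def fac16 (τ : ℍ) (n : ℕ) : ℂ :=
  (1 - qq τ ^ (16 * (n + 1))) ^ 8 * ((1 - qq τ ^ (8 * (n + 1))) ^ 4)⁻¹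

/-- `R₄(τ) = q·∏_{n≥1}(1−q^{4n})^8(1−q^{2n})^{−4}`. -/
def R4 (τ : ℍ) : ℂ := qq τ * ∏' n : ℕ, fac4 τ n

/-- `R₈(τ) = q²·∏_{n≥1}(1−q^{8n})^8(1−q^{4n})^{−4}`. -/
def R8 (τ : ℍ) : ℂ := qq τ ^ 2 * ∏' n : ℕ, fac8 τ n

/-- `R₁₂(τ) = q⁴·∏_{n≥1}(1−q^{12n})^{12}(1−q^{2n})²(1−q^{6n})^{−6}(1−q^{4n})^{−4}`. -/
def R12 (τ : ℍ) : ℂ := qq τ ^ 4 * ∏' n : ℕ, fac12 τ n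

/-- `R₁₆(τ) = q⁴·∏_{n≥1}(1−q^{16n})^8(1−q^{8n})^{−4}`. -/
def R16 (τ : ℍ) : ℂ := qq τ ^ 4 * ∏' n : ℕ, fac16 τ n

/-- `R_{4N}` for `N = 1, 2, 3, 4`. -/
def RR : ℕ → ℍ → ℂ
  | 1 => R4
  | 2 => R8
  | 3 => R12
  | 4 => R16
  | _ => fun _ => 0

/-- The point `it ∈ ℍ` for `t > 0`. -/
def vpt (t : {t : ℝ // 0 < t}) : ℍ := ⟨Complex.I * (t : ℝ), by simpa using t.2⟩

/-- The automorphy factor `cτ + d`. -/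
def autFactor (γ : SL(2, ℤ)) (τ : ℍ) : ℂ := (γ 1 0 : ℂ) * (τ : ℂ) + (γ 1 1 : ℂ)

lemma autFactor_ne_zero (γ : SL(2, ℤ)) (τ : ℍ) : autFactor γ τ ≠ 0 := by
  have := UpperHalfPlane.denom_ne_zero (γ : GL (Fin 2) ℝ) τ
  rwa [ModularGroup.denom_apply] at this

lemma coe_smul_eq_div (γ : SL(2, ℤ)) (τ : ℍ) :
    ((γ • τ : ℍ) : ℂ) = ((γ 0 0 : ℂ) * (τ : ℂ) + (γ 0 1 : ℂ)) / autFactor γ τ := by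
  rw [UpperHalfPlane.coe_specialLinearGroup_apply]
  simp [autFactor]

lemma autFactor_one (τ : ℍ) : autFactor 1 τ = 1 := by
  simp [autFactor]

lemma autFactor_mul (γ γ' : SL(2, ℤ)) (τ : ℍ) :
    autFactor (γ * γ') τ = autFactor γ (γ' • τ) * autFactor γ' τ := by
  have h := autFactor_ne_zero γ' τ
  have h2 : autFactor γ (γ' • τ) = (γ 1 0 : ℂ) * ((γ' • τ : ℍ) : ℂ) + (γ 1 1 : ℂ) := rfl
  rw [h2, coe_smul_eq_div, add_mul, mul_assoc, div_mul_cancel₀ _ h]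
  simp [autFactor, Matrix.mul_apply, Fin.sum_univ_two]
  ring

/-- The 3-part of the exponent of the multiplier of `η²`. -/
def etaExp3 (a b c d : ZMod 3) : ZMod 3 := (a + d) * c - b * d * (c ^ 2 - 1)

/-- The 4-part of the exponent of the multiplier of `η²`. -/
def etaExp4 (a b c d : ZMod 4) : ZMod 4 :=
  c ^ 3 * (a + d + 1) + (1 - c ^ 2) * (d * (b - c + 3) + 1)

/-- The multiplier of `η²`, a character of `SL(2, ℤ)` of order `12`. -/
def etaMult (γ : SL(2, ℤ)) : ℂ :=
  ZMod.stdAddChar (etaExp3 (γ 0 0) (γ 0 1) (γ 1 0) (γ 1 1)) *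
    ZMod.stdAddChar (-etaExp4 (γ 0 0) (γ 0 1) (γ 1 0) (γ 1 1))

lemma etaMult_ne_zero (γ : SL(2, ℤ)) : etaMult γ ≠ 0 := by
  simp [etaMult, ZMod.stdAddChar_apply]

lemma etaMult_one : etaMult 1 = 1 := by
  have h3 : etaExp3 1 0 0 1 = 0 := by decide
  have h4 : etaExp4 1 0 0 1 = 0 := by decide
  simp [etaMult, h3, h4]

lemma det_eq_one (γ : SL(2, ℤ)) : γ 0 0 * γ 1 1 - γ 0 1 * γ 1 0 = 1 := by
  rw [← Matrix.det_fin_two]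
  exact γ.det_coe

lemma det_eq_one_zmod (n : ℕ) (γ : SL(2, ℤ)) :
    (γ 0 0 : ZMod n) * (γ 1 1 : ZMod n) - (γ 0 1 : ZMod n) * (γ 1 0 : ZMod n) = 1 := by
  exact_mod_cast congrArg (Int.cast : ℤ → ZMod n) (det_eq_one γ)

lemma etaMult_T : etaMult ModularGroup.T = Complex.exp (2 * Real.pi * Complex.I / 12) := by
  have h3 : etaExp3 1 1 0 1 = ((1 : ℤ) : ZMod 3) := by decide
  have h4 : -etaExp4 1 1 0 1 = ((-1 : ℤ) : ZMod 4) := by decide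
  simp only [etaMult, ModularGroup.T, Matrix.SpecialLinearGroup.coe_mk, Matrix.of_apply,
    Matrix.cons_val', Matrix.cons_val_zero, Matrix.cons_val_one, Matrix.cons_val_fin_one,
    Int.cast_one, Int.cast_zero, h3, h4]
  rw [← Int.cast_one (R := ZMod 3), ZMod.stdAddChar_coe, ZMod.stdAddChar_coe, ← Complex.exp_add]
  congr 1
  push_cast
  ring

lemma etaMult_S : etaMult ModularGroup.S = -Complex.I := by
  have h3 : etaExp3 0 (-1) 1 0 = 0 := by decide
  have h4 : -etaExp4 0 (-1) 1 0 = ((-1 : ℤ) : ZMod 4) := by decide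
  have h : ZMod.stdAddChar ((-1 : ℤ) : ZMod 4) = -Complex.I := by
    rw [ZMod.stdAddChar_coe, show 2 * (Real.pi : ℂ) * Complex.I * ((-1 : ℤ) : ℂ) / ((4 : ℕ) : ℂ)
      = -(Real.pi / 2 * Complex.I) by push_cast; ring, Complex.exp_neg, Complex.exp_pi_div_two_mul_I,
      Complex.inv_I]
  simp only [etaMult, ModularGroup.S, Matrix.SpecialLinearGroup.coe_mk, Matrix.of_apply,
    Matrix.cons_val', Matrix.cons_val_zero, Matrix.cons_val_one, Matrix.cons_val_fin_one,
    Int.cast_one, Int.cast_zero, Int.cast_neg, h3, h4]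
  rw [AddChar.map_zero_eq_one, one_mul]
  exact_mod_cast h

lemma mul_entry (γ γ' : SL(2, ℤ)) (i j : Fin 2) :
    (γ * γ') i j = γ i 0 * γ' 0 j + γ i 1 * γ' 1 j := by
  rw [Matrix.SpecialLinearGroup.coe_mul, Matrix.mul_apply, Fin.sum_univ_two]

lemma etaMult_T_mul (γ : SL(2, ℤ)) : etaMult (ModularGroup.T * γ) =
    etaMult ModularGroup.T * etaMult γ := by
  have h3 : ∀ a b c d : ZMod 3, a * d - b * c = 1 →
    etaExp3 (a + c) (b + d) c d = etaExp3 1 1 0 1 + etaExp3 a b c d := by decide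
  have h4 : ∀ a b c d : ZMod 4, a * d - b * c = 1 →
    -etaExp4 (a + c) (b + d) c d = -etaExp4 1 1 0 1 + -etaExp4 a b c d := by decide
  have h3' := h3 _ _ _ _ (det_eq_one_zmod 3 γ)
  have h4' := h4 _ _ _ _ (det_eq_one_zmod 4 γ)
  have e00 : (ModularGroup.T * γ) 0 0 = γ 0 0 + γ 1 0 := by
    rw [mul_entry]
    simp [ModularGroup.coe_T]
  have e01 : (ModularGroup.T * γ) 0 1 = γ 0 1 + γ 1 1 := by
    rw [mul_entry]
    simp [ModularGroup.coe_T]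
  have e10 : (ModularGroup.T * γ) 1 0 = γ 1 0 := by
    rw [mul_entry]
    simp [ModularGroup.coe_T]
  have e11 : (ModularGroup.T * γ) 1 1 = γ 1 1 := by
    rw [mul_entry]
    simp [ModularGroup.coe_T]
  simp only [etaMult, e00, e01, e10, e11, Int.cast_add, h3', h4', AddChar.map_add_eq_mul]
  simp [ModularGroup.T]
  ring

lemma etaMult_S_mul (γ : SL(2, ℤ)) : etaMult (ModularGroup.S * γ) =
    etaMult ModularGroup.S * etaMult γ := by
  have h3 : ∀ a b c d : ZMod 3, a * d - b * c = 1 →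
    etaExp3 (-c) (-d) a b = etaExp3 0 (-1) 1 0 + etaExp3 a b c d := by decide
  have h4 : ∀ a b c d : ZMod 4, a * d - b * c = 1 →
    -etaExp4 (-c) (-d) a b = -etaExp4 0 (-1) 1 0 + -etaExp4 a b c d := by decide
  have h3' := h3 _ _ _ _ (det_eq_one_zmod 3 γ)
  have h4' := h4 _ _ _ _ (det_eq_one_zmod 4 γ)
  have e00 : (ModularGroup.S * γ) 0 0 = -γ 1 0 := by
    rw [mul_entry]
    simp [ModularGroup.coe_S]
  have e01 : (ModularGroup.S * γ) 0 1 = -γ 1 1 := by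
    rw [mul_entry]
    simp [ModularGroup.coe_S]
  have e10 : (ModularGroup.S * γ) 1 0 = γ 0 0 := by
    rw [mul_entry]
    simp [ModularGroup.coe_S]
  have e11 : (ModularGroup.S * γ) 1 1 = γ 0 1 := by
    rw [mul_entry]
    simp [ModularGroup.coe_S]
  simp only [etaMult, e00, e01, e10, e11, Int.cast_neg, h3', h4', AddChar.map_add_eq_mul]
  simp [ModularGroup.S]
  ring

/-- The function `η²` on the complex plane. -/
def etaSq (z : ℂ) : ℂ := ModularForm.eta z ^ 2

lemma etaSq_T (τ : ℍ) : etaSq ((ModularGroup.T • τ : ℍ) : ℂ) =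
    etaMult ModularGroup.T * autFactor ModularGroup.T τ * etaSq τ := by
  have h : autFactor ModularGroup.T τ = 1 := by simp [autFactor, ModularGroup.T]
  have h1 : Function.Periodic.qParam 1 (1 + (τ : ℂ)) = Function.Periodic.qParam 1 (τ : ℂ) := by
    simp [Function.Periodic.qParam, mul_add, Complex.exp_add]
  rw [etaMult_T, h, UpperHalfPlane.modular_T_smul, UpperHalfPlane.coe_vadd]
  simp only [etaSq, ModularForm.eta, ModularForm.eta_q, Complex.ofReal_one, h1, mul_one, mul_pow,
    ← mul_assoc]
  congr 1
  simp only [Function.Periodic.qParam, ← Complex.exp_nat_mul, ← Complex.exp_add]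
  congr 1
  push_cast
  ring

lemma etaSq_S (τ : ℍ) : etaSq ((ModularGroup.S • τ : ℍ) : ℂ) =
    etaMult ModularGroup.S * autFactor ModularGroup.S τ * etaSq τ := by
  have h : autFactor ModularGroup.S τ = τ := by simp [autFactor, ModularGroup.S]
  have hs (z : ℂ) : Complex.sqrt z ^ 2 = z := by
    rw [Complex.sqrt]
    exact_mod_cast Complex.cpow_nat_inv_pow z two_ne_zero
  have key := ModularForm.eta_comp_eq_csqrt_I_inv τ.2
  simp only [Function.comp, Pi.smul_apply, Pi.mul_apply, smul_eq_mul] at key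
  rw [etaMult_S, h, UpperHalfPlane.modular_S_smul]
  simp only [etaSq]
  rw [show (-(τ : ℂ))⁻¹ = -1 / (τ : ℂ) by rw [inv_neg, neg_div, one_div], key, mul_pow, mul_pow,
    inv_pow, hs, hs, Complex.inv_I]
  ring

/-- The transformation law of `η²` under the full modular group. -/
theorem etaSq_smul (γ : SL(2, ℤ)) (τ : ℍ) : etaSq ((γ • τ : ℍ) : ℂ) =
    etaMult γ * autFactor γ τ * etaSq τ := by
  have hγ : γ ∈ Subgroup.closure {ModularGroup.S, ModularGroup.T} := by
    simp [SpecialLinearGroup.SL2Z_generators]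
  suffices H : (∀ M, etaMult (γ * M) = etaMult γ * etaMult M) ∧
      ∀ τ : ℍ, etaSq ((γ • τ : ℍ) : ℂ) = etaMult γ * autFactor γ τ * etaSq τ from H.2 τ
  induction hγ using Subgroup.closure_induction with
  | mem x hx =>
    rcases hx with rfl | hx
    · exact ⟨etaMult_S_mul, etaSq_S⟩
    · rw [Set.mem_singleton_iff] at hx
      subst hx
      exact ⟨etaMult_T_mul, etaSq_T⟩
  | one => simp [etaMult_one, autFactor_one]
  | mul x y _ _ hx hy =>
    refine ⟨fun M ↦ by rw [mul_assoc, hx.1, hy.1, hx.1, mul_assoc], fun τ ↦ ?_⟩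
    rw [mul_smul, hx.2, hy.2, hx.1, autFactor_mul]
    ring
  | inv x _ hx =>
    have h1 : etaMult x * etaMult x⁻¹ = 1 := by rw [← hx.1, mul_inv_cancel, etaMult_one]
    refine ⟨fun M ↦ ?_, fun τ ↦ ?_⟩
    · have h2 := hx.1 (x⁻¹ * M)
      rw [mul_inv_cancel_left] at h2
      rw [h2, ← mul_assoc, mul_comm (etaMult x⁻¹), h1, one_mul]
    · have h2 := hx.2 (x⁻¹ • τ)
      have h3 := autFactor_mul x x⁻¹ τ
      rw [smul_inv_smul] at h2
      rw [mul_inv_cancel, autFactor_one] at h3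
      rw [h2]
      linear_combination (-etaSq ((x⁻¹ • τ : ℍ) : ℂ)) * h1 +
        etaMult x * etaMult x⁻¹ * etaSq ((x⁻¹ • τ : ℍ) : ℂ) * h3

/-- The Euler product `∏ (1 - qⁿ)`. -/
def eulerProd (q : ℂ) : ℂ := ∏' n : ℕ, (1 - q ^ (n + 1))

lemma continuousAt_eulerProd {q : ℂ} (hq : ‖q‖ < 1) : ContinuousAt eulerProd q :=
  (ModularForm.differentiableOn_tprod_one_sub_pow.differentiableAt
    (Metric.isOpen_ball.mem_nhds (by simpa using hq))).continuousAt

lemma tendsto_prod_eulerProd {q : ℂ} (hq : ‖q‖ < 1) :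
    Tendsto (fun p : Finset ℕ × ℂ ↦ ∏ n ∈ p.1, (1 - p.2 ^ (n + 1))) (atTop ×ˢ 𝓝 q)
      (𝓝 (eulerProd q)) := by
  have hmem : q ∈ Metric.ball (0 : ℂ) 1 := by simpa using hq
  have h := tendstoLocallyUniformlyOn_iff_filter.mp
    ModularForm.multipliableLocallyUniformlyOn_one_sub_pow.hasProdLocallyUniformlyOn q hmem
  rw [Metric.isOpen_ball.nhdsWithin_eq hmem] at h
  exact Filter.Tendsto.congr_uniformity ((continuousAt_eulerProd hq).tendsto.comp tendsto_snd)
    (tendstoUniformlyOnFilter_iff_tendsto.mp h)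

lemma one_sub_pow_ne_zero {q : ℂ} (hq : ‖q‖ < 1) {n : ℕ} (hn : n ≠ 0) : 1 - q ^ n ≠ 0 := by
  intro h
  have h1 : ‖q ^ n‖ < 1 := by
    rw [norm_pow]
    exact pow_lt_one₀ (norm_nonneg q) hq hn
  rw [← sub_eq_zero.mp h] at h1
  simp at h1

lemma eulerProd_ne_zero {q : ℂ} (hq : ‖q‖ < 1) : eulerProd q ≠ 0 := by
  have hs : Summable fun n : ℕ ↦ ‖-q ^ (n + 1)‖ := by
    simp only [norm_neg, norm_pow]
    exact (summable_nat_add_iff 1).mpr (summable_geometric_of_lt_one (norm_nonneg q) hq)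
  have := tprod_one_add_ne_zero_of_summable (f := fun n : ℕ ↦ -q ^ (n + 1))
    (fun n ↦ by rw [← sub_eq_add_neg]; exact one_sub_pow_ne_zero hq n.succ_ne_zero) hs
  simpa only [eulerProd, ← sub_eq_add_neg] using this

lemma eulerProd_zero : eulerProd 0 = 1 := by
  simp [eulerProd]

lemma etaSq_eq (z : ℂ) : etaSq z =
    Complex.exp (2 * Real.pi * Complex.I * z / 12) *
      eulerProd (Complex.exp (2 * Real.pi * Complex.I * z)) ^ 2 := by
  have h : ∀ n : ℕ, ModularForm.eta_q n z =
      Complex.exp (2 * Real.pi * Complex.I * z) ^ (n + 1) := by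
    intro n
    rw [ModularForm.eta_q_eq_pow]
  simp only [etaSq, ModularForm.eta, h, eulerProd, mul_pow, Function.Periodic.qParam]
  rw [← Complex.exp_nat_mul]
  congr 2
  push_cast
  ring

lemma norm_qq_lt_one (τ : ℍ) : ‖qq τ‖ < 1 := by
  rw [qq, Complex.norm_exp]
  have : (2 * Real.pi * Complex.I * (τ : ℂ)).re = -(2 * Real.pi * τ.im) := by
    simp
  rw [this, Real.exp_lt_one_iff, neg_lt_zero]
  have := τ.im_pos
  positivity

lemma continuous_qq : Continuous qq := by
  unfold qq
  fun_prop

/-- The `η²`-quotient `∏ η(δz)^(2 s_δ)`. -/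
def etaQuot (S : Finset ℕ) (s : ℕ → ℤ) (z : ℂ) : ℂ := ∏ δ ∈ S, etaSq (δ * z) ^ s δ

/-- The `n`-th factor of the infinite product of an `η²`-quotient. -/
def etaQuotFactor (S : Finset ℕ) (s : ℕ → ℤ) (q : ℂ) (n : ℕ) : ℂ :=
  ∏ δ ∈ S, ((1 - q ^ (δ * (n + 1))) ^ 2) ^ s δ

section

variable {S : Finset ℕ} (s : ℕ → ℤ)

lemma tendsto_prod_etaQuotFactor (hS : ∀ δ ∈ S, δ ≠ 0) (τ : ℍ) :
    Tendsto (fun p : Finset ℕ × ℍ ↦ ∏ n ∈ p.1, etaQuotFactor S s (qq p.2) n) (atTop ×ˢ 𝓝 τ)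
      (𝓝 (∏ δ ∈ S, (eulerProd (qq τ ^ δ) ^ 2) ^ s δ)) := by
  have h : (fun p : Finset ℕ × ℍ ↦ ∏ n ∈ p.1, etaQuotFactor S s (qq p.2) n) =
      fun p ↦ ∏ δ ∈ S, ((∏ n ∈ p.1, (1 - (qq p.2 ^ δ) ^ (n + 1))) ^ 2) ^ s δ := by
    funext p
    simp only [etaQuotFactor, pow_mul]
    rw [Finset.prod_comm]
    simp only [Finset.prod_zpow, Finset.prod_pow]
  rw [h]
  refine tendsto_finsetProd _ fun δ hδ ↦ ?_
  have hq : ‖qq τ ^ δ‖ < 1 := by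
    rw [norm_pow]
    exact pow_lt_one₀ (norm_nonneg _) (norm_qq_lt_one τ) (hS δ hδ)
  refine Tendsto.zpow₀ (Tendsto.pow ?_ 2) _ (.inl (pow_ne_zero _ (eulerProd_ne_zero hq)))
  have hpair : Tendsto (fun p : Finset ℕ × ℍ ↦ (p.1, qq p.2 ^ δ)) (atTop ×ˢ 𝓝 τ)
      (atTop ×ˢ 𝓝 (qq τ ^ δ)) :=
    tendsto_fst.prodMk (((continuous_qq.pow δ).tendsto τ).comp tendsto_snd)
  simpa only [Function.comp_def] using (tendsto_prod_eulerProd hq).comp hpair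

lemma tprod_etaQuotFactor (hS : ∀ δ ∈ S, δ ≠ 0) (τ : ℍ) :
    ∏' n, etaQuotFactor S s (qq τ) n = ∏ δ ∈ S, (eulerProd (qq τ ^ δ) ^ 2) ^ s δ := by
  refine HasProd.tprod_eq ?_
  rw [HasProd, SummationFilter.unconditional_filter]
  have hpair : Tendsto (fun t : Finset ℕ ↦ (t, τ)) atTop (atTop ×ˢ 𝓝 τ) :=
    tendsto_id.prodMk tendsto_const_nhds
  simpa only [Function.comp_def] using (tendsto_prod_etaQuotFactor s hS τ).comp hpair

lemma tendstoLocallyUniformly_etaQuotFactor (hS : ∀ δ ∈ S, δ ≠ 0) :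
    TendstoLocallyUniformly
      (fun (t : Finset ℕ) (τ : ℍ) ↦ ∏ n ∈ t, etaQuotFactor S s (qq τ) n)
      (fun τ ↦ ∏' n, etaQuotFactor S s (qq τ) n) atTop := by
  rw [tendstoLocallyUniformly_iff_filter]
  intro τ
  rw [tendstoUniformlyOnFilter_iff_tendsto]
  have hlim : Tendsto (fun τ : ℍ ↦ ∏' n, etaQuotFactor S s (qq τ) n) (𝓝 τ)
      (𝓝 (∏ δ ∈ S, (eulerProd (qq τ ^ δ) ^ 2) ^ s δ)) := by
    simp only [tprod_etaQuotFactor s hS]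
    refine tendsto_finsetProd _ fun δ hδ ↦ ?_
    have hq : ‖qq τ ^ δ‖ < 1 := by
      rw [norm_pow]
      exact pow_lt_one₀ (norm_nonneg _) (norm_qq_lt_one τ) (hS δ hδ)
    refine Tendsto.zpow₀ (Tendsto.pow ?_ 2) _ (.inl (pow_ne_zero _ (eulerProd_ne_zero hq)))
    exact (continuousAt_eulerProd hq).tendsto.comp ((continuous_qq.pow δ).tendsto τ)
  refine Tendsto.mono_right ?_ (nhds_le_uniformity
    (∏ δ ∈ S, (eulerProd (qq τ ^ δ) ^ 2) ^ s δ))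
  rw [nhds_prod_eq]
  exact (hlim.comp tendsto_snd).prodMk (tendsto_prod_etaQuotFactor s hS τ)

lemma etaQuot_eq_qq_pow_mul_tprod (hS : ∀ δ ∈ S, δ ≠ 0) {m : ℕ}
    (hm : ∑ δ ∈ S, δ * s δ = 12 * m) (τ : ℍ) :
    etaQuot S s τ = qq τ ^ m * ∏' n, etaQuotFactor S s (qq τ) n := by
  rw [tprod_etaQuotFactor s hS, etaQuot]
  simp only [etaSq_eq, mul_zpow]
  rw [Finset.prod_mul_distrib]
  congr 1
  · simp only [← Complex.exp_int_mul, ← Complex.exp_sum, qq, ← Complex.exp_nat_mul]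
    have h := congrArg (Int.cast : ℤ → ℂ) hm
    push_cast at h
    have h2 : (m : ℂ) = (∑ δ ∈ S, (δ : ℂ) * s δ) / 12 := by rw [h]; ring
    rw [h2, Finset.sum_div, Finset.sum_mul]
    congr 1
    refine Finset.sum_congr rfl fun δ _ ↦ ?_
    ring
  · refine Finset.prod_congr rfl fun δ _ ↦ ?_
    rw [qq, ← Complex.exp_nat_mul]
    congr 4
    ring

lemma etaQuot_ne_zero (hS : ∀ δ ∈ S, δ ≠ 0) (τ : ℍ) : etaQuot S s τ ≠ 0 := by
  refine Finset.prod_ne_zero_iff.mpr fun δ hδ ↦ zpow_ne_zero _ (pow_ne_zero _ ?_)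
  refine ModularForm.eta_ne_zero ?_
  have := τ.im_pos
  have h0 : 0 < δ := Nat.pos_of_ne_zero (hS δ hδ)
  simp [UpperHalfPlane.upperHalfPlaneSet]
  positivity

end

lemma etaSq_mul_smul {δ A D : ℕ} {B : ℤ} (hD : D ≠ 0) {σ σ' : SL(2, ℤ)}
    (h00 : δ * σ 0 0 = σ' 0 0 * A) (h01 : δ * σ 0 1 = σ' 0 0 * B + σ' 0 1 * D)
    (h10 : σ 1 0 = σ' 1 0 * A) (h11 : σ 1 1 = σ' 1 0 * B + σ' 1 1 * D) {τ w : ℍ}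
    (hw : (w : ℂ) = (A * τ + B) / D) :
    etaSq (δ * (σ • τ : ℍ)) = etaMult σ' / D * autFactor σ τ * etaSq w := by
  have hD' : (D : ℂ) ≠ 0 := Nat.cast_ne_zero.mpr hD
  replace hw : (D : ℂ) * w = A * τ + B := by rw [hw]; field_simp
  have c00 := congrArg (Int.cast : ℤ → ℂ) h00
  have c01 := congrArg (Int.cast : ℤ → ℂ) h01
  have c10 := congrArg (Int.cast : ℤ → ℂ) h10
  have c11 := congrArg (Int.cast : ℤ → ℂ) h11
  push_cast at c00 c01 c10 c11
  have haut : autFactor σ τ = D * autFactor σ' w := by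
    simp only [autFactor, c10, c11]
    linear_combination -(σ' 1 0 : ℂ) * hw
  have hsmul : (δ : ℂ) * (σ • τ : ℍ) = (σ' • w : ℍ) := by
    have h1 := autFactor_ne_zero σ' w
    rw [coe_smul_eq_div, coe_smul_eq_div, haut]
    field_simp
    linear_combination (τ : ℂ) * c00 + c01 - (σ' 0 0 : ℂ) * hw
  rw [hsmul, etaSq_smul, haut]
  field_simp

/-- Every matrix `diag(δ, 1) σ` factors as an element of `SL(2, ℤ)` times an upper triangular
matrix with diagonal `gcd(δ, c), δ / gcd(δ, c)`. -/
lemma exists_factorization (σ : SL(2, ℤ)) {δ : ℕ} (hδ : δ ≠ 0) :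
    ∃ (D : ℕ) (B : ℤ) (σ' : SL(2, ℤ)), δ = Nat.gcd δ (σ 1 0).natAbs * D ∧
      δ * σ 0 0 = σ' 0 0 * (Nat.gcd δ (σ 1 0).natAbs : ℕ) ∧
      δ * σ 0 1 = σ' 0 0 * B + σ' 0 1 * D ∧
      σ 1 0 = σ' 1 0 * (Nat.gcd δ (σ 1 0).natAbs : ℕ) ∧ σ 1 1 = σ' 1 0 * B + σ' 1 1 * D := by
  have hdet := det_eq_one σ
  set a := σ 0 0
  set b := σ 0 1
  set c := σ 1 0
  set d := σ 1 1
  set A := Nat.gcd δ c.natAbs with hA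
  have hA0 : A ≠ 0 := Nat.gcd_ne_zero_left hδ
  obtain ⟨D, hD⟩ : A ∣ δ := Nat.gcd_dvd_left _ _
  obtain ⟨c₁, hc⟩ : (A : ℤ) ∣ c := Int.natCast_dvd.mpr (Nat.gcd_dvd_right _ _)
  have hD' : (δ : ℤ) = A * D := by exact_mod_cast hD
  have hcop : IsCoprime (D : ℤ) c₁ := by
    have h1 : (A : ℤ) = (δ : ℤ) * Int.gcdA δ c + c * Int.gcdB δ c := by
      rw [← Int.gcd_eq_gcd_ab, hA, Int.gcd, Int.natAbs_natCast]
    refine ⟨Int.gcdA δ c, Int.gcdB δ c, ?_⟩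
    have h2 : (A : ℤ) ≠ 0 := by exact_mod_cast hA0
    apply mul_left_cancel₀ h2
    generalize Int.gcdA δ c = x at h1 ⊢
    generalize Int.gcdB δ c = y at h1 ⊢
    linear_combination -h1 - x * hD' - y * hc
  have hcop' : IsCoprime a c₁ := ⟨d, -(b * A), by rw [hc] at hdet; linear_combination hdet⟩
  obtain ⟨u, v, huv⟩ := hcop.mul_left hcop'
  refine ⟨D, u * δ * b + v * d, ⟨!![D * a, -v; c₁, u], ?_⟩, hD, ?_, ?_, ?_, ?_⟩
  · rw [Matrix.det_fin_two_of]
    linear_combination huv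
  · simp
    rw [hD']
    ring
  · simp
    linear_combination -(δ * b : ℤ) * huv - v * D * hdet + b * v * c₁ * hD' - v * D * b * hc
  · simp
    linear_combination hc
  · simp
    linear_combination -d * huv + u * D * hdet + u * D * b * hc - u * b * c₁ * hD'

lemma exists_etaSq_mul_smul (σ : SL(2, ℤ)) {δ : ℕ} (hδ : δ ≠ 0) :
    ∃ C : ℂ, C ≠ 0 ∧ ∃ θ : ℝ, ∀ τ : ℍ, etaSq (δ * (σ • τ : ℍ)) =
      C * autFactor σ τ *
        (Complex.exp (2 * Real.pi * Complex.I * τ *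
            ((Nat.gcd δ (σ 1 0).natAbs : ℂ) ^ 2 / (12 * δ))) *
          eulerProd (Complex.exp (2 * Real.pi * Complex.I *
            (((Nat.gcd δ (σ 1 0).natAbs ^ 2 / δ : ℝ) : ℂ) * τ + θ))) ^ 2) := by
  obtain ⟨D, B, σ', hD, h00, h01, h10, h11⟩ := exists_factorization σ hδ
  have hA0 : Nat.gcd δ (σ 1 0).natAbs ≠ 0 := Nat.gcd_ne_zero_left hδ
  set A := Nat.gcd δ (σ 1 0).natAbs
  have hD0 : D ≠ 0 := by
    rintro rfl
    exact hδ (by simpa using hD)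
  have hD' : (D : ℂ) ≠ 0 := Nat.cast_ne_zero.mpr hD0
  have hA' : (A : ℂ) ≠ 0 := Nat.cast_ne_zero.mpr hA0
  have hδ' : (δ : ℂ) = A * D := by exact_mod_cast hD
  refine ⟨etaMult σ' / D * Complex.exp (2 * Real.pi * Complex.I * (B / D) / 12),
    mul_ne_zero (div_ne_zero (etaMult_ne_zero σ') hD') (Complex.exp_ne_zero _), B / D, fun τ ↦ ?_⟩
  have him : 0 < (((A : ℂ) * τ + B) / D).im := by
    have h1 : ((A : ℂ) * τ + B) / D = (((A / D : ℝ) : ℂ) * τ + ((B / D : ℝ) : ℂ)) := by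
      push_cast
      field_simp
    have := τ.im_pos
    rw [h1, Complex.add_im, Complex.ofReal_im, Complex.im_ofReal_mul, add_zero]
    have : 0 < A := Nat.pos_of_ne_zero hA0
    have : 0 < D := Nat.pos_of_ne_zero hD0
    simp only [UpperHalfPlane.coe_im]
    positivity
  rw [etaSq_mul_smul hD0 h00 h01 h10 h11 (w := ⟨_, him⟩) rfl, UpperHalfPlane.coe_mk, etaSq_eq]
  have e1 : Complex.exp (2 * Real.pi * Complex.I * (((A : ℂ) * τ + B) / D) / 12) =
      Complex.exp (2 * Real.pi * Complex.I * (B / D) / 12) *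
        Complex.exp (2 * Real.pi * Complex.I * τ * ((A : ℂ) ^ 2 / (12 * δ))) := by
    rw [← Complex.exp_add, hδ']
    congr 1
    field_simp
    ring
  have e2 : 2 * Real.pi * Complex.I * (((A : ℂ) * τ + B) / D) =
      2 * Real.pi * Complex.I * (((A ^ 2 / δ : ℝ) : ℂ) * τ + ((B / D : ℝ) : ℂ)) := by
    push_cast
    rw [hδ']
    field_simp
  rw [e1, e2]
  ring

lemma norm_cexp_two_pi_I_mul (r θ : ℝ) (τ : ℍ) :
    ‖Complex.exp (2 * Real.pi * Complex.I * ((r : ℂ) * τ + θ))‖ =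
      Real.exp (-(2 * Real.pi * r * τ.im)) := by
  rw [Complex.norm_exp]
  congr 1
  simp
  ring

lemma prod_addChar_zpow {A : Type*} [AddCommGroup A] (ψ : AddChar A ℂ) (S : Finset ℕ)
    (s : ℕ → ℤ) (f : ℕ → A) : ∏ δ ∈ S, ψ (f δ) ^ s δ = ψ (∑ δ ∈ S, s δ • f δ) := by
  induction S using Finset.cons_induction with
  | empty => simp
  | cons δ T hδ ih =>
    rw [Finset.prod_cons, Finset.sum_cons, ih, AddChar.map_add_eq_mul, AddChar.map_zsmul_eq_zpow]

/-- Arithmetic conditions under which the quotient `∏ η(δz)^(2 s_δ)` has weight `2` and trivial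
multiplier for `Γ₀(M)`, and vanishes only at the cusp `∞`. -/
structure IsCuspInftyQuotient (M : ℕ) (S : Finset ℕ) (s : ℕ → ℤ) : Prop where
  ne_zero : M ≠ 0
  dvd : ∀ δ ∈ S, δ ∣ M
  weight : ∑ δ ∈ S, s δ = 2
  exp3 : ∀ a b c d : ZMod 3, a * d - b * (M * c) = 1 →
    ∑ δ ∈ S, s δ • etaExp3 a (δ * b) ((M / δ : ℕ) * c) d = 0
  exp4 : ∀ a b c d : ZMod 4, a * d - b * (M * c) = 1 →
    ∑ δ ∈ S, s δ • -etaExp4 a (δ * b) ((M / δ : ℕ) * c) d = 0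
  order_nonneg : ∀ g ∈ M.divisors, 0 ≤ ∑ δ ∈ S, s δ * ((M / δ : ℕ) * (Nat.gcd δ g : ℤ) ^ 2)
  order_eq_zero : ∀ g ∈ M.divisors, g ≠ M →
    ∑ δ ∈ S, s δ * ((M / δ : ℕ) * (Nat.gcd δ g : ℤ) ^ 2) = 0

namespace IsCuspInftyQuotient

variable {M : ℕ} {S : Finset ℕ} {s : ℕ → ℤ}

lemma index_ne_zero (h : IsCuspInftyQuotient M S s) : ∀ δ ∈ S, δ ≠ 0 :=
  fun δ hδ ↦ ne_zero_of_dvd_ne_zero h.ne_zero (h.dvd δ hδ)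

lemma prod_autFactor_zpow (h : IsCuspInftyQuotient M S s) (σ : SL(2, ℤ)) (τ : ℍ) :
    ∏ δ ∈ S, autFactor σ τ ^ s δ = autFactor σ τ ^ 2 := by
  have : ∀ T : Finset ℕ, ∏ δ ∈ T, autFactor σ τ ^ s δ = autFactor σ τ ^ ∑ δ ∈ T, s δ := by
    intro T
    induction T using Finset.cons_induction with
    | empty => simp
    | cons δ T hδ ih =>
      rw [Finset.prod_cons, Finset.sum_cons, ih, zpow_add₀ (autFactor_ne_zero σ τ)]
  rw [this, h.weight, zpow_ofNat]

lemma etaQuot_smul (h : IsCuspInftyQuotient M S s) {γ : SL(2, ℤ)} (hγ : γ ∈ Gamma0 M) (τ : ℍ) :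
    etaQuot S s (γ • τ : ℍ) = autFactor γ τ ^ 2 * etaQuot S s τ := by
  obtain ⟨k, hk⟩ := (ZMod.intCast_zmod_eq_zero_iff_dvd _ M).mp (Gamma0_mem.mp hγ)
  have hdet := det_eq_one γ
  have hdiv : ∀ δ ∈ S, (M : ℤ) = δ * (M / δ : ℕ) := fun δ hδ ↦ by
    exact_mod_cast (Nat.mul_div_cancel' (h.dvd δ hδ)).symm
  have hdetn : ∀ n : ℕ, (γ 0 0 : ZMod n) * (γ 1 1 : ZMod n) -
      (γ 0 1 : ZMod n) * ((M : ZMod n) * (k : ZMod n)) = 1 := fun n ↦ by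
    have := det_eq_one_zmod n γ
    rw [hk] at this
    exact_mod_cast this
  set ψ : ℕ → ℂ := fun δ ↦
    ZMod.stdAddChar (etaExp3 (γ 0 0) (δ * γ 0 1) ((M / δ : ℕ) * k) (γ 1 1)) *
      ZMod.stdAddChar (-etaExp4 (γ 0 0) (δ * γ 0 1) ((M / δ : ℕ) * k) (γ 1 1)) with hψ
  have key : ∀ δ ∈ S, etaSq (δ * (γ • τ : ℍ)) = ψ δ * autFactor γ τ * etaSq (δ * τ) := by
    intro δ hδ
    have hδ0 : 0 < δ := Nat.pos_of_ne_zero (h.index_ne_zero δ hδ)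
    have him : 0 < ((δ : ℂ) * τ).im := by
      have := τ.im_pos
      simp only [Complex.mul_im, Complex.natCast_re, Complex.natCast_im, zero_mul, add_zero,
        UpperHalfPlane.coe_im]
      positivity
    have hdet' : (!![γ 0 0, δ * γ 0 1; (M / δ : ℕ) * k, γ 1 1] : Matrix _ _ ℤ).det = 1 := by
      rw [Matrix.det_fin_two_of]
      rw [hk] at hdet
      linear_combination hdet + γ 0 1 * k * hdiv δ hδ
    have := etaSq_mul_smul (δ := δ) (A := δ) (B := 0) one_ne_zero (σ := γ)
      (σ' := ⟨_, hdet'⟩) (τ := τ) (w := ⟨_, him⟩) (by simp [mul_comm]) (by simp)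
      (by simp [-Int.natCast_ediv]; rw [hk]; linear_combination k * hdiv δ hδ) (by simp) (by simp)
    rw [this]
    simp [etaMult, hψ, -Int.natCast_ediv]
  have hone : ∏ δ ∈ S, ψ δ ^ s δ = 1 := by
    simp only [hψ, mul_zpow]
    rw [Finset.prod_mul_distrib, prod_addChar_zpow, prod_addChar_zpow,
      h.exp3 _ _ _ _ (hdetn 3), h.exp4 _ _ _ _ (hdetn 4)]
    simp
  rw [etaQuot, Finset.prod_congr rfl fun δ hδ ↦ by rw [key δ hδ]]
  simp only [mul_zpow, Finset.prod_mul_distrib]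
  rw [hone, one_mul, h.prod_autFactor_zpow, etaQuot]

lemma exists_slash_eq (h : IsCuspInftyQuotient M S s) (σ : SL(2, ℤ)) :
    ∃ (C : ℂ) (θ : ℕ → ℝ) (m : ℝ), C ≠ 0 ∧ 0 ≤ m ∧ (¬ (M : ℤ) ∣ σ 1 0 → m = 0) ∧
      ∀ τ : ℍ, (autFactor σ τ ^ 2)⁻¹ * etaQuot S s (σ • τ : ℍ) =
        C * Complex.exp (2 * Real.pi * Complex.I * τ * m) *
          ∏ δ ∈ S, (eulerProd (Complex.exp (2 * Real.pi * Complex.I *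
            (((Nat.gcd δ (σ 1 0).natAbs ^ 2 / δ : ℝ) : ℂ) * τ + θ δ))) ^ 2) ^ s δ := by
  choose! C hC θ hθ using fun δ (hδ : δ ∈ S) ↦ exists_etaSq_mul_smul σ (h.index_ne_zero δ hδ)
  set c := (σ 1 0).natAbs
  set g := Nat.gcd M c
  have hg : g ∈ M.divisors := Nat.mem_divisors.mpr ⟨Nat.gcd_dvd_left _ _, h.ne_zero⟩
  have hgcd : ∀ δ ∈ S, Nat.gcd δ g = Nat.gcd δ c := fun δ hδ ↦ by
    rw [← Nat.gcd_assoc, Nat.gcd_eq_left (h.dvd δ hδ)]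
  set k : ℤ := ∑ δ ∈ S, s δ * ((M / δ : ℕ) * (Nat.gcd δ g : ℤ) ^ 2) with hk
  refine ⟨∏ δ ∈ S, C δ ^ s δ, θ, k / (12 * M), ?_, ?_, ?_, fun τ ↦ ?_⟩
  · exact Finset.prod_ne_zero_iff.mpr fun δ hδ ↦ zpow_ne_zero _ (hC δ hδ)
  · have : (0 : ℝ) ≤ k := by exact_mod_cast h.order_nonneg g hg
    positivity
  · intro hdvd
    have : k = 0 := h.order_eq_zero g hg fun hgM ↦ hdvd <|
      Int.natCast_dvd.mpr (Nat.gcd_eq_left_iff_dvd.mp hgM)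
    simp [this]
  · have hexp : ∏ δ ∈ S, Complex.exp (2 * Real.pi * Complex.I * τ *
        ((Nat.gcd δ c : ℂ) ^ 2 / (12 * δ))) ^ s δ =
        Complex.exp (2 * Real.pi * Complex.I * τ * (k / (12 * M) : ℝ)) := by
      simp only [← Complex.exp_int_mul, ← Complex.exp_sum]
      rw [hk]
      push_cast [-Int.natCast_ediv]
      rw [Finset.sum_div, Finset.mul_sum]
      congr 1
      refine Finset.sum_congr rfl fun δ hδ ↦ ?_
      have h1 : (δ : ℂ) ≠ 0 := Nat.cast_ne_zero.mpr (h.index_ne_zero δ hδ)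
      have h2 : (M : ℂ) ≠ 0 := Nat.cast_ne_zero.mpr h.ne_zero
      rw [hgcd δ hδ, Nat.cast_div (h.dvd δ hδ) h1]
      field_simp
    rw [etaQuot, Finset.prod_congr rfl fun δ hδ ↦ by rw [hθ δ hδ τ]]
    simp only [mul_zpow, Finset.prod_mul_distrib]
    rw [hexp, h.prod_autFactor_zpow]
    have := autFactor_ne_zero σ τ
    field_simp

lemma exists_norm_slash_le (h : IsCuspInftyQuotient M S s) (σ : SL(2, ℤ)) :
    ∃ K : ℝ, ∀ τ : ℍ, 1 ≤ τ.im →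
      ‖(autFactor σ τ ^ 2)⁻¹ * etaQuot S s (σ • τ : ℍ)‖ ≤ K := by
  obtain ⟨C, θ, m, -, hm, -, heq⟩ := h.exists_slash_eq σ
  have hbound : ∀ δ ∈ S, ∃ K : ℝ, ∀ τ : ℍ, 1 ≤ τ.im →
      ‖(eulerProd (Complex.exp (2 * Real.pi * Complex.I *
        (((Nat.gcd δ (σ 1 0).natAbs ^ 2 / δ : ℝ) : ℂ) * τ + θ δ))) ^ 2) ^ s δ‖ ≤ K := by
    intro δ hδ
    have hδ0 := h.index_ne_zero δ hδ
    have hr : (0 : ℝ) < Nat.gcd δ (σ 1 0).natAbs ^ 2 / δ := by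
      have h1 : 0 < Nat.gcd δ (σ 1 0).natAbs := Nat.pos_of_ne_zero (Nat.gcd_ne_zero_left hδ0)
      have h2 : 0 < δ := Nat.pos_of_ne_zero hδ0
      positivity
    set r : ℝ := Nat.gcd δ (σ 1 0).natAbs ^ 2 / δ
    have hlt : Real.exp (-(2 * Real.pi * r)) < 1 := by
      rw [Real.exp_lt_one_iff, neg_lt_zero]
      positivity
    obtain ⟨K, hK⟩ := (isCompact_closedBall (0 : ℂ)
      (Real.exp (-(2 * Real.pi * r)))).exists_bound_of_continuousOn
        (f := fun q ↦ (eulerProd q ^ 2) ^ s δ) fun q hq ↦ by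
          have hq' : ‖q‖ < 1 := (mem_closedBall_zero_iff.mp hq).trans_lt hlt
          exact (((continuousAt_eulerProd hq').pow 2).zpow₀ _
            (.inl (pow_ne_zero _ (eulerProd_ne_zero hq')))).continuousWithinAt
    refine ⟨K, fun τ hτ ↦ hK _ ?_⟩
    rw [mem_closedBall_zero_iff, norm_cexp_two_pi_I_mul, Real.exp_le_exp]
    exact neg_le_neg (le_mul_of_one_le_right (by positivity) hτ)
  choose! K hK using hbound
  refine ⟨‖C‖ * 1 * ∏ δ ∈ S, K δ, fun τ hτ ↦ ?_⟩
  rw [heq τ, norm_mul, norm_mul, norm_prod]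
  gcongr with δ hδ
  · have hnorm := norm_cexp_two_pi_I_mul m 0 τ
    rw [Complex.ofReal_zero, add_zero, mul_comm (m : ℂ), ← mul_assoc] at hnorm
    rw [hnorm, Real.exp_le_one_iff, neg_nonpos]
    have := τ.im_pos
    positivity
  · exact hK δ hδ τ hτ

lemma exists_tendsto_slash (h : IsCuspInftyQuotient M S s) (σ : SL(2, ℤ))
    (hσ : ¬ (M : ℤ) ∣ σ 1 0) :
    ∃ l : ℂ, l ≠ 0 ∧ Tendsto
      (fun t : {t : ℝ // 0 < t} ↦
        (autFactor σ (vpt t) ^ 2)⁻¹ * etaQuot S s (σ • vpt t : ℍ)) atTop (𝓝 l) := by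
  obtain ⟨C, θ, m, hC, -, hm, heq⟩ := h.exists_slash_eq σ
  refine ⟨C, hC, ?_⟩
  simp only [heq, hm hσ, Complex.ofReal_zero, mul_zero, Complex.exp_zero, mul_one]
  rw [show 𝓝 C = 𝓝 (C * ∏ δ ∈ S, (eulerProd 0 ^ 2) ^ s δ) by simp [eulerProd_zero]]
  refine tendsto_const_nhds.mul (tendsto_finsetProd _ fun δ hδ ↦ ?_)
  refine Tendsto.zpow₀ (Tendsto.pow ?_ 2) _ (.inl (by simp [eulerProd_zero]))
  refine (continuousAt_eulerProd (by simp)).tendsto.comp ?_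
  have hδ0 := h.index_ne_zero δ hδ
  have hr : (0 : ℝ) < Nat.gcd δ (σ 1 0).natAbs ^ 2 / δ := by
    have h1 : 0 < Nat.gcd δ (σ 1 0).natAbs := Nat.pos_of_ne_zero (Nat.gcd_ne_zero_left hδ0)
    have h2 : 0 < δ := Nat.pos_of_ne_zero hδ0
    positivity
  rw [tendsto_zero_iff_norm_tendsto_zero]
  simp only [norm_cexp_two_pi_I_mul]
  refine Real.tendsto_exp_atBot.comp (tendsto_neg_atTop_atBot.comp ?_)
  have hval : Tendsto (fun t : {t : ℝ // 0 < t} ↦ (t : ℝ)) atTop atTop :=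
    (map_val_Ioi_atTop (0 : ℝ)).le
  refine Tendsto.const_mul_atTop (by positivity) ?_
  simpa [vpt] using hval

lemma slash_properties (h : IsCuspInftyQuotient M S s) {f : ℍ → ℂ}
    (hf : ∀ τ, f τ = etaQuot S s τ) :
    (∀ γ ∈ Gamma0 M, ∀ τ : ℍ,
      f (γ • τ) = ((γ 1 0 : ℂ) * (τ : ℂ) + (γ 1 1 : ℂ)) ^ 2 * f τ) ∧
    (∀ σ : SL(2, ℤ), ∃ Cb : ℝ, ∀ τ : ℍ, 1 ≤ τ.im →
      ‖(((σ 1 0 : ℂ) * (τ : ℂ) + (σ 1 1 : ℂ)) ^ 2)⁻¹ * f (σ • τ)‖ ≤ Cb) ∧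
    (∀ τ : ℍ, f τ ≠ 0) ∧
    (∀ σ : SL(2, ℤ), (¬ ∃ γ ∈ Gamma0 M, (γ * σ) 1 0 = 0) →
      ∃ l : ℂ, l ≠ 0 ∧
        Filter.Tendsto
          (fun t : {t : ℝ // 0 < t} =>
            (((σ 1 0 : ℂ) * (Complex.I * (t : ℝ)) + (σ 1 1 : ℂ)) ^ 2)⁻¹ * f (σ • vpt t))
          Filter.atTop (nhds l)) := by
  simp only [hf]
  refine ⟨fun γ hγ τ ↦ h.etaQuot_smul hγ τ, h.exists_norm_slash_le,
    etaQuot_ne_zero s h.index_ne_zero, fun σ hσ ↦ h.exists_tendsto_slash σ fun hdvd ↦ hσ ?_⟩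
  refine ⟨σ⁻¹, inv_mem (Gamma0_mem.mpr ((ZMod.intCast_zmod_eq_zero_iff_dvd _ M).mpr hdvd)), ?_⟩
  simp

end IsCuspInftyQuotient

lemma isCuspInftyQuotient_four :
    IsCuspInftyQuotient 4 {2, 4} (fun δ ↦ if δ = 4 then 4 else -2) := by
  constructor <;> decide

lemma fac4_eq :
    fac4 = fun τ n ↦ etaQuotFactor {2, 4} (fun δ ↦ if δ = 4 then 4 else -2) (qq τ) n := by
  funext τ n
  simp [fac4, etaQuotFactor, ← pow_mul, mul_comm]

lemma R4_eq (τ : ℍ) : R4 τ = etaQuot {2, 4} (fun δ ↦ if δ = 4 then 4 else -2) τ := by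
  rw [etaQuot_eq_qq_pow_mul_tprod _ isCuspInftyQuotient_four.index_ne_zero (m := 1) (by decide),
    R4, fac4_eq, pow_one]

lemma isCuspInftyQuotient_eight :
    IsCuspInftyQuotient 8 {4, 8} (fun δ ↦ if δ = 8 then 4 else -2) := by
  constructor <;> decide

lemma fac8_eq :
    fac8 = fun τ n ↦ etaQuotFactor {4, 8} (fun δ ↦ if δ = 8 then 4 else -2) (qq τ) n := by
  funext τ n
  simp [fac8, etaQuotFactor, ← pow_mul, mul_comm]

lemma R8_eq (τ : ℍ) : R8 τ = etaQuot {4, 8} (fun δ ↦ if δ = 8 then 4 else -2) τ := by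
  rw [etaQuot_eq_qq_pow_mul_tprod _ isCuspInftyQuotient_eight.index_ne_zero (m := 2) (by decide),
    R8, fac8_eq]

/-- Half of the exponents of the eta-quotient `R₁₂`. -/
def expTwelve (δ : ℕ) : ℤ :=
  if δ = 12 then 6 else if δ = 2 then 1 else if δ = 6 then -3 else -2

lemma isCuspInftyQuotient_twelve : IsCuspInftyQuotient 12 {2, 4, 6, 12} expTwelve := by
  constructor <;> decide

lemma fac12_eq : fac12 = fun τ n ↦ etaQuotFactor {2, 4, 6, 12} expTwelve (qq τ) n := by
  funext τ n
  simp [fac12, etaQuotFactor, expTwelve, ← pow_mul]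
  ring

lemma R12_eq (τ : ℍ) : R12 τ = etaQuot {2, 4, 6, 12} expTwelve τ := by
  rw [etaQuot_eq_qq_pow_mul_tprod _ isCuspInftyQuotient_twelve.index_ne_zero (m := 4) (by decide),
    R12, fac12_eq]

lemma isCuspInftyQuotient_sixteen :
    IsCuspInftyQuotient 16 {8, 16} (fun δ ↦ if δ = 16 then 4 else -2) := by
  constructor <;> decide

lemma fac16_eq :
    fac16 = fun τ n ↦ etaQuotFactor {8, 16} (fun δ ↦ if δ = 16 then 4 else -2) (qq τ) n := by
  funext τ n
  simp [fac16, etaQuotFactor, ← pow_mul, mul_comm]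

lemma R16_eq (τ : ℍ) : R16 τ = etaQuot {8, 16} (fun δ ↦ if δ = 16 then 4 else -2) τ := by
  rw [etaQuot_eq_qq_pow_mul_tprod _ isCuspInftyQuotient_sixteen.index_ne_zero (m := 4) (by decide),
    R16, fac16_eq]

/-- The four infinite products converge locally uniformly on `ℍ`, and for each
`N ∈ {1,2,3,4}`: (a) `R_{4N}` transforms with weight `2` under `Γ₀(4N)`; (b) every slash of
`R_{4N}` by an element of `SL₂(ℤ)` is bounded on `{Im τ ≥ 1}` (so `R_{4N}` is a holomorphic
modular form of weight `2` on `Γ₀(4N)`); (c) `R_{4N}` is nonvanishing on `ℍ`; and (d) at every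
cusp `σ∞` not `Γ₀(4N)`-equivalent to `∞`, the limit of `(c·it+d)^{−2}·R_{4N}(σ(it))` as
`t → ∞` exists and is nonzero. -/
theorem statement9 :
    (TendstoLocallyUniformly
      (fun (s : Finset ℕ) (τ : ℍ) => ∏ n ∈ s, fac4 τ n) (fun τ => ∏' n : ℕ, fac4 τ n)
      Filter.atTop) ∧
    (TendstoLocallyUniformly
      (fun (s : Finset ℕ) (τ : ℍ) => ∏ n ∈ s, fac8 τ n) (fun τ => ∏' n : ℕ, fac8 τ n)
      Filter.atTop) ∧
    (TendstoLocallyUniformly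
      (fun (s : Finset ℕ) (τ : ℍ) => ∏ n ∈ s, fac12 τ n) (fun τ => ∏' n : ℕ, fac12 τ n)
      Filter.atTop) ∧
    (TendstoLocallyUniformly
      (fun (s : Finset ℕ) (τ : ℍ) => ∏ n ∈ s, fac16 τ n) (fun τ => ∏' n : ℕ, fac16 τ n)
      Filter.atTop) ∧
    ∀ N ∈ ({1, 2, 3, 4} : Finset ℕ),
      (∀ γ ∈ Gamma0 (4 * N), ∀ τ : ℍ,
        RR N (γ • τ) = ((γ 1 0 : ℂ) * (τ : ℂ) + (γ 1 1 : ℂ)) ^ 2 * RR N τ) ∧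
      (∀ σ : SL(2, ℤ), ∃ Cb : ℝ, ∀ τ : ℍ, 1 ≤ τ.im →
        ‖(((σ 1 0 : ℂ) * (τ : ℂ) + (σ 1 1 : ℂ)) ^ 2)⁻¹ * RR N (σ • τ)‖ ≤ Cb) ∧
      (∀ τ : ℍ, RR N τ ≠ 0) ∧
      (∀ σ : SL(2, ℤ), (¬ ∃ γ ∈ Gamma0 (4 * N), (γ * σ) 1 0 = 0) →
        ∃ l : ℂ, l ≠ 0 ∧
          Filter.Tendsto
            (fun t : {t : ℝ // 0 < t} =>
              (((σ 1 0 : ℂ) * (Complex.I * (t : ℝ)) + (σ 1 1 : ℂ)) ^ 2)⁻¹ * RR N (σ • vpt t))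
            Filter.atTop (nhds l)) := by
  refine ⟨?_, ?_, ?_, ?_, fun N hN ↦ ?_⟩
  · rw [fac4_eq]
    exact tendstoLocallyUniformly_etaQuotFactor _ isCuspInftyQuotient_four.index_ne_zero
  · rw [fac8_eq]
    exact tendstoLocallyUniformly_etaQuotFactor _ isCuspInftyQuotient_eight.index_ne_zero
  · rw [fac12_eq]
    exact tendstoLocallyUniformly_etaQuotFactor _ isCuspInftyQuotient_twelve.index_ne_zero
  · rw [fac16_eq]
    exact tendstoLocallyUniformly_etaQuotFactor _ isCuspInftyQuotient_sixteen.index_ne_zero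
  simp only [Finset.mem_insert, Finset.mem_singleton] at hN
  obtain rfl | rfl | rfl | rfl := hN
  · exact isCuspInftyQuotient_four.slash_properties R4_eq
  · exact isCuspInftyQuotient_eight.slash_properties R8_eq
  · exact isCuspInftyQuotient_twelve.slash_properties R12_eq
  · exact isCuspInftyQuotient_sixteen.slash_properties R16_eq

end
end
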